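/- Let 1/2 ≤ p < 1 be fixed, and for each n let A_n be the adjacency matrix of a uniformly random simple graph on n vertices with exactly m_n edges, where |m_n − p·binom(n,2)| = O(1). Let (t_n) be a sequence with n^{3/4}·t_n → ∞ and t_n → 0. Then, conditioned on the event {τ(A_n) ≤ p^3 − t_n}, with high probability the smallest eigenvalue λ_n(A_n) satisfies λ_n(A_n)^3 = −t_n n^3 (1 − o(1)) and the second-smallest eigenvalue satisfies λ_{n−1}(A_n)^3 ≥ −o(t_n n^3); that is, for every ε > 0 the conditional probability of the event {−(1+ε) t_n n^3 ≤ λ_n(A_n)^3 ≤ −(1−ε) t_n n^3 and λ_{n−1}(A_n)^3 ≥ −ε t_n n^3} given {τ(A_n) ≤ p^3 − t_n} tends to 1 as n → ∞. -/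

import Mathlib

open Filter MeasureTheory ProbabilityTheory Matrix
open scoped Topology ENNReal BigOperators

noncomputable section

/-- Extended-real logarithm of a real number: `⊥` for nonpositive inputs. -/
def elogR (x : ℝ) : EReal := if x ≤ 0 then ⊥ else ((Real.log x : ℝ) : EReal)

/-- Legendre transform of `f : ℝ → ℝ`, valued in the extended reals. -/
def legendre (f : ℝ → ℝ) (y : ℝ) : EReal := ⨆ x : ℝ, ((x * y - f x : ℝ) : EReal)

/-- Frobenius inner product of two square matrices. -/
def finner {n : ℕ} (A B : Matrix (Fin n) (Fin n) ℝ) : ℝ := ∑ i, ∑ j, A i j * B i j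

/-- Frobenius norm. -/
def fnorm {n : ℕ} (M : Matrix (Fin n) (Fin n) ℝ) : ℝ := Real.sqrt (finner M M)

open Classical in
/-- `eigDesc A i` is the `(i+1)`-st largest eigenvalue of a symmetric real matrix `A`
(0-indexed, so `eigDesc A 0 = λ_1` is the largest and `eigDesc A (n-1) = λ_n` the smallest);
junk value `0` out of range or for non-symmetric `A`. -/
def eigDesc {n : ℕ} (A : Matrix (Fin n) (Fin n) ℝ) (i : ℕ) : ℝ :=
  if h : i < n then
    (if hA : A.IsHermitian then
      hA.eigenvalues ((Tuple.sort hA.eigenvalues) (Fin.rev ⟨i, h⟩)) else 0)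
  else 0

/-- `singDesc A i` is the `(i+1)`-st largest singular value of `A` (0-indexed). -/
def singDesc {n : ℕ} (A : Matrix (Fin n) (Fin n) ℝ) (i : ℕ) : ℝ :=
  Real.sqrt (eigDesc (Aᵀ * A) i)

/-- Index type for potential edges: ordered pairs `i < j`. -/
abbrev EdgeIdx (n : ℕ) := {p : Fin n × Fin n // p.1 < p.2}

/-- Number of edges of the graph encoded by `g`. -/
def edgeCount {n : ℕ} (g : EdgeIdx n → Bool) : ℕ :=
  (Finset.univ.filter fun p => g p = true).card

/-- Adjacency matrix of the graph encoded by `g`. -/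
def adjOf {n : ℕ} (g : EdgeIdx n → Bool) : Matrix (Fin n) (Fin n) ℝ :=
  Matrix.of fun i j =>
    if h : i < j then (if g ⟨(i, j), h⟩ then 1 else 0)
    else if h' : j < i then (if g ⟨(j, i), h'⟩ then 1 else 0) else 0

open Classical in
/-- Probability, under the uniform distribution `G(n,m)` over simple graphs on `n` labeled
vertices with exactly `m` edges, that the adjacency matrix satisfies `pred`. -/
def grProb (n m : ℕ) (pred : Matrix (Fin n) (Fin n) ℝ → Prop) : ℝ :=
  ((Finset.univ.filter fun g : EdgeIdx n → Bool =>
      edgeCount g = m ∧ pred (adjOf g)).card : ℝ) /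
  ((Finset.univ.filter fun g : EdgeIdx n → Bool => edgeCount g = m).card : ℝ)

open Classical in
/-- Conditional probability of `pred` given `cond` under `G(n,m)`. -/
def condGrProb (n m : ℕ) (pred cond : Matrix (Fin n) (Fin n) ℝ → Prop) : ℝ :=
  ((Finset.univ.filter fun g : EdgeIdx n → Bool =>
      edgeCount g = m ∧ cond (adjOf g) ∧ pred (adjOf g)).card : ℝ) /
  ((Finset.univ.filter fun g : EdgeIdx n → Bool =>
      edgeCount g = m ∧ cond (adjOf g)).card : ℝ)

/-- Triangle density `tr(A³)/(n(n-1)(n-2))`. -/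
def triDensity {n : ℕ} (A : Matrix (Fin n) (Fin n) ℝ) : ℝ :=
  (A * A * A).trace / ((n : ℝ) * ((n : ℝ) - 1) * ((n : ℝ) - 2))

section BernoulliProduct

variable {ι : Type*} [Fintype ι] [DecidableEq ι]

/-- Mass of `g` under the product of the Bernoulli laws with parameters `q e`. -/
def bernWeight (q : ι → ℝ) (g : ι → Bool) : ℝ := ∏ e, if g e then q e else 1 - q e

/-- Expectation under the product of the Bernoulli laws with parameters `q e`. -/
def bernExp (q : ι → ℝ) (F : (ι → Bool) → ℝ) : ℝ := ∑ g, bernWeight q g * F g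

open Classical in
/-- Probability under the product of the Bernoulli laws with parameters `q e`. -/
def bernProb (q : ι → ℝ) (S : (ι → Bool) → Prop) : ℝ := bernExp q fun g => if S g then 1 else 0

/-- All parameters lie in `[0, 1]`. -/
def IsBern (q : ι → ℝ) : Prop := ∀ e, 0 ≤ q e ∧ q e ≤ 1

lemma bernWeight_nonneg {q : ι → ℝ} (hq : IsBern q) (g : ι → Bool) : 0 ≤ bernWeight q g := by
  refine Finset.prod_nonneg fun e _ => ?_
  split_ifs
  · exact (hq e).1
  · linarith [(hq e).2]

lemma bernExp_prod (q : ι → ℝ) (φ : ι → Bool → ℝ) :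
    bernExp q (fun g => ∏ e, φ e (g e)) = ∏ e, (q e * φ e true + (1 - q e) * φ e false) := by
  have h := Finset.prod_univ_sum (fun _ : ι => (Finset.univ : Finset Bool))
    (fun e b => (if b = true then q e else 1 - q e) * φ e b)
  rw [Fintype.piFinset_univ] at h
  simp only [Fintype.sum_bool] at h
  simp only [if_true, Bool.false_eq_true, if_false] at h
  rw [h]
  unfold bernExp bernWeight
  refine Finset.sum_congr rfl fun g _ => ?_
  rw [← Finset.prod_mul_distrib]

lemma bernExp_const (q : ι → ℝ) (c : ℝ) : bernExp q (fun _ => c) = c := by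
  have h := bernExp_prod q (fun _ _ => 1)
  simp only [Finset.prod_const_one, mul_one, add_sub_cancel] at h
  unfold bernExp at h ⊢
  simp only [mul_one] at h
  rw [← Finset.sum_mul, h, one_mul]

lemma bernExp_mono {q : ι → ℝ} (hq : IsBern q) {F G : (ι → Bool) → ℝ} (h : ∀ g, F g ≤ G g) :
    bernExp q F ≤ bernExp q G :=
  Finset.sum_le_sum fun g _ => mul_le_mul_of_nonneg_left (h g) (bernWeight_nonneg hq g)

lemma bernExp_add (q : ι → ℝ) (F G : (ι → Bool) → ℝ) :
    bernExp q (fun g => F g + G g) = bernExp q F + bernExp q G := by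
  simp [bernExp, mul_add, Finset.sum_add_distrib]

lemma bernExp_sub (q : ι → ℝ) (F G : (ι → Bool) → ℝ) :
    bernExp q (fun g => F g - G g) = bernExp q F - bernExp q G := by
  simp [bernExp, mul_sub, Finset.sum_sub_distrib]

lemma bernExp_const_mul (q : ι → ℝ) (c : ℝ) (F : (ι → Bool) → ℝ) :
    bernExp q (fun g => c * F g) = c * bernExp q F := by
  simp only [bernExp, Finset.mul_sum]
  exact Finset.sum_congr rfl fun g _ => by ring

lemma bernExp_sum {κ : Type*} (q : ι → ℝ) (s : Finset κ) (F : κ → (ι → Bool) → ℝ) :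
    bernExp q (fun g => ∑ k ∈ s, F k g) = ∑ k ∈ s, bernExp q (F k) := by
  simp only [bernExp, Finset.mul_sum]
  exact Finset.sum_comm

lemma bernExp_nonneg {q : ι → ℝ} (hq : IsBern q) {F : (ι → Bool) → ℝ} (h : ∀ g, 0 ≤ F g) :
    0 ≤ bernExp q F :=
  Finset.sum_nonneg fun g _ => mul_nonneg (bernWeight_nonneg hq g) (h g)

/-- Independence of distinct coordinates. -/
lemma bernExp_prod_finset (q : ι → ℝ) (s : Finset ι) (φ : ι → Bool → ℝ) :
    bernExp q (fun g => ∏ e ∈ s, φ e (g e)) =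
      ∏ e ∈ s, (q e * φ e true + (1 - q e) * φ e false) := by
  have h := bernExp_prod q (fun e b => if e ∈ s then φ e b else 1)
  have h1 : ∀ g : ι → Bool, (∏ e, if e ∈ s then φ e (g e) else 1) = ∏ e ∈ s, φ e (g e) :=
    fun g => by rw [Finset.prod_ite_mem, Finset.univ_inter]
  simp only [h1] at h
  rw [h, ← Finset.univ_inter s, ← Finset.prod_ite_mem, Finset.univ_inter]
  refine Finset.prod_congr rfl fun e _ => ?_
  split_ifs <;> ring

lemma bernProb_nonneg {q : ι → ℝ} (hq : IsBern q) (S : (ι → Bool) → Prop) : 0 ≤ bernProb q S :=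
  bernExp_nonneg hq fun g => by split_ifs <;> norm_num

lemma bernProb_mono {q : ι → ℝ} (hq : IsBern q) {S T : (ι → Bool) → Prop} (h : ∀ g, S g → T g) :
    bernProb q S ≤ bernProb q T := by
  refine bernExp_mono hq fun g => ?_
  by_cases hS : S g
  · simp [hS, h g hS]
  · simp only [hS, if_false]; split_ifs <;> norm_num

lemma bernProb_or_le {q : ι → ℝ} (hq : IsBern q) (S T : (ι → Bool) → Prop) :
    bernProb q (fun g => S g ∨ T g) ≤ bernProb q S + bernProb q T := by
  unfold bernProb
  rw [← bernExp_add]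
  refine bernExp_mono hq fun g => ?_
  by_cases hS : S g <;> by_cases hT : T g <;> simp [hS, hT]

lemma bernProb_exists_le {κ : Type*} {q : ι → ℝ} (hq : IsBern q) (s : Finset κ)
    (S : κ → (ι → Bool) → Prop) :
    bernProb q (fun g => ∃ k ∈ s, S k g) ≤ ∑ k ∈ s, bernProb q (S k) := by
  classical
  unfold bernProb
  rw [← bernExp_sum]
  refine bernExp_mono hq fun g => ?_
  split_ifs with h
  · obtain ⟨k, hk, hS⟩ := h
    have := Finset.single_le_sum (f := fun k => if S k g then (1 : ℝ) else 0)
      (fun i _ => by split_ifs <;> norm_num) hk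
    simpa [hS] using this
  · exact Finset.sum_nonneg fun i _ => by split_ifs <;> norm_num

lemma bernProb_not (q : ι → ℝ) (S : (ι → Bool) → Prop) :
    bernProb q (fun g => ¬ S g) = 1 - bernProb q S := by
  unfold bernProb
  rw [eq_sub_iff_add_eq, ← bernExp_add]
  conv_rhs => rw [← bernExp_const q 1]
  congr 1; funext g
  by_cases hS : S g <;> simp [hS]

/-- Markov's inequality. -/
lemma mul_bernProb_le_bernExp {q : ι → ℝ} (hq : IsBern q) {F : (ι → Bool) → ℝ}
    (hF : ∀ g, 0 ≤ F g) (a : ℝ) : a * bernProb q (fun g => a ≤ F g) ≤ bernExp q F := by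
  unfold bernProb
  rw [← bernExp_const_mul]
  refine bernExp_mono hq fun g => ?_
  split_ifs with h
  · simpa using h
  · simpa using hF g

/-- Chernoff's inequality. -/
lemma bernProb_le_exp_mul {q : ι → ℝ} (hq : IsBern q) (F : (ι → Bool) → ℝ) (a : ℝ) :
    bernProb q (fun g => a ≤ F g) ≤ Real.exp (-a) * bernExp q (fun g => Real.exp (F g)) := by
  unfold bernProb
  rw [← bernExp_const_mul]
  refine bernExp_mono hq fun g => ?_
  rw [← Real.exp_add]
  split_ifs with h
  · exact Real.one_le_exp (by linarith)
  · positivity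

/-- Jensen's inequality for the exponential. -/
lemma exp_bernExp_le {q : ι → ℝ} (hq : IsBern q) (F : (ι → Bool) → ℝ) :
    Real.exp (bernExp q F) ≤ bernExp q (fun g => Real.exp (F g)) := by
  have h : ∀ g, Real.exp (bernExp q F) * (F g - bernExp q F + 1) ≤ Real.exp (F g) := fun g => by
    calc _ ≤ Real.exp (bernExp q F) * Real.exp (F g - bernExp q F) :=
          mul_le_mul_of_nonneg_left (Real.add_one_le_exp _) (Real.exp_pos _).le
      _ = _ := by rw [← Real.exp_add]; congr 1; ring
  have h2 := bernExp_mono hq h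
  rw [bernExp_const_mul, bernExp_add, bernExp_sub, bernExp_const, bernExp_const] at h2
  simpa using h2

lemma bernExp_comp_equiv {κ : Type*} [Fintype κ] [DecidableEq κ] (σ : κ ≃ ι) (q : ι → ℝ)
    (F : (ι → Bool) → ℝ) :
    bernExp q F = bernExp (fun k => q (σ k)) (fun g => F fun e => g (σ.symm e)) := by
  unfold bernExp bernWeight
  refine Fintype.sum_equiv (Equiv.arrowCongr σ.symm (Equiv.refl Bool)) _ _ fun g => ?_
  congr 1
  · rw [← Equiv.prod_comp σ]
    simp [Equiv.arrowCongr]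
  · simp [Equiv.arrowCongr]

end BernoulliProduct

lemma bernExp_succ {N : ℕ} (q : Fin (N + 1) → ℝ) (F : (Fin (N + 1) → Bool) → ℝ) :
    bernExp q F = bernExp (fun i => q i.succ)
      (fun g => q 0 * F (Fin.cons true g) + (1 - q 0) * F (Fin.cons false g)) := by
  unfold bernExp bernWeight
  rw [← (Fin.consEquiv (fun _ : Fin (N + 1) => Bool)).sum_comp, Fintype.sum_prod_type,
    Fintype.sum_bool, ← Finset.sum_add_distrib]
  refine Finset.sum_congr rfl fun g _ => ?_
  simp [Fin.consEquiv, Fin.prod_univ_succ]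
  ring

section ConvexConcentration

lemma exp_neg_add_exp_sub_sq_le_two {d : ℝ} (h0 : 0 ≤ d) (h1 : d ≤ 1 / 2) :
    Real.exp (-d) + Real.exp (d - d ^ 2) ≤ 2 := by
  have a := Real.exp_bound' (x := d - d^2) (by nlinarith) (by nlinarith) (n := 3) (by norm_num)
  have b : Real.exp (-d) ≤ 1 - d + d ^ 2 / 2 := by
    rw [Real.exp_neg]
    have h := Real.quadratic_le_exp_of_nonneg h0
    rw [inv_le_comm₀ (Real.exp_pos _) (by nlinarith)]
    have h3 := Real.sum_le_exp_of_nonneg h0 4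
    norm_num [Finset.sum_range_succ, Nat.factorial] at h3
    refine le_trans ?_ h3
    rw [inv_le_iff_one_le_mul₀ (by nlinarith)]
    nlinarith [pow_nonneg h0 3, pow_nonneg h0 4, pow_nonneg h0 5,
      mul_nonneg (pow_nonneg h0 3) (sub_nonneg.2 h1), mul_nonneg (pow_nonneg h0 4) (sub_nonneg.2 h1)]
  norm_num [Finset.sum_range_succ, Nat.factorial] at a
  have hd2 : 0 ≤ d - d ^ 2 := by nlinarith
  have c : (d - d^2)^2 = d^2 - 2*d^3 + d^4 := by ring
  have e : (d - d^2)^3 ≤ d^3 := by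
    apply pow_le_pow_left₀ hd2; nlinarith
  nlinarith [pow_nonneg h0 3, mul_nonneg (pow_nonneg h0 3) (sub_nonneg.2 h1)]

/-- One-dimensional infimum-convolution inequality at the two endpoints of `[0, 1]`. -/
lemma two_point_infConv {q u v k₀ k₁ : ℝ} (hq0 : 0 ≤ q) (hq1 : q ≤ 1)
    (h₀ : ∀ s : ℝ, 0 ≤ s → s ≤ 1 → k₀ ≤ (1 - s) * u + s * v + s ^ 2 / 4)
    (h₁ : ∀ s : ℝ, 0 ≤ s → s ≤ 1 → k₁ ≤ (1 - s) * v + s * u + s ^ 2 / 4) :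
    (q * Real.exp k₁ + (1 - q) * Real.exp k₀) *
      (q * Real.exp (-v) + (1 - q) * Real.exp (-u)) ≤ 1 := by
  wlog huv : u ≤ v generalizing q u v k₀ k₁
  · have := this (q := 1 - q) (u := v) (v := u) (k₀ := k₁) (k₁ := k₀) (by linarith) (by linarith)
      h₁ h₀ (by linarith)
    calc _ = _ := by ring
      _ ≤ 1 := this
  have e0 : k₀ ≤ u := by simpa using h₀ 0 le_rfl zero_le_one
  have e1 : k₁ ≤ v := by simpa using h₁ 0 le_rfl zero_le_one
  have key : Real.exp (k₁ - u) + Real.exp (u - v) ≤ 2 := by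
    rcases le_or_gt (v - u) (1 / 2) with h | h
    · have := h₁ (2 * (v - u)) (by linarith) (by linarith)
      have h2 : k₁ - u ≤ (v - u) - (v - u) ^ 2 := by nlinarith
      have := exp_neg_add_exp_sub_sq_le_two (d := v - u) (by linarith) h
      have := Real.exp_le_exp.2 h2
      rw [neg_sub] at *
      linarith
    · have := h₁ 1 zero_le_one le_rfl
      have h2 : Real.exp (k₁ - u) ≤ Real.exp (1 / 4) := Real.exp_le_exp.2 (by linarith)
      have h3 : Real.exp (u - v) ≤ Real.exp (-(1 / 2)) := Real.exp_le_exp.2 (by linarith)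
      have h4 := Real.exp_bound' (x := 1 / 4) (by norm_num) (by norm_num) (n := 3) (by norm_num)
      have h5 : Real.exp (-(1 / 2)) ≤ 2 / 3 := by
        rw [Real.exp_neg, inv_le_comm₀ (Real.exp_pos _) (by norm_num)]
        have := Real.add_one_le_exp (1 / 2 : ℝ); norm_num at this ⊢; linarith
      norm_num [Finset.sum_range_succ, Nat.factorial] at h4
      linarith
  have ex : (q * Real.exp k₁ + (1 - q) * Real.exp k₀) *
      (q * Real.exp (-v) + (1 - q) * Real.exp (-u)) =
      q ^ 2 * Real.exp (k₁ - v) + (1 - q) ^ 2 * Real.exp (k₀ - u)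
      + q * (1 - q) * (Real.exp (k₁ - u) + Real.exp (k₀ - v)) := by
    simp only [sub_eq_add_neg, Real.exp_add]; ring
  rw [ex]
  have a1 : Real.exp (k₁ - v) ≤ 1 := Real.exp_le_one_iff.2 (by linarith)
  have a2 : Real.exp (k₀ - u) ≤ 1 := Real.exp_le_one_iff.2 (by linarith)
  have a3 : Real.exp (k₀ - v) ≤ Real.exp (u - v) := Real.exp_le_exp.2 (by linarith)
  have b1 := mul_le_mul_of_nonneg_left a1 (sq_nonneg q)
  have b2 := mul_le_mul_of_nonneg_left a2 (sq_nonneg (1 - q))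
  have b3 := mul_le_mul_of_nonneg_left (add_le_add_right a3 (Real.exp (k₁ - u)) |>.trans key)
    (mul_nonneg hq0 (sub_nonneg.2 hq1))
  nlinarith

end ConvexConcentration

section InfConv

lemma convexOn_log_mix_exp {E : Type*} [AddCommGroup E] [Module ℝ E] {s : Set E} {k₁ k₀ : E → ℝ}
    {q : ℝ} (hq0 : 0 ≤ q) (hq1 : q ≤ 1) (h₁ : ConvexOn ℝ s k₁) (h₀ : ConvexOn ℝ s k₀) :
    ConvexOn ℝ s fun y => Real.log (q * Real.exp (k₁ y) + (1 - q) * Real.exp (k₀ y)) := by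
  have hpos : ∀ a b : ℝ, 0 < q * Real.exp a + (1 - q) * Real.exp b := fun a b => by
    rcases hq0.eq_or_lt with h | h
    · subst h; simp [Real.exp_pos]
    · have := mul_pos h (Real.exp_pos a)
      have := mul_nonneg (sub_nonneg.2 hq1) (Real.exp_pos b).le
      linarith
  refine ⟨h₁.1, fun x hx y hy a b ha hb hab => ?_⟩
  simp only [smul_eq_mul]
  set gx := Real.log (q * Real.exp (k₁ x) + (1 - q) * Real.exp (k₀ x)) with hgx
  set gy := Real.log (q * Real.exp (k₁ y) + (1 - q) * Real.exp (k₀ y)) with hgy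
  have nx : q * Real.exp (k₁ x - gx) + (1 - q) * Real.exp (k₀ x - gx) = 1 := by
    rw [Real.exp_sub, Real.exp_sub, hgx, Real.exp_log (hpos _ _)]
    field_simp [(hpos (k₁ x) (k₀ x)).ne']
  have ny : q * Real.exp (k₁ y - gy) + (1 - q) * Real.exp (k₀ y - gy) = 1 := by
    rw [Real.exp_sub, Real.exp_sub, hgy, Real.exp_log (hpos _ _)]
    field_simp [(hpos (k₁ y) (k₀ y)).ne']
  have step : ∀ k : E → ℝ, ConvexOn ℝ s k →
      Real.exp (k (a • x + b • y) - (a * gx + b * gy)) ≤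
        a * Real.exp (k x - gx) + b * Real.exp (k y - gy) := fun k hk => by
    have e1 := hk.2 hx hy ha hb hab
    simp only [smul_eq_mul] at e1
    have e2 := convexOn_exp.2 (Set.mem_univ (k x - gx)) (Set.mem_univ (k y - gy)) ha hb hab
    simp only [smul_eq_mul] at e2
    refine le_trans (Real.exp_le_exp.2 ?_) e2
    linarith
  have s1 := mul_le_mul_of_nonneg_left (step k₁ h₁) hq0
  have s0 := mul_le_mul_of_nonneg_left (step k₀ h₀) (sub_nonneg.2 hq1)
  rw [Real.log_le_iff_le_exp (hpos _ _)]
  have e : ∀ z : ℝ, Real.exp z = Real.exp (z - (a * gx + b * gy)) * Real.exp (a * gx + b * gy) :=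
    fun z => by rw [← Real.exp_add]; congr 1; ring
  rw [e (k₁ _), e (k₀ _)]
  calc _ = (q * Real.exp (k₁ (a • x + b • y) - (a * gx + b * gy)) +
        (1 - q) * Real.exp (k₀ (a • x + b • y) - (a * gx + b * gy))) *
        Real.exp (a * gx + b * gy) := by ring
    _ ≤ 1 * Real.exp (a * gx + b * gy) := by
        refine mul_le_mul_of_nonneg_right ?_ (Real.exp_pos _).le
        calc _ ≤ _ := add_le_add s1 s0
          _ = a * (q * Real.exp (k₁ x - gx) + (1 - q) * Real.exp (k₀ x - gx)) +
              b * (q * Real.exp (k₁ y - gy) + (1 - q) * Real.exp (k₀ y - gy)) := by ring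
          _ = 1 := by rw [nx, ny]; linarith
    _ = _ := one_mul _

/-- The value `1` or `0` of a Boolean. -/
def boolVal (b : Bool) : ℝ := if b then 1 else 0

lemma boolVal_mem (b : Bool) : 0 ≤ boolVal b ∧ boolVal b ≤ 1 := by
  cases b <;> simp [boolVal]

lemma cons_mem_cube {N : ℕ} {u : ℝ} {y : Fin N → ℝ} (hu : u ∈ Set.Icc (0 : ℝ) 1)
    (hy : y ∈ Set.Icc (0 : Fin N → ℝ) 1) :
    (Fin.cons u y : Fin (N + 1) → ℝ) ∈ Set.Icc (0 : Fin (N + 1) → ℝ) 1 := by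
  refine ⟨fun i => ?_, fun i => ?_⟩ <;> refine Fin.cases ?_ (fun j => ?_) i
  · simpa using hu.1
  · simpa using hy.1 j
  · simpa using hu.2
  · simpa using hy.2 j

/-- Partial infimal convolution of `f` with `(c - ·)² / 4` in the first coordinate. -/
def partialInfConv {N : ℕ} (f : (Fin (N + 1) → ℝ) → ℝ) (c : ℝ) (y : Fin N → ℝ) : ℝ :=
  ⨅ u : Set.Icc (0 : ℝ) 1, (f (Fin.cons u.1 y) + (c - u.1) ^ 2 / 4)

section

variable {N : ℕ} {f : (Fin (N + 1) → ℝ) → ℝ} {b : ℝ}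

lemma partialInfConv_bddBelow (hb : ∀ y ∈ Set.Icc (0 : Fin (N + 1) → ℝ) 1, b ≤ f y) (c : ℝ)
    {y : Fin N → ℝ} (hy : y ∈ Set.Icc (0 : Fin N → ℝ) 1) :
    BddBelow (Set.range fun u : Set.Icc (0 : ℝ) 1 =>
      (f (Fin.cons u.1 y) + (c - u.1) ^ 2 / 4)) := by
  refine ⟨b, ?_⟩
  rintro _ ⟨u, rfl⟩
  have := hb _ (cons_mem_cube u.2 hy)
  simp only
  nlinarith [sq_nonneg (c - u.1)]

lemma partialInfConv_le (hb : ∀ y ∈ Set.Icc (0 : Fin (N + 1) → ℝ) 1, b ≤ f y) (c : ℝ)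
    {y : Fin N → ℝ} (hy : y ∈ Set.Icc (0 : Fin N → ℝ) 1) {u : ℝ} (hu : u ∈ Set.Icc (0 : ℝ) 1) :
    partialInfConv f c y ≤ f (Fin.cons u y) + (c - u) ^ 2 / 4 :=
  ciInf_le (partialInfConv_bddBelow hb c hy) ⟨u, hu⟩

lemma le_partialInfConv {c a : ℝ} {y : Fin N → ℝ}
    (h : ∀ u ∈ Set.Icc (0 : ℝ) 1, a ≤ f (Fin.cons u y) + (c - u) ^ 2 / 4) :
    a ≤ partialInfConv f c y := by
  have : Nonempty (Set.Icc (0 : ℝ) 1) := ⟨⟨0, by simp⟩⟩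
  exact le_ciInf fun u => h u.1 u.2

lemma convexOn_partialInfConv (hf : ConvexOn ℝ (Set.Icc (0 : Fin (N + 1) → ℝ) 1) f)
    (hb : ∀ y ∈ Set.Icc (0 : Fin (N + 1) → ℝ) 1, b ≤ f y) (c : ℝ) :
    ConvexOn ℝ (Set.Icc (0 : Fin N → ℝ) 1) (partialInfConv f c) := by
  have : Nonempty (Set.Icc (0 : ℝ) 1) := ⟨⟨0, by simp⟩⟩
  refine ⟨convex_Icc _ _, fun x hx y hy s t hs ht hst => ?_⟩
  refine le_of_forall_pos_le_add fun ε hε => ?_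
  obtain ⟨u, hu⟩ := exists_lt_of_ciInf_lt
    (show partialInfConv f c x < partialInfConv f c x + ε by linarith)
  obtain ⟨v, hv⟩ := exists_lt_of_ciInf_lt
    (show partialInfConv f c y < partialInfConv f c y + ε by linarith)
  have hw : s * u.1 + t * v.1 ∈ Set.Icc (0 : ℝ) 1 := by
    have := convex_Icc (0 : ℝ) 1 u.2 v.2 hs ht hst
    simpa using this
  have h1 := partialInfConv_le hb c (convex_Icc _ _ hx hy hs ht hst) hw
  have h2 := hf.2 (cons_mem_cube u.2 hx) (cons_mem_cube v.2 hy) hs ht hst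
  have e : (s • Fin.cons u.1 x + t • Fin.cons v.1 y : Fin (N + 1) → ℝ) =
      Fin.cons (s * u.1 + t * v.1) (s • x + t • y) := by
    funext i
    refine Fin.cases ?_ (fun j => ?_) i <;> simp
  rw [e] at h2
  simp only [smul_eq_mul] at h2 ⊢
  have h3 : (c - (s * u.1 + t * v.1)) ^ 2 ≤ s * (c - u.1) ^ 2 + t * (c - v.1) ^ 2 := by
    have ht' : t = 1 - s := by linarith
    subst ht'
    nlinarith [mul_nonneg (mul_nonneg hs ht) (sq_nonneg (u.1 - v.1))]
  have h4 := mul_le_mul_of_nonneg_left hu.le hs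
  have h5 := mul_le_mul_of_nonneg_left hv.le ht
  have h6 : s * ε + t * ε = ε := by rw [← add_mul, hst, one_mul]
  nlinarith

end

/-- Infimal-convolution inequality for convex functions and product Bernoulli measures. -/
lemma bernExp_infConv : ∀ {N : ℕ} {q : Fin N → ℝ}, IsBern q → ∀ {f : (Fin N → ℝ) → ℝ},
    ConvexOn ℝ (Set.Icc (0 : Fin N → ℝ) 1) f → (∃ b, ∀ y ∈ Set.Icc (0 : Fin N → ℝ) 1, b ≤ f y) →
    ∀ {h : (Fin N → Bool) → ℝ}, (∀ g, ∀ y ∈ Set.Icc (0 : Fin N → ℝ) 1,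
      h g ≤ f y + (∑ i, (boolVal (g i) - y i) ^ 2) / 4) →
    bernExp q (fun g => Real.exp (h g)) *
      bernExp q (fun g => Real.exp (-f fun i => boolVal (g i))) ≤ 1 := by
  intro N
  induction N with
  | zero =>
    intro q _ f _ _ h hh
    simp only [bernExp, bernWeight, Finset.univ_unique, Finset.sum_singleton,
      Finset.univ_eq_empty, Finset.prod_empty, one_mul]
    rw [← Real.exp_add]
    apply Real.exp_le_one_iff.2
    set g₀ : Fin 0 → Bool := @default _ Unique.instInhabited
    have := hh g₀ (fun i => boolVal (g₀ i))
      ⟨fun i => i.elim0, fun i => i.elim0⟩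
    simp only [Finset.univ_eq_empty, Finset.sum_empty, zero_div, add_zero] at this
    rw [← sub_eq_add_neg, sub_nonpos]
    exact this
  | succ N ih =>
    intro q hq f hf hb h hh
    obtain ⟨b, hb⟩ := hb
    have hq0 := (hq 0).1
    have hq1 := (hq 0).2
    set q' : Fin N → ℝ := fun i => q i.succ
    have hq' : IsBern q' := fun i => hq i.succ
    have hpos : ∀ a b : ℝ, 0 < q 0 * Real.exp a + (1 - q 0) * Real.exp b := fun a b => by
      rcases hq0.eq_or_lt with h | h
      · rw [← h]; simp [Real.exp_pos]
      · have := mul_pos h (Real.exp_pos a)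
        have := mul_nonneg (sub_nonneg.2 hq1) (Real.exp_pos b).le
        linarith
    set k := partialInfConv f
    set G : (Fin N → ℝ) → ℝ := fun y =>
      Real.log (q 0 * Real.exp (k 1 y) + (1 - q 0) * Real.exp (k 0 y)) with hG
    have hkb : ∀ c, ∀ y ∈ Set.Icc (0 : Fin N → ℝ) 1, b ≤ k c y := fun c y hy =>
      le_partialInfConv fun u hu => by
        have := hb _ (cons_mem_cube hu hy)
        nlinarith [sq_nonneg (c - u)]
    have hGc : ConvexOn ℝ (Set.Icc (0 : Fin N → ℝ) 1) G :=
      convexOn_log_mix_exp hq0 hq1 (convexOn_partialInfConv hf hb 1)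
        (convexOn_partialInfConv hf hb 0)
    have hGb : ∀ y ∈ Set.Icc (0 : Fin N → ℝ) 1, b ≤ G y := fun y hy => by
      rw [hG, Real.le_log_iff_exp_le (hpos _ _)]
      have h1 := mul_le_mul_of_nonneg_left (Real.exp_le_exp.2 (hkb 1 y hy)) hq0
      have h0 := mul_le_mul_of_nonneg_left (Real.exp_le_exp.2 (hkb 0 y hy)) (sub_nonneg.2 hq1)
      linarith
    have hstep : ∀ g, ∀ y ∈ Set.Icc (0 : Fin N → ℝ) 1,
        Real.log (q 0 * Real.exp (h (Fin.cons true g)) + (1 - q 0) * Real.exp (h (Fin.cons false g)))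
          ≤ G y + (∑ i, (boolVal (g i) - y i) ^ 2) / 4 := fun g y hy => by
      rw [Real.log_le_iff_le_exp (hpos _ _), Real.exp_add, hG, Real.exp_log (hpos _ _), add_mul,
        mul_assoc, mul_assoc, ← Real.exp_add, ← Real.exp_add]
      have aux : ∀ s : Bool, h (Fin.cons s g) ≤
          k (boolVal s) y + (∑ i, (boolVal (g i) - y i) ^ 2) / 4 := fun s => by
        rw [← sub_le_iff_le_add]
        refine le_partialInfConv fun u hu => ?_
        have := hh (Fin.cons s g) _ (cons_mem_cube hu hy)
        rw [Fin.sum_univ_succ] at this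
        simp only [Fin.cons_zero, Fin.cons_succ] at this
        linarith
      have a1 := aux true
      have a0 := aux false
      simp only [boolVal, if_true, Bool.false_eq_true, if_false] at a1 a0
      exact add_le_add (mul_le_mul_of_nonneg_left (Real.exp_le_exp.2 a1) hq0)
        (mul_le_mul_of_nonneg_left (Real.exp_le_exp.2 a0) (sub_nonneg.2 hq1))
    have hih := ih hq' hGc ⟨b, hGb⟩ hstep
    simp only [Real.exp_log (hpos _ _)] at hih
    rw [bernExp_succ, bernExp_succ]
    refine le_trans (mul_le_mul_of_nonneg_left ?_ (bernExp_nonneg hq' fun g => (hpos _ _).le)) hih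
    refine bernExp_mono hq' fun g => ?_
    set y : Fin N → ℝ := fun i => boolVal (g i)
    have hy : y ∈ Set.Icc (0 : Fin N → ℝ) 1 :=
      ⟨fun i => (boolVal_mem _).1, fun i => (boolVal_mem _).2⟩
    have c1 : ∀ s : Bool, (fun i => boolVal ((Fin.cons s g : Fin (N + 1) → Bool) i)) =
        (Fin.cons (boolVal s) y : Fin (N + 1) → ℝ) := fun s => by
      funext i; refine Fin.cases ?_ (fun j => ?_) i <;> simp [y]
    simp only [c1]
    have chord : ∀ s : ℝ, 0 ≤ s → s ≤ 1 → f (Fin.cons s y) ≤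
        (1 - s) * f (Fin.cons 0 y) + s * f (Fin.cons 1 y) := fun s hs0 hs1 => by
      have := hf.2 (cons_mem_cube (u := 0) (by simp) hy) (cons_mem_cube (u := 1) (by simp) hy)
        (sub_nonneg.2 hs1) hs0 (by ring)
      have e : ((1 - s) • Fin.cons 0 y + s • Fin.cons 1 y : Fin (N + 1) → ℝ) = Fin.cons s y := by
        funext i; refine Fin.cases ?_ (fun j => ?_) i <;> simp; ring
      rw [e] at this
      simpa using this
    have key := two_point_infConv (q := q 0) (u := f (Fin.cons 0 y)) (v := f (Fin.cons 1 y))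
      (k₀ := k 0 y) (k₁ := k 1 y) hq0 hq1
      (fun s h0 h1 => by
        have := partialInfConv_le hb 0 hy (u := s) ⟨h0, h1⟩
        have := chord s h0 h1
        nlinarith)
      (fun s h0 h1 => by
        have := partialInfConv_le hb 1 hy (u := 1 - s) ⟨by linarith, by linarith⟩
        have := chord (1 - s) (by linarith) (by linarith)
        nlinarith)
    have hGy : Real.exp (-G y) = (q 0 * Real.exp (k 1 y) + (1 - q 0) * Real.exp (k 0 y))⁻¹ := by
      rw [Real.exp_neg, hG, Real.exp_log (hpos _ _)]
    rw [hGy, ← one_div, le_div_iff₀' (hpos _ _)]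
    simpa [boolVal] using key

variable {ι : Type*} [Fintype ι] [DecidableEq ι]

/-- Exponential concentration of convex Lipschitz functions of Bernoulli variables. -/
lemma bernExp_convex_lipschitz {q : ι → ℝ} (hq : IsBern q) {f : (ι → ℝ) → ℝ}
    (hf : ConvexOn ℝ Set.univ f) {L : ℝ}
    (hL : ∀ x y, f x ≤ f y + L * Real.sqrt (∑ i, (x i - y i) ^ 2))
    {c : ℝ} (hc : 0 ≤ c) :
    bernExp q (fun g => Real.exp (c * f fun i => boolVal (g i))) *
      bernExp q (fun g => Real.exp (-(c * f fun i => boolVal (g i)))) ≤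
        Real.exp (c ^ 2 * L ^ 2) := by
  set N := Fintype.card ι
  set σ : Fin N ≃ ι := (Fintype.equivFin ι).symm
  set F : (Fin N → ℝ) → ℝ := fun y => c * f fun e => y (σ.symm e)
  have hFL : ∀ x y : Fin N → ℝ, F x - c ^ 2 * L ^ 2 ≤ F y + (∑ i, (x i - y i) ^ 2) / 4 :=
      fun x y => by
    have h1 := mul_le_mul_of_nonneg_left (hL (fun e => x (σ.symm e)) fun e => y (σ.symm e)) hc
    rw [Equiv.sum_comp σ.symm fun i => (x i - y i) ^ 2] at h1
    set S := ∑ i, (x i - y i) ^ 2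
    have hS : 0 ≤ S := Finset.sum_nonneg fun i _ => sq_nonneg _
    have h2 := Real.sq_sqrt hS
    simp only [F]
    nlinarith [sq_nonneg (Real.sqrt S / 2 - c * L)]
  have hFc : ConvexOn ℝ (Set.Icc (0 : Fin N → ℝ) 1) F := by
    refine ⟨convex_Icc _ _, fun x _ y _ a b ha hb hab => ?_⟩
    have := hf.2 (Set.mem_univ fun e => x (σ.symm e)) (Set.mem_univ fun e => y (σ.symm e))
      ha hb hab
    have h2 := mul_le_mul_of_nonneg_left this hc
    simp only [F, smul_eq_mul] at h2 ⊢
    refine le_trans (le_of_eq rfl) (h2.trans (le_of_eq (by ring)))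
  have hFb : ∃ b, ∀ y ∈ Set.Icc (0 : Fin N → ℝ) 1, b ≤ F y := by
    refine ⟨F 0 - c ^ 2 * L ^ 2 - N / 4, fun y hy => ?_⟩
    have h1 := hFL 0 y
    have h2 : ∑ i, ((0 : Fin N → ℝ) i - y i) ^ 2 ≤ N := by
      calc _ ≤ ∑ i : Fin N, (1 : ℝ) := Finset.sum_le_sum fun i _ => by
            have a := hy.1 i; have b := hy.2 i
            simp only [Pi.zero_apply, Pi.one_apply] at a b ⊢
            nlinarith
        _ = N := by simp
    linarith
  have key := bernExp_infConv (q := fun k => q (σ k)) (fun k => hq _) hFc hFb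
    (h := fun g => F (fun i => boolVal (g i)) - c ^ 2 * L ^ 2) fun g y _ => hFL (fun i => boolVal (g i)) y
  rw [bernExp_comp_equiv σ, bernExp_comp_equiv σ q (fun g => Real.exp (-(c * f fun i => boolVal (g i))))]
  have e : bernExp (fun k => q (σ k)) (fun g => Real.exp (F (fun i => boolVal (g i)) - c ^ 2 * L ^ 2))
      = Real.exp (-(c ^ 2 * L ^ 2)) *
        bernExp (fun k => q (σ k)) (fun g => Real.exp (F fun i => boolVal (g i))) := by
    rw [← bernExp_const_mul]
    congr 1; funext g; rw [← Real.exp_add]; congr 1; ring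
  rw [e, mul_assoc, Real.exp_neg, inv_mul_le_iff₀ (Real.exp_pos _), mul_one] at key
  exact key

lemma bernProb_convex_lipschitz {q : ι → ℝ} (hq : IsBern q) {f : (ι → ℝ) → ℝ}
    (hf : ConvexOn ℝ Set.univ f) {L : ℝ} (hL0 : 0 < L)
    (hL : ∀ x y, f x ≤ f y + L * Real.sqrt (∑ i, (x i - y i) ^ 2)) {a : ℝ} (ha : 0 ≤ a) :
    bernProb q (fun g => bernExp q (fun g => f fun i => boolVal (g i)) + a ≤
      f fun i => boolVal (g i)) ≤ Real.exp (-(a ^ 2 / (4 * L ^ 2))) ∧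
    bernProb q (fun g => (f fun i => boolVal (g i)) ≤
      bernExp q (fun g => f fun i => boolVal (g i)) - a) ≤ Real.exp (-(a ^ 2 / (4 * L ^ 2))) := by
  set φ : (ι → Bool) → ℝ := fun g => f fun i => boolVal (g i)
  set m := bernExp q φ
  set c := a / (2 * L ^ 2)
  have hc : 0 ≤ c := by positivity
  have key := bernExp_convex_lipschitz hq hf hL hc
  have ecalc : -(c * a) + c ^ 2 * L ^ 2 = -(a ^ 2 / (4 * L ^ 2)) := by
    simp only [c]; field_simp; ring
  have j1 := exp_bernExp_le hq (fun g => c * φ g)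
  have j2 := exp_bernExp_le hq (fun g => -(c * φ g))
  have e2 : bernExp q (fun g => -(c * φ g)) = -(c * m) := by
    have := bernExp_const_mul q (-c) φ
    simpa [neg_mul] using this
  rw [bernExp_const_mul] at j1
  rw [e2] at j2
  have u1 : bernExp q (fun g => Real.exp (c * φ g)) ≤ Real.exp (c * m + c ^ 2 * L ^ 2) := by
    have := (mul_le_mul_of_nonneg_left j2 (bernExp_nonneg hq fun g =>
      (Real.exp_pos (c * φ g)).le)).trans key
    rw [Real.exp_neg, ← div_eq_mul_inv, div_le_iff₀ (Real.exp_pos _), ← Real.exp_add] at this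
    rwa [add_comm]
  have u2 : bernExp q (fun g => Real.exp (-(c * φ g))) ≤ Real.exp (-(c * m) + c ^ 2 * L ^ 2) := by
    have := (mul_le_mul_of_nonneg_right j1 (bernExp_nonneg hq fun g =>
      (Real.exp_pos (-(c * φ g))).le)).trans key
    rw [← le_div_iff₀' (Real.exp_pos _), ← Real.exp_sub] at this
    refine this.trans (le_of_eq ?_)
    congr 1; ring
  constructor
  · calc _ ≤ bernProb q (fun g => c * (m + a) ≤ c * φ g) :=
          bernProb_mono hq fun g h => mul_le_mul_of_nonneg_left h hc
      _ ≤ _ := bernProb_le_exp_mul hq _ _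
      _ ≤ Real.exp (-(c * (m + a))) * Real.exp (c * m + c ^ 2 * L ^ 2) :=
          mul_le_mul_of_nonneg_left u1 (Real.exp_pos _).le
      _ = _ := by rw [← Real.exp_add, ← ecalc]; congr 1; ring
  · calc _ ≤ bernProb q (fun g => -(c * (m - a)) ≤ -(c * φ g)) :=
          bernProb_mono hq fun g h => neg_le_neg (mul_le_mul_of_nonneg_left h hc)
      _ ≤ _ := bernProb_le_exp_mul hq _ _
      _ ≤ Real.exp (-(-(c * (m - a)))) * Real.exp (-(c * m) + c ^ 2 * L ^ 2) :=
          mul_le_mul_of_nonneg_left u2 (Real.exp_pos _).le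
      _ = _ := by rw [← Real.exp_add, ← ecalc]; congr 1; ring

end InfConv

section Spectral

variable {ι : Type*} [Fintype ι] [DecidableEq ι] {A B : Matrix ι ι ℝ}

/-- The orthogonal matrix of eigenvectors of a symmetric real matrix. -/
def eigMat (hA : A.IsHermitian) : Matrix ι ι ℝ := (hA.eigenvectorUnitary : Matrix ι ι ℝ)

lemma eigMat_transpose_mul (hA : A.IsHermitian) : (eigMat hA)ᵀ * eigMat hA = 1 := by
  have h := Unitary.coe_star_mul_self hA.eigenvectorUnitary
  rwa [star_eq_conjTranspose, conjTranspose_eq_transpose_of_trivial] at h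

lemma eigMat_mul_transpose (hA : A.IsHermitian) : eigMat hA * (eigMat hA)ᵀ = 1 :=
  mul_eq_one_comm.1 (eigMat_transpose_mul hA)

lemma eq_eigMat_mul (hA : A.IsHermitian) :
    A = eigMat hA * diagonal hA.eigenvalues * (eigMat hA)ᵀ := by
  have h := hA.spectral_theorem
  rw [Unitary.conjStarAlgAut_apply, star_eq_conjTranspose,
    conjTranspose_eq_transpose_of_trivial] at h
  exact h

lemma apply_eq_sum_eigenvalues (hA : A.IsHermitian) (a b : ι) :
    A a b = ∑ i, hA.eigenvalues i * eigMat hA a i * eigMat hA b i := by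
  conv_lhs => rw [eq_eigMat_mul hA]
  rw [mul_apply]
  refine Finset.sum_congr rfl fun i _ => ?_
  rw [mul_diagonal, transpose_apply]; ring

lemma eigMat_conj (hA : A.IsHermitian) :
    (eigMat hA)ᵀ * A * eigMat hA = diagonal hA.eigenvalues := by
  calc _ = (eigMat hA)ᵀ * (eigMat hA * diagonal hA.eigenvalues * (eigMat hA)ᵀ) * eigMat hA := by
        rw [← eq_eigMat_mul hA]
    _ = ((eigMat hA)ᵀ * eigMat hA) * diagonal hA.eigenvalues *
      ((eigMat hA)ᵀ * eigMat hA) := by simp only [Matrix.mul_assoc]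
    _ = _ := by simp [eigMat_transpose_mul]

lemma trace_pow_two_eq (hA : A.IsHermitian) :
    (A * A).trace = ∑ i, hA.eigenvalues i ^ 2 := by
  conv_lhs => rw [eq_eigMat_mul hA]
  set O := eigMat hA
  have hO : Oᵀ * O = 1 := eigMat_transpose_mul hA
  calc _ = (O * (diagonal hA.eigenvalues * (Oᵀ * O) * diagonal hA.eigenvalues * Oᵀ)).trace := by
        simp only [Matrix.mul_assoc]
    _ = (diagonal hA.eigenvalues * diagonal hA.eigenvalues).trace := by
        rw [trace_mul_comm, hO]
        simp only [Matrix.mul_assoc, hO, Matrix.mul_one]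
    _ = _ := by
        rw [diagonal_mul_diagonal, trace_diagonal]
        simp [sq]

lemma trace_pow_three_eq (hA : A.IsHermitian) :
    (A * A * A).trace = ∑ i, hA.eigenvalues i ^ 3 := by
  conv_lhs => rw [eq_eigMat_mul hA]
  set O := eigMat hA
  set D := diagonal hA.eigenvalues with hD
  have hO : Oᵀ * O = 1 := eigMat_transpose_mul hA
  calc _ = (O * (D * (Oᵀ * O) * D * (Oᵀ * O) * D * Oᵀ)).trace := by
        simp only [Matrix.mul_assoc]
    _ = (D * D * D).trace := by
        rw [trace_mul_comm, hO]
        simp only [Matrix.mul_assoc, hO, Matrix.mul_one]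
    _ = _ := by
        rw [hD, diagonal_mul_diagonal, diagonal_mul_diagonal, trace_diagonal]
        refine Finset.sum_congr rfl fun i _ => ?_
        ring

lemma sum_sq_eq_sum_eigenvalues_sq (hA : A.IsHermitian) :
    ∑ i, ∑ j, A i j ^ 2 = ∑ i, hA.eigenvalues i ^ 2 := by
  rw [← trace_pow_two_eq hA]
  refine Finset.sum_congr rfl fun i _ => ?_
  rw [diag_apply, mul_apply]
  refine Finset.sum_congr rfl fun j _ => ?_
  have : A j i = A i j := by
    have := hA.apply i j
    simpa using this
  rw [this, sq]

lemma sum_apply_conj_le {f : ℝ → ℝ} (hf : ConvexOn ℝ Set.univ f) (hA : A.IsHermitian)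
    {W : Matrix ι ι ℝ} (hW : Wᵀ * W = 1) :
    ∑ i, f ((Wᵀ * A * W) i i) ≤ ∑ i, f (hA.eigenvalues i) := by
  have hW' : W * Wᵀ = 1 := mul_eq_one_comm.1 hW
  set V := Wᵀ * eigMat hA with hV
  have hVV : V * Vᵀ = 1 := by
    rw [hV, transpose_mul, transpose_transpose]
    calc _ = Wᵀ * (eigMat hA * (eigMat hA)ᵀ) * W := by simp only [Matrix.mul_assoc]
      _ = 1 := by rw [eigMat_mul_transpose, Matrix.mul_one, hW]
  have hVV' : Vᵀ * V = 1 := mul_eq_one_comm.1 hVV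
  have hrow : ∀ i, ∑ j, V i j ^ 2 = 1 := fun i => by
    have := congrFun (congrFun hVV i) i
    rw [mul_apply, one_apply_eq] at this
    simpa [sq] using this
  have hcol : ∀ j, ∑ i, V i j ^ 2 = 1 := fun j => by
    have := congrFun (congrFun hVV' j) j
    rw [mul_apply, one_apply_eq] at this
    simpa [sq] using this
  have hval : ∀ i, (Wᵀ * A * W) i i = ∑ j, V i j ^ 2 * hA.eigenvalues j := fun i => by
    have : Wᵀ * A * W = V * diagonal hA.eigenvalues * Vᵀ := by
      conv_lhs => rw [eq_eigMat_mul hA]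
      rw [hV, transpose_mul, transpose_transpose]
      simp only [Matrix.mul_assoc]
    rw [this, mul_apply]
    refine Finset.sum_congr rfl fun j _ => ?_
    rw [mul_diagonal, transpose_apply]; ring
  calc ∑ i, f ((Wᵀ * A * W) i i) ≤ ∑ i, ∑ j, V i j ^ 2 * f (hA.eigenvalues j) := by
        refine Finset.sum_le_sum fun i _ => ?_
        rw [hval]
        have := hf.map_sum_le (t := Finset.univ) (w := fun j => V i j ^ 2)
          (p := hA.eigenvalues) (fun j _ => sq_nonneg _) (hrow i) (fun _ _ => Set.mem_univ _)
        simpa [smul_eq_mul] using this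
    _ = ∑ j, f (hA.eigenvalues j) := by
        rw [Finset.sum_comm]
        refine Finset.sum_congr rfl fun j _ => ?_
        rw [← Finset.sum_mul, hcol, one_mul]

open Classical in
/-- The trace of `f` applied to a symmetric matrix (`0` for other matrices). -/
def specSum (f : ℝ → ℝ) (A : Matrix ι ι ℝ) : ℝ :=
  if hA : A.IsHermitian then ∑ i, f (hA.eigenvalues i) else 0

lemma specSum_eq (f : ℝ → ℝ) (hA : A.IsHermitian) :
    specSum f A = ∑ i, f (hA.eigenvalues i) := dif_pos hA

lemma specSum_eq_conj (f : ℝ → ℝ) (hA : A.IsHermitian) :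
    specSum f A = ∑ i, f (((eigMat hA)ᵀ * A * eigMat hA) i i) := by
  simp [specSum_eq f hA, eigMat_conj]

lemma specSum_mix_le {f : ℝ → ℝ} (hf : ConvexOn ℝ Set.univ f) (hA : A.IsHermitian)
    (hB : B.IsHermitian) {a b : ℝ} (ha : 0 ≤ a) (hb : 0 ≤ b) (hab : a + b = 1) :
    specSum f (a • A + b • B) ≤ a * specSum f A + b * specSum f B := by
  have hC : (a • A + b • B).IsHermitian := by
    have h1 : (a • A).IsHermitian := by
      rw [IsHermitian, conjTranspose_smul, hA.eq]; simp
    have h2 : (b • B).IsHermitian := by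
      rw [IsHermitian, conjTranspose_smul, hB.eq]; simp
    exact h1.add h2
  set W := eigMat hC with hW
  have hWW : Wᵀ * W = 1 := eigMat_transpose_mul hC
  rw [specSum_eq_conj f hC, specSum_eq f hA, specSum_eq f hB, ← hW]
  calc _ ≤ ∑ i, (a * f ((Wᵀ * A * W) i i) + b * f ((Wᵀ * B * W) i i)) := by
        refine Finset.sum_le_sum fun i _ => ?_
        have h : (Wᵀ * (a • A + b • B) * W) i i
            = a • (Wᵀ * A * W) i i + b • (Wᵀ * B * W) i i := by
          simp [Matrix.mul_add, Matrix.add_mul]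
        rw [h]
        exact hf.2 (Set.mem_univ _) (Set.mem_univ _) ha hb hab
    _ ≤ _ := by
        rw [Finset.sum_add_distrib, ← Finset.mul_sum, ← Finset.mul_sum]
        exact add_le_add (mul_le_mul_of_nonneg_left (sum_apply_conj_le hf hA hWW) ha)
          (mul_le_mul_of_nonneg_left (sum_apply_conj_le hf hB hWW) hb)

lemma specSum_le_add {f : ℝ → ℝ} (hf : ConvexOn ℝ Set.univ f) {L : ℝ} (hL0 : 0 ≤ L)
    (hL : ∀ x y, f x ≤ f y + L * |x - y|) (hA : A.IsHermitian) (hB : B.IsHermitian) :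
    specSum f A ≤ specSum f B +
      L * √(Fintype.card ι) * √(∑ i, ∑ j, (A i j - B i j) ^ 2) := by
  have hC : (A - B).IsHermitian := hA.sub hB
  set W := eigMat hA with hW
  have hWW : Wᵀ * W = 1 := eigMat_transpose_mul hA
  set d : ι → ℝ := fun i => (Wᵀ * (A - B) * W) i i with hd
  have hd2 : ∑ i, d i ^ 2 ≤ ∑ i, ∑ j, (A i j - B i j) ^ 2 := by
    have h2 : ConvexOn ℝ Set.univ fun x : ℝ => x ^ 2 := (even_two).convexOn_pow
    have := sum_apply_conj_le h2 hC hWW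
    rw [← sum_sq_eq_sum_eigenvalues_sq hC] at this
    simpa using this
  have hd1 : ∑ i, |d i| ≤ √(Fintype.card ι) * √(∑ i, ∑ j, (A i j - B i j) ^ 2) := by
    rw [← Real.sqrt_mul (by positivity)]
    refine Real.le_sqrt_of_sq_le ?_
    calc (∑ i, |d i|) ^ 2 ≤ (Finset.univ : Finset ι).card * ∑ i, |d i| ^ 2 :=
          sq_sum_le_card_mul_sum_sq
      _ ≤ _ := by
          simp only [sq_abs, Finset.card_univ]
          gcongr
  rw [specSum_eq_conj f hA, specSum_eq f hB, ← hW]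
  calc _ ≤ ∑ i, (f ((Wᵀ * B * W) i i) + L * |d i|) := by
        refine Finset.sum_le_sum fun i _ => ?_
        refine (hL _ ((Wᵀ * B * W) i i)).trans_eq ?_
        simp [hd, Matrix.mul_sub, Matrix.sub_mul]
    _ ≤ _ := by
        rw [Finset.sum_add_distrib, ← Finset.mul_sum, mul_assoc L]
        exact add_le_add (sum_apply_conj_le hf hB hWW) (mul_le_mul_of_nonneg_left hd1 hL0)

end Spectral

section Bulk

/-- The largest convex function lying below the positive part of the cube and affine
beyond `R`. -/
def bulkCube (R x : ℝ) : ℝ :=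
  3 * (max 0 (min x R)) ^ 2 * x - 2 * (max 0 (min x R)) ^ 3

variable {R : ℝ}

lemma bulkCube_of_nonpos (hR : 0 ≤ R) {x : ℝ} (hx : x ≤ 0) : bulkCube R x = 0 := by
  have : max 0 (min x R) = 0 := max_eq_left (by rw [min_eq_left (hx.trans hR)]; exact hx)
  simp [bulkCube, this]

lemma bulkCube_of_mem {x : ℝ} (hx : 0 ≤ x) (hxR : x ≤ R) : bulkCube R x = x ^ 3 := by
  have : max 0 (min x R) = x := by rw [min_eq_left hxR, max_eq_right hx]
  rw [bulkCube, this]; ring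

lemma bulkCube_of_ge (hR : 0 ≤ R) {x : ℝ} (hx : R ≤ x) :
    bulkCube R x = 3 * R ^ 2 * x - 2 * R ^ 3 := by
  have : max 0 (min x R) = R := by rw [min_eq_right hx, max_eq_right hR]
  rw [bulkCube, this]

lemma tangent_le_bulkCube {c : ℝ} (hc : 0 ≤ c) (hcR : c ≤ R) (x : ℝ) :
    3 * c ^ 2 * x - 2 * c ^ 3 ≤ bulkCube R x := by
  have hR := hc.trans hcR
  rcases le_total x 0 with h | h
  · rw [bulkCube_of_nonpos hR h]
    have := mul_nonneg (sq_nonneg c) (neg_nonneg.2 h)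
    have := pow_nonneg hc 3
    nlinarith
  rcases le_total x R with h' | h'
  · rw [bulkCube_of_mem h h']
    nlinarith [mul_nonneg (sq_nonneg (x - c)) (add_nonneg h (mul_nonneg zero_le_two hc))]
  · rw [bulkCube_of_ge hR h']
    have h1 : 0 ≤ (R - c) * (R + c) * (x - R) :=
      mul_nonneg (mul_nonneg (by linarith) (by linarith)) (by linarith)
    have h2 : 0 ≤ (R - c) ^ 2 * (R + 2 * c) := mul_nonneg (sq_nonneg _) (by linarith)
    nlinarith

lemma convexOn_bulkCube (hR : 0 ≤ R) : ConvexOn ℝ Set.univ (bulkCube R) := by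
  refine ⟨convex_univ, fun x _ y _ a b ha hb hab => ?_⟩
  have hc0 : 0 ≤ max 0 (min (a • x + b • y) R) := le_max_left _ _
  have hcR : max 0 (min (a • x + b • y) R) ≤ R := max_le hR (min_le_right _ _)
  have h1 := mul_le_mul_of_nonneg_left (tangent_le_bulkCube hc0 hcR x) ha
  have h2 := mul_le_mul_of_nonneg_left (tangent_le_bulkCube hc0 hcR y) hb
  rw [bulkCube]
  set c := max 0 (min (a • x + b • y) R)
  simp only [smul_eq_mul] at *
  obtain rfl : b = 1 - a := by linarith
  nlinarith

lemma bulkCube_nonneg (hR : 0 ≤ R) (x : ℝ) : 0 ≤ bulkCube R x := by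
  simpa using tangent_le_bulkCube le_rfl hR x

lemma bulkCube_le_add (hR : 0 ≤ R) (x y : ℝ) :
    bulkCube R x ≤ bulkCube R y + 3 * R ^ 2 * max 0 (x - y) := by
  have hc0 : 0 ≤ max 0 (min x R) := le_max_left _ _
  have hcR : max 0 (min x R) ≤ R := max_le hR (min_le_right _ _)
  have h1 := tangent_le_bulkCube hc0 hcR y
  rw [bulkCube]
  set c := max 0 (min x R)
  have h2 : c ^ 2 * (x - y) ≤ R ^ 2 * max 0 (x - y) := by
    calc c ^ 2 * (x - y) ≤ c ^ 2 * max 0 (x - y) := by gcongr; exact le_max_right _ _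
      _ ≤ _ := by gcongr
  nlinarith

lemma bulkCube_le_add_abs (hR : 0 ≤ R) (x y : ℝ) :
    bulkCube R x ≤ bulkCube R y + 3 * R ^ 2 * |x - y| := by
  refine (bulkCube_le_add hR x y).trans ?_
  gcongr
  exact max_le (abs_nonneg _) (le_abs_self _)

lemma bulkCube_le_mul (hR : 0 ≤ R) {x : ℝ} (hx : 0 ≤ x) : bulkCube R x ≤ 3 * R ^ 2 * x := by
  have := bulkCube_le_add hR x 0
  rwa [bulkCube_of_nonpos hR le_rfl, zero_add, sub_zero, max_eq_right hx] at this

lemma bulkCube_le_cube {x : ℝ} (hx : 0 ≤ x) : bulkCube R x ≤ x ^ 3 := by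
  have hc0 : 0 ≤ max 0 (min x R) := le_max_left _ _
  rw [bulkCube]
  set c := max 0 (min x R)
  nlinarith [mul_nonneg (sq_nonneg (x - c)) (add_nonneg hx (mul_nonneg zero_le_two hc0))]

lemma convexOn_bulkCube_neg (hR : 0 ≤ R) : ConvexOn ℝ Set.univ fun x => bulkCube R (-x) := by
  have h := convexOn_bulkCube hR
  refine ⟨convex_univ, fun x _ y _ a b ha hb hab => ?_⟩
  have := h.2 (Set.mem_univ (-x)) (Set.mem_univ (-y)) ha hb hab
  simp only [smul_eq_mul] at this ⊢
  convert this using 2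
  ring

end Bulk

section SubGaussian

lemma mul_sinh_le {u w : ℝ} (hu : 0 ≤ u) (huw : u ≤ w) : w * Real.sinh u ≤ u * Real.sinh w := by
  have hconv : ConvexOn ℝ (Set.Ici (0 : ℝ)) Real.sinh := by
    refine convexOn_of_deriv2_nonneg (convex_Ici 0) Real.continuous_sinh.continuousOn
      Real.differentiable_sinh.differentiableOn ?_ ?_
    · rw [Real.deriv_sinh]; exact Real.differentiable_cosh.differentiableOn
    · intro x hx
      simp only [Function.iterate_succ, Function.iterate_zero, Function.comp_def, id,
        Real.deriv_sinh, Real.deriv_cosh]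
      rw [interior_Ici] at hx
      exact (Real.sinh_pos_iff.2 hx).le
  rcases hu.eq_or_lt with rfl | hu'
  · simp
  have hw : 0 < w := hu'.trans_le huw
  have h := hconv.2 (Set.mem_Ici.2 (le_refl (0 : ℝ))) (Set.mem_Ici.2 hw.le)
    (show 0 ≤ 1 - u / w by rw [sub_nonneg, div_le_one hw]; exact huw)
    (show 0 ≤ u / w by positivity) (by ring)
  simp only [smul_eq_mul, mul_zero, zero_add, Real.sinh_zero] at h
  rw [div_mul_cancel₀ _ hw.ne'] at h
  calc w * Real.sinh u ≤ w * (u / w * Real.sinh w) := by gcongr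
    _ = _ := by field_simp

lemma mul_sinh_mul_cosh_le {x y : ℝ} (hx : 0 ≤ x) (hxy : x ≤ y) :
    x * (Real.cosh x * Real.sinh y) ≤ y * (Real.sinh x * Real.cosh y) := by
  have h := mul_sinh_le (sub_nonneg.2 hxy) (show y - x ≤ y + x by linarith)
  rw [Real.sinh_sub, Real.sinh_add] at h
  nlinarith

lemma cosh_le_cosh_mul_exp {a : ℝ} (ha : 0 < a) (x : ℝ) :
    Real.cosh x ≤ Real.cosh a *
      Real.exp ((x ^ 2 - a ^ 2) * (Real.sinh a / Real.cosh a / a) / 2) := by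
  wlog hx : 0 ≤ x generalizing x
  · have := this (-x) (by linarith)
    rwa [Real.cosh_neg, neg_sq] at this
  set c := Real.sinh a / Real.cosh a / a with hc
  set F : ℝ → ℝ := fun x => Real.log (Real.cosh x) - c * x ^ 2 / 2 with hF
  have hd : ∀ x, HasDerivAt F (Real.sinh x / Real.cosh x - c * x) x := fun x => by
    have h1 := (Real.hasDerivAt_cosh x).log (Real.cosh_pos x).ne'
    have h2 := ((hasDerivAt_pow 2 x).const_mul c).div_const 2
    refine (h1.sub h2).congr_deriv ?_
    simp; ring
  have hcont : Continuous F := continuous_iff_continuousAt.2 fun x => (hd x).continuousAt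
  have hcosh := Real.cosh_pos
  have hle : F x ≤ F a := by
    rcases le_total x a with h | h
    · refine monotoneOn_of_deriv_nonneg (convex_Icc 0 a) hcont.continuousOn
        (fun y _ => (hd y).differentiableAt.differentiableWithinAt) (fun y hy => ?_)
        ⟨hx, h⟩ ⟨ha.le, le_rfl⟩ h
      rw [interior_Icc] at hy
      rw [(hd y).deriv, sub_nonneg, hc, le_div_iff₀ (hcosh y), div_div, div_mul_eq_mul_div,
        div_mul_eq_mul_div, div_le_iff₀ (mul_pos (hcosh a) ha)]
      have := mul_sinh_mul_cosh_le hy.1.le hy.2.le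
      nlinarith
    · refine antitoneOn_of_deriv_nonpos (convex_Ici a) hcont.continuousOn
        (fun y _ => (hd y).differentiableAt.differentiableWithinAt) (fun y hy => ?_)
        (Set.mem_Ici.2 le_rfl) (Set.mem_Ici.2 h) h
      rw [interior_Ici] at hy
      rw [(hd y).deriv, sub_nonpos, hc, div_le_iff₀ (hcosh y), div_div, div_mul_eq_mul_div,
        div_mul_eq_mul_div, le_div_iff₀ (mul_pos (hcosh a) ha)]
      have := mul_sinh_mul_cosh_le ha.le (le_of_lt hy)
      nlinarith
  have h2 : Real.log (Real.cosh x) ≤ Real.log (Real.cosh a) + (x ^ 2 - a ^ 2) * c / 2 := by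
    simp only [hF] at hle
    linarith
  calc Real.cosh x = Real.exp (Real.log (Real.cosh x)) := (Real.exp_log (hcosh x)).symm
    _ ≤ Real.exp (Real.log (Real.cosh a) + (x ^ 2 - a ^ 2) * c / 2) := Real.exp_le_exp.2 h2
    _ = _ := by rw [Real.exp_add, Real.exp_log (hcosh a)]

/-- Relative entropy of Bernoulli variables with parameters `q` and `p`. -/
def bernKL (q p : ℝ) : ℝ := q * Real.log (q / p) + (1 - q) * Real.log ((1 - q) / (1 - p))

lemma bernKL_le {q p : ℝ} (hq : 0 < q) (hq1 : q < 1) (hp : 0 < p) (hp1 : p < 1) :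
    bernKL q p ≤ (q - p) ^ 2 / (p * (1 - p)) := by
  have hq' : 0 < 1 - q := by linarith
  have hp' : 0 < 1 - p := by linarith
  have h1 := mul_le_mul_of_nonneg_left (Real.log_le_sub_one_of_pos (div_pos hq hp)) hq.le
  have h2 := mul_le_mul_of_nonneg_left (Real.log_le_sub_one_of_pos (div_pos hq' hp')) hq'.le
  refine (add_le_add h1 h2).trans_eq ?_
  field_simp
  ring

lemma bernKL_half_le {x : ℝ} (hx : 0 < x) (hx1 : x ≤ 1 / 2) :
    bernKL (1 / 2 - x / 2) (1 / 2) ≤ (1 + 4 * x) * (x ^ 2 / 2) := by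
  have ha : |x| < 1 := by rw [abs_of_pos hx]; linarith
  have ha' : |-x| < 1 := by rwa [abs_neg]
  have h1 := (abs_le.1 (Real.abs_log_sub_add_sum_range_le ha 2)).2
  have h2 := (abs_le.1 (Real.abs_log_sub_add_sum_range_le ha' 2)).2
  simp only [Finset.sum_range_succ, Finset.sum_range_zero] at h1 h2
  rw [abs_neg] at h2
  rw [abs_of_pos hx] at h1 h2
  have he : x ^ (2 + 1) / (1 - x) ≤ 2 * x ^ 3 := by
    rw [div_le_iff₀ (by linarith)]
    have : x ^ 3 * (1 / 2) ≤ x ^ 3 * (1 - x) := by gcongr; linarith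
    norm_num
    linarith
  norm_num at h1 h2
  norm_num at he
  rw [bernKL]
  have e1 : (1 / 2 - x / 2) / (1 / 2) = 1 - x := by ring
  have e2 : (1 - (1 / 2 - x / 2)) / (1 - 1 / 2) = 1 + x := by ring
  rw [e1, e2]
  have h3 : (1 - x) * Real.log (1 - x) ≤ (1 - x) * (2 * x ^ 3 - x - x ^ 2 / 2) :=
    mul_le_mul_of_nonneg_left (by linarith) (by linarith)
  have h4 : (1 + x) * Real.log (1 + x) ≤ (1 + x) * (2 * x ^ 3 + x - x ^ 2 / 2) :=
    mul_le_mul_of_nonneg_left (by linarith) (by linarith)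
  nlinarith

/-- For `1 / 2 ≤ p < 1` a centered Bernoulli variable is sub-Gaussian with a variance proxy
that is attained by the relative entropy of a downward shift. -/
lemma exists_variance_proxy {p : ℝ} (hp : 1 / 2 ≤ p) (hp1 : p < 1) :
    ∃ v : ℝ, 0 < v ∧
      (∀ s : ℝ, p * Real.exp (s * (1 - p)) + (1 - p) * Real.exp (-(s * p)) ≤
        Real.exp (v * s ^ 2 / 2)) ∧
      ∀ η : ℝ, 0 < η → ∃ δ : ℝ, 0 < δ ∧ δ < p ∧
        bernKL (p - δ) p ≤ (1 + η) * (δ ^ 2 / (2 * v)) := by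
  rcases hp.eq_or_lt with rfl | hp'
  · refine ⟨1 / 4, by norm_num, fun s => ?_, fun η hη => ?_⟩
    · have := Real.cosh_le_exp_half_sq (s / 2)
      rw [Real.cosh_eq] at this
      convert this using 1
      · ring_nf
      · ring_nf
    · have hx : 0 < min (1 / 2) (η / 4) := lt_min (by norm_num) (by linarith)
      have h1 := min_le_left (1 / 2) (η / 4)
      have h2 := min_le_right (1 / 2) (η / 4)
      set x := min (1 / 2) (η / 4)
      refine ⟨x / 2, by linarith, by linarith, (bernKL_half_le hx h1).trans ?_⟩
      have : (x / 2) ^ 2 / (2 * (1 / 4)) = x ^ 2 / 2 := by ring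
      rw [this]
      gcongr
      linarith
  · have hq : 0 < 1 - p := by linarith
    have hp0 : 0 < p := by linarith
    set l := Real.log (p / (1 - p)) with hl
    have hl0 : 0 < l := Real.log_pos (by rw [lt_div_iff₀ hq]; linarith)
    have hexp : Real.exp (l / 2) ^ 2 = p / (1 - p) := by
      rw [← Real.exp_nat_mul, hl]
      rw [show ((2 : ℕ) : ℝ) * (Real.log (p / (1 - p)) / 2) = Real.log (p / (1 - p)) by
        push_cast; ring]
      exact Real.exp_log (div_pos hp0 hq)
    set E := Real.exp (l / 2) with hE
    have hE0 : 0 < E := Real.exp_pos _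
    have hpE : p = (1 - p) * E ^ 2 := by rw [hexp]; field_simp
    have hcosh : Real.cosh (l / 2) = (E + E⁻¹) / 2 := by
      rw [Real.cosh_eq, Real.exp_neg]
    have hsinh : Real.sinh (l / 2) = (E - E⁻¹) / 2 := by
      rw [Real.sinh_eq, Real.exp_neg]
    have htanh : Real.sinh (l / 2) / Real.cosh (l / 2) = 2 * p - 1 := by
      rw [hcosh, hsinh, div_eq_iff (by positivity)]
      field_simp
      nlinarith
    refine ⟨(2 * p - 1) / (2 * l), div_pos (by linarith) (by linarith), fun s => ?_,
      fun η hη => ⟨2 * p - 1, by linarith, by linarith, ?_⟩⟩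
    · have h := cosh_le_cosh_mul_exp (half_pos hl0) ((s + l) / 2)
      rw [htanh] at h
      have h2 : p * Real.exp (s * (1 - p)) + (1 - p) * Real.exp (-(s * p))
          = Real.exp (s * (1 / 2 - p)) *
            (Real.cosh ((s + l) / 2) / Real.cosh (l / 2)) := by
        rw [hcosh, Real.cosh_eq]
        rw [show (s + l) / 2 = s / 2 + l / 2 by ring, neg_add, Real.exp_add, Real.exp_add,
          Real.exp_neg (l / 2), ← hE,
          show s * (1 - p) = s * (1 / 2 - p) + s / 2 by ring,
          show -(s * p) = s * (1 / 2 - p) + -(s / 2) by ring, Real.exp_add, Real.exp_add]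
        have e1 : p = E / (E + E⁻¹) := by
          rw [eq_div_iff (by positivity)]
          field_simp
          nlinarith
        have e2 : 1 - p = E⁻¹ / (E + E⁻¹) := by
          rw [eq_div_iff (by positivity)]
          field_simp
          nlinarith
        generalize Real.exp (s * (1 / 2 - p)) = G
        rw [e2]
        nth_rewrite 1 [e1]
        field_simp
      rw [h2]
      calc _ ≤ Real.exp (s * (1 / 2 - p)) * Real.exp ((((s + l) / 2) ^ 2 - (l / 2) ^ 2) *
            ((2 * p - 1) / (l / 2)) / 2) := by
            gcongr
            rw [div_le_iff₀ (Real.cosh_pos _), mul_comm]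
            exact h
        _ = _ := by
            rw [← Real.exp_add]
            congr 1
            field_simp
            ring
    · have e : bernKL (p - (2 * p - 1)) p = (2 * p - 1) * l := by
        rw [bernKL, show p - (2 * p - 1) = 1 - p by ring, sub_sub_cancel, hl,
          ← inv_div p (1 - p), Real.log_inv]
        ring
      rw [e]
      have : (2 * p - 1) ^ 2 / (2 * ((2 * p - 1) / (2 * l))) = (2 * p - 1) * l := by
        have : 2 * p - 1 ≠ 0 := by linarith
        field_simp
      rw [this]
      have := mul_pos (show 0 < 2 * p - 1 by linarith) hl0
      nlinarith

lemma exp_le_add_exp_sq (x : ℝ) : Real.exp x ≤ x + Real.exp (x ^ 2) := by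
  have h2 := Real.add_one_le_exp (x ^ 2)
  rcases le_total |x| 1 with h | h
  · have := (abs_le.1 (Real.abs_exp_sub_one_sub_id_le h)).2
    linarith
  · rcases le_total 0 x with h0 | h0
    · rw [abs_of_nonneg h0] at h
      have : Real.exp x ≤ Real.exp (x ^ 2) := Real.exp_le_exp.2 (by nlinarith)
      linarith
    · rw [abs_of_nonpos h0] at h
      have : Real.exp x ≤ 1 := Real.exp_le_one_iff.2 h0
      nlinarith

lemma mgf_two_point_le {q x₁ x₀ c : ℝ} (hq : 0 ≤ q) (hq1 : q ≤ 1)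
    (hm : q * x₁ + (1 - q) * x₀ = 0) (h₁ : |x₁| ≤ c) (h₀ : |x₀| ≤ c) :
    q * Real.exp x₁ + (1 - q) * Real.exp x₀ ≤ Real.exp (c ^ 2) := by
  have key : ∀ x : ℝ, |x| ≤ c → Real.exp x ≤ x + Real.exp (c ^ 2) := fun x hx =>
    (exp_le_add_exp_sq x).trans (by
      have : x ^ 2 ≤ c ^ 2 := sq_le_sq.2 (hx.trans (le_abs_self c))
      gcongr)
  have := mul_le_mul_of_nonneg_left (key _ h₁) hq
  have := mul_le_mul_of_nonneg_left (key _ h₀) (sub_nonneg.2 hq1)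
  nlinarith

variable {ι : Type*} [Fintype ι] [DecidableEq ι]

/-- Hoeffding's inequality for sums of independent centered two-valued variables. -/
lemma bernProb_sum_ge_le {q : ι → ℝ} (hq : IsBern q) {X : ι → Bool → ℝ} {c y : ℝ}
    (hm : ∀ e, q e * X e true + (1 - q e) * X e false = 0)
    (hc : 0 < c) (hX : ∀ e b, |X e b| ≤ c) (hy : 0 ≤ y) (N : ℝ) (hN : Fintype.card ι ≤ N)
    (hN0 : 0 < N) :
    bernProb q (fun g => y ≤ ∑ e, X e (g e)) ≤ Real.exp (-(y ^ 2 / (4 * N * c ^ 2))) := by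
  set s := y / (2 * N * c ^ 2) with hs
  have hs0 : 0 ≤ s := by positivity
  have h1 : bernProb q (fun g => y ≤ ∑ e, X e (g e)) ≤
      bernProb q (fun g => s * y ≤ ∑ e, s * X e (g e)) := by
    refine bernProb_mono hq fun g hg => ?_
    rw [← Finset.mul_sum]
    exact mul_le_mul_of_nonneg_left hg hs0
  refine (h1.trans (bernProb_le_exp_mul hq _ _)).trans ?_
  have h2 : bernExp q (fun g => Real.exp (∑ e, s * X e (g e))) ≤
      Real.exp (N * (s * c) ^ 2) := by
    simp_rw [Real.exp_sum]
    rw [bernExp_prod q fun e b => Real.exp (s * X e b)]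
    calc _ ≤ ∏ _e : ι, Real.exp ((s * c) ^ 2) := by
          refine Finset.prod_le_prod (fun e _ => ?_) fun e _ => ?_
          · have := hq e
            have := mul_nonneg this.1 (Real.exp_pos (s * X e true)).le
            have := mul_nonneg (sub_nonneg.2 (hq e).2) (Real.exp_pos (s * X e false)).le
            linarith
          · refine mgf_two_point_le (hq e).1 (hq e).2 ?_ ?_ ?_
            · have := hm e
              calc _ = s * (q e * X e true + (1 - q e) * X e false) := by ring
                _ = 0 := by rw [this, mul_zero]
            · rw [abs_mul, abs_of_nonneg hs0]
              exact mul_le_mul_of_nonneg_left (hX _ _) hs0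
            · rw [abs_mul, abs_of_nonneg hs0]
              exact mul_le_mul_of_nonneg_left (hX _ _) hs0
      _ ≤ _ := by
          rw [Finset.prod_const, ← Real.exp_nat_mul, Finset.card_univ]
          gcongr
  calc _ ≤ Real.exp (-(s * y)) * Real.exp (N * (s * c) ^ 2) := by gcongr
    _ = _ := by
        rw [← Real.exp_add]
        congr 1
        rw [hs]
        field_simp
        ring

end SubGaussian

section EdgeMatrix

variable {n : ℕ}

/-- The symmetric matrix with zero diagonal and prescribed entries above the diagonal. -/
def smat (x : EdgeIdx n → ℝ) : Matrix (Fin n) (Fin n) ℝ :=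
  Matrix.of fun i j =>
    if h : i < j then x ⟨(i, j), h⟩ else if h' : j < i then x ⟨(j, i), h'⟩ else 0

lemma adjOf_eq_smat (g : EdgeIdx n → Bool) : adjOf g = smat fun e => boolVal (g e) := rfl

lemma smat_of_lt (x : EdgeIdx n → ℝ) {i j : Fin n} (h : i < j) :
    smat x i j = x ⟨(i, j), h⟩ := by simp [smat, h]

@[simp] lemma smat_self (x : EdgeIdx n → ℝ) (i : Fin n) : smat x i i = 0 := by simp [smat]

lemma smat_comm (x : EdgeIdx n → ℝ) (i j : Fin n) : smat x i j = smat x j i := by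
  rcases lt_trichotomy i j with h | h | h
  · simp [smat, h, h.not_gt]
  · rw [h]
  · simp [smat, h, h.not_gt]

@[simp] lemma smat_edge (x : EdgeIdx n → ℝ) (e : EdgeIdx n) : smat x e.1.1 e.1.2 = x e :=
  smat_of_lt x e.2

lemma smat_isHermitian (x : EdgeIdx n → ℝ) : (smat x).IsHermitian := by
  ext i j
  simp [smat_comm x j i]

lemma smat_add (x y : EdgeIdx n → ℝ) : smat (fun e => x e + y e) = smat x + smat y := by
  ext i j
  simp only [smat, of_apply, Matrix.add_apply]
  split_ifs <;> simp

lemma smat_sub (x y : EdgeIdx n → ℝ) : smat (fun e => x e - y e) = smat x - smat y := by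
  ext i j
  simp only [smat, of_apply, Matrix.sub_apply]
  split_ifs <;> simp

lemma smat_smul (a : ℝ) (x : EdgeIdx n → ℝ) : smat (fun e => a * x e) = a • smat x := by
  ext i j
  simp only [smat, of_apply, Matrix.smul_apply, smul_eq_mul]
  split_ifs <;> simp

lemma smat_of_ne (F : Fin n → Fin n → ℝ) (hF : ∀ i j, F i j = F j i) {i j : Fin n} (h : i ≠ j) :
    smat (fun e => F e.1.1 e.1.2) i j = F i j := by
  rcases h.lt_or_gt with h | h
  · simp [smat, h]
  · simp [smat, h, h.not_gt, hF i j]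

lemma sum_sum_eq_edges {H : Fin n → Fin n → ℝ} (hH : ∀ i j, H i j = H j i) :
    ∑ i, ∑ j, H i j = ∑ i, H i i + 2 * ∑ e : EdgeIdx n, H e.1.1 e.1.2 := by
  have h1 : ∑ e : EdgeIdx n, H e.1.1 e.1.2 = ∑ i, ∑ j, if i < j then H i j else 0 := by
    rw [← Fintype.sum_prod_type' (f := fun i j => if i < j then H i j else 0),
      ← Finset.sum_filter]
    exact (Finset.sum_subtype (Finset.univ.filter fun p : Fin n × Fin n => p.1 < p.2)
      (by simp) (fun p => H p.1 p.2)).symm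
  have h2 : ∑ e : EdgeIdx n, H e.1.1 e.1.2 = ∑ i, ∑ j, if j < i then H i j else 0 := by
    rw [h1, Finset.sum_comm]
    refine Finset.sum_congr rfl fun i _ => Finset.sum_congr rfl fun j _ => ?_
    rw [hH]
  have h3 : ∑ i, H i i = ∑ i, ∑ j, if i = j then H i j else 0 := by simp
  rw [two_mul]
  nth_rewrite 2 [h2]
  rw [h1, h3, ← Finset.sum_add_distrib, ← Finset.sum_add_distrib]
  refine Finset.sum_congr rfl fun i _ => ?_
  rw [← Finset.sum_add_distrib, ← Finset.sum_add_distrib]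
  refine Finset.sum_congr rfl fun j _ => ?_
  rcases lt_trichotomy i j with h | h | h
  · simp [h, h.ne, h.not_gt]
  · simp [h]
  · simp [h, h.ne', h.not_gt]

lemma sum_smat_mul_eq (x : EdgeIdx n → ℝ) {H : Fin n → Fin n → ℝ} (hH : ∀ i j, H i j = H j i) :
    ∑ i, ∑ j, smat x i j * H i j = 2 * ∑ e : EdgeIdx n, x e * H e.1.1 e.1.2 := by
  rw [sum_sum_eq_edges (H := fun i j => smat x i j * H i j)]
  · simp
  · intro i j
    rw [smat_comm, hH]

lemma sum_smat_sub_sq (x y : EdgeIdx n → ℝ) :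
    ∑ i, ∑ j, (smat x i j - smat y i j) ^ 2 = 2 * ∑ e, (x e - y e) ^ 2 := by
  rw [sum_sum_eq_edges (H := fun i j => (smat x i j - smat y i j) ^ 2)]
  · simp
  · intro i j
    rw [smat_comm x, smat_comm y]

lemma card_edgeIdx (n : ℕ) : (n : ℝ) + 2 * (Fintype.card (EdgeIdx n) : ℝ) = (n : ℝ) ^ 2 := by
  have := sum_sum_eq_edges (n := n) (H := fun _ _ => (1 : ℝ)) (fun _ _ => rfl)
  simp at this
  rw [sq]
  simpa using this.symm

lemma sum_edges_le_half {H : Fin n → Fin n → ℝ} (hH : ∀ i j, H i j = H j i)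
    (h0 : ∀ i j, 0 ≤ H i j) : 2 * ∑ e : EdgeIdx n, H e.1.1 e.1.2 ≤ ∑ i, ∑ j, H i j := by
  rw [sum_sum_eq_edges hH]
  have := Finset.sum_nonneg fun i (_ : i ∈ Finset.univ) => h0 i i
  linarith

/-- The fluctuation matrix of a random graph. -/
def flucMat (p : ℝ) (g : EdgeIdx n → Bool) : Matrix (Fin n) (Fin n) ℝ :=
  smat fun e => boolVal (g e) - p

lemma flucMat_isHermitian (p : ℝ) (g : EdgeIdx n → Bool) : (flucMat p g).IsHermitian :=
  smat_isHermitian _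

lemma adjOf_isHermitian (g : EdgeIdx n → Bool) : (adjOf g).IsHermitian := by
  rw [adjOf_eq_smat]; exact smat_isHermitian _

lemma flucMat_eq (p : ℝ) (g : EdgeIdx n → Bool) (i j : Fin n) :
    flucMat p g i j = adjOf g i j + (if i = j then p else 0) - p := by
  rw [flucMat, smat_sub, adjOf_eq_smat, Matrix.sub_apply]
  split_ifs with h
  · subst h; simp
  · rw [smat_of_ne (fun _ _ => p) (fun _ _ => rfl) h]; ring

lemma adjOf_nonneg (g : EdgeIdx n → Bool) (i j : Fin n) : 0 ≤ adjOf g i j := by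
  simp only [adjOf, of_apply]; split_ifs <;> norm_num

lemma adjOf_le_one (g : EdgeIdx n → Bool) (i j : Fin n) : adjOf g i j ≤ 1 := by
  simp only [adjOf, of_apply]; split_ifs <;> norm_num

lemma edgeCount_eq_sum (g : EdgeIdx n → Bool) :
    (edgeCount g : ℝ) = ∑ e, boolVal (g e) := by
  simp [edgeCount, boolVal, Finset.sum_boole]

lemma sum_adjOf (g : EdgeIdx n → Bool) : ∑ i, ∑ j, adjOf g i j = 2 * (edgeCount g : ℝ) := by
  have := sum_smat_mul_eq (fun e => boolVal (g e)) (H := fun _ _ => 1) (fun _ _ => rfl)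
  rw [edgeCount_eq_sum]
  simpa [adjOf_eq_smat] using this

end EdgeMatrix

section TailBound

variable {n : ℕ} {I : Type*} [Fintype I] [DecidableEq I]

/-- The entry of `U Uᵀ` at an edge. -/
def gramEdge (U : Fin n × I → ℝ) (e : EdgeIdx n) : ℝ := ∑ k, U (e.1.1, k) * U (e.1.2, k)

/-- The derivative of `gramEdge` in the coordinate `c`. -/
def gramSlope (U : Fin n × I → ℝ) (c : Fin n × I) (i j : Fin n) : ℝ :=
  (if i = c.1 then U (j, c.2) else 0) + (if j = c.1 then U (i, c.2) else 0)

lemma gramEdge_update (U : Fin n × I → ℝ) (c : Fin n × I) (x : ℝ) (e : EdgeIdx n) :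
    gramEdge (Function.update U c x) e =
      gramEdge U e + (x - U c) * gramSlope U c e.1.1 e.1.2 := by
  obtain ⟨a, k⟩ := c
  have hne : e.1.1 ≠ e.1.2 := e.2.ne
  have key : ∀ l, Function.update U (a, k) x (e.1.1, l) * Function.update U (a, k) x (e.1.2, l)
      = U (e.1.1, l) * U (e.1.2, l) +
        if l = k then (x - U (a, k)) * gramSlope U (a, k) e.1.1 e.1.2 else 0 := by
    intro l
    by_cases hl : l = k
    · subst hl
      by_cases h1 : e.1.1 = a
      · have h2 : e.1.2 ≠ a := fun h => hne (h1.trans h.symm)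
        simp only [gramSlope, Function.update_apply, Prod.mk.injEq, h1, h2, and_true, if_true,
          if_false]
        ring
      · by_cases h2 : e.1.2 = a
        · simp only [gramSlope, Function.update_apply, Prod.mk.injEq, h1, h2, and_true, if_true,
            if_false]
          ring
        · simp only [gramSlope, Function.update_apply, Prod.mk.injEq, h1, h2, and_true, if_true,
            if_false]
          ring
    · simp [hl]
  simp only [gramEdge, key, Finset.sum_add_distrib]
  simp

lemma sum_gramSlope_sq_le (U : Fin n × I → ℝ) (c : Fin n × I) :
    ∑ e : EdgeIdx n, gramSlope U c e.1.1 e.1.2 ^ 2 ≤ 2 * ∑ j, U (j, c.2) ^ 2 := by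
  have h := sum_edges_le_half (H := fun i j => gramSlope U c i j ^ 2)
    (fun i j => by simp only [gramSlope]; ring) (fun i j => sq_nonneg _)
  have h2 : ∑ i, ∑ j, gramSlope U c i j ^ 2 ≤ ∑ i, ∑ j,
      ((if i = c.1 then 2 * U (j, c.2) ^ 2 else 0) +
        (if j = c.1 then 2 * U (i, c.2) ^ 2 else 0)) := by
    refine Finset.sum_le_sum fun i _ => Finset.sum_le_sum fun j _ => ?_
    simp only [gramSlope]
    split_ifs <;> nlinarith [sq_nonneg (U (j, c.2) - U (i, c.2))]
  have h3 : ∑ i, ∑ j, ((if i = c.1 then 2 * U (j, c.2) ^ 2 else 0) +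
        (if j = c.1 then 2 * U (i, c.2) ^ 2 else 0)) = 4 * ∑ j, U (j, c.2) ^ 2 := by
    simp only [Finset.sum_add_distrib]
    rw [Finset.sum_comm]
    simp only [Finset.sum_ite_eq', Finset.mem_univ, if_true, ← Finset.mul_sum]
    ring
  linarith

lemma exists_round {κ : Type*} [Fintype κ] [DecidableEq κ] (G : (κ → ℝ) → ℝ) (U₀ : κ → ℝ)
    (h : ℝ) (D : κ → ℝ)
    (hstep : ∀ U : κ → ℝ, (∀ c, |U c - U₀ c| ≤ h) → ∀ c, U c = U₀ c →
      ∃ z : ℤ, |h * z - U₀ c| ≤ h ∧ G U - D c ≤ G (Function.update U c (h * z))) (h0 : 0 ≤ h) :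
    ∃ z : κ → ℤ, (∀ c, |h * z c - U₀ c| ≤ h) ∧ G U₀ - ∑ c, D c ≤ G fun c => h * z c := by
  have key : ∀ s : Finset κ, ∃ z : κ → ℤ, (∀ c ∈ s, |h * z c - U₀ c| ≤ h) ∧
      G U₀ - ∑ c ∈ s, D c ≤ G fun c => if c ∈ s then h * z c else U₀ c := by
    intro s
    induction s using Finset.induction_on with
    | empty => exact ⟨fun _ => 0, by simp, by simp⟩
    | insert a s ha ih =>
      obtain ⟨z, hz, hG⟩ := ih
      obtain ⟨y, hy, hG'⟩ := hstep (fun c => if c ∈ s then h * z c else U₀ c) (fun c => by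
        split_ifs with hc
        · exact hz c hc
        · simpa using h0) a (by simp [ha])
      refine ⟨Function.update z a y, fun c hc => ?_, ?_⟩
      · by_cases hca : c = a
        · subst hca; simpa using hy
        · rw [Function.update_of_ne hca]
          exact hz c ((Finset.mem_insert.1 hc).resolve_left hca)
      · rw [Finset.sum_insert ha]
        have he : (fun c => if c ∈ insert a s then h * ((Function.update z a y c : ℤ) : ℝ)
            else U₀ c) =
            Function.update (fun c => if c ∈ s then h * (z c : ℝ) else U₀ c) a (h * y) := by
          funext c
          by_cases hca : c = a
          · subst hca; simp
          · simp [hca, Finset.mem_insert]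
        rw [he]
        linarith
  obtain ⟨z, hz, hG⟩ := key Finset.univ
  exact ⟨z, fun c => hz c (Finset.mem_univ _), by simpa using hG⟩

/-- A linear statistic of the edges minus its quadratic compensator. -/
def compLin (p v lam : ℝ) (g : EdgeIdx n → Bool) (b : EdgeIdx n → ℝ) : ℝ :=
  ∑ e, (lam * (boolVal (g e) - p) * b e - v * lam ^ 2 / 2 * b e ^ 2)

lemma bernExp_exp_compLin_le {p v : ℝ} (hp : 0 ≤ p) (hp1 : p ≤ 1)
    (hv : ∀ s : ℝ, p * Real.exp (s * (1 - p)) + (1 - p) * Real.exp (-(s * p)) ≤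
        Real.exp (v * s ^ 2 / 2)) (lam : ℝ) (b : EdgeIdx n → ℝ) :
    bernExp (fun _ => p) (fun g => Real.exp (compLin p v lam g b)) ≤ 1 := by
  simp_rw [compLin, Real.exp_sum]
  rw [bernExp_prod (fun _ => p) fun e t =>
    Real.exp (lam * (boolVal t - p) * b e - v * lam ^ 2 / 2 * b e ^ 2)]
  refine Finset.prod_le_one (fun e _ => ?_) fun e _ => ?_
  · have := mul_nonneg hp (Real.exp_pos
      (lam * (boolVal true - p) * b e - v * lam ^ 2 / 2 * b e ^ 2)).le
    have := mul_nonneg (sub_nonneg.2 hp1) (Real.exp_pos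
      (lam * (boolVal false - p) * b e - v * lam ^ 2 / 2 * b e ^ 2)).le
    linarith
  · have h := hv (lam * b e)
    simp only [boolVal, if_true, Bool.false_eq_true, if_false]
    rw [Real.exp_sub, Real.exp_sub, ← mul_div_assoc, ← mul_div_assoc, ← add_div,
      div_le_one (Real.exp_pos _)]
    rw [show lam * (1 - p) * b e = lam * b e * (1 - p) by ring,
      show lam * (0 - p) * b e = -(lam * b e * p) by ring,
      show v * lam ^ 2 / 2 * b e ^ 2 = v * (lam * b e) ^ 2 / 2 by ring]
    exact h

lemma sum_Icc_half_pow_le (L : ℕ) :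
    ∑ k ∈ Finset.Icc (-(L : ℤ)) L, (1 / 2 : ℝ) ^ k.natAbs ≤ 4 := by
  have hsub : Finset.Icc (-(L : ℤ)) L ⊆
      (Finset.range (L + 1)).image (fun k : ℕ => (k : ℤ)) ∪
      (Finset.range (L + 1)).image (fun k : ℕ => -(k : ℤ)) := by
    intro k hk
    rw [Finset.mem_Icc] at hk
    simp only [Finset.mem_union, Finset.mem_image, Finset.mem_range]
    rcases le_total 0 k with h | h
    · exact Or.inl ⟨k.natAbs, by omega, by omega⟩
    · exact Or.inr ⟨k.natAbs, by omega, by omega⟩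
  refine (Finset.sum_le_sum_of_subset_of_nonneg hsub fun _ _ _ => by positivity).trans ?_
  have hunion := Finset.sum_union_inter (s₁ := (Finset.range (L + 1)).image (fun k : ℕ => (k : ℤ)))
    (s₂ := (Finset.range (L + 1)).image (fun k : ℕ => -(k : ℤ)))
    (f := fun k : ℤ => (1 / 2 : ℝ) ^ k.natAbs)
  have hnn : 0 ≤ ∑ k ∈ (Finset.range (L + 1)).image (fun k : ℕ => (k : ℤ)) ∩
      (Finset.range (L + 1)).image (fun k : ℕ => -(k : ℤ)), (1 / 2 : ℝ) ^ k.natAbs :=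
    Finset.sum_nonneg fun _ _ => by positivity
  have h1 : ∑ k ∈ (Finset.range (L + 1)).image (fun k : ℕ => (k : ℤ)),
      (1 / 2 : ℝ) ^ k.natAbs ≤ 2 := by
    rw [Finset.sum_image (fun a _ b _ h => by simpa using h)]
    simpa using sum_geometric_two_le (L + 1)
  have h2 : ∑ k ∈ (Finset.range (L + 1)).image (fun k : ℕ => -(k : ℤ)),
      (1 / 2 : ℝ) ^ k.natAbs ≤ 2 := by
    rw [Finset.sum_image (fun a _ b _ h => by simpa using h)]
    simpa using sum_geometric_two_le (L + 1)
  linarith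

lemma card_lattice_ball_le {κ : Type*} [Fintype κ] [DecidableEq κ] (L Y : ℕ) :
    (((Fintype.piFinset fun _ : κ => Finset.Icc (-(L : ℤ)) L).filter
      fun z => ∑ c, (z c).natAbs ≤ Y).card : ℝ) ≤ 2 ^ Y * 4 ^ Fintype.card κ := by
  have h1 : ∑ z ∈ Fintype.piFinset fun _ : κ => Finset.Icc (-(L : ℤ)) L,
      ∏ c, (1 / 2 : ℝ) ^ (z c).natAbs ≤ 4 ^ Fintype.card κ := by
    rw [← Finset.prod_univ_sum (fun _ : κ => Finset.Icc (-(L : ℤ)) L)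
      (fun _ k => (1 / 2 : ℝ) ^ k.natAbs)]
    calc _ ≤ ∏ _c : κ, (4 : ℝ) := Finset.prod_le_prod
          (fun _ _ => Finset.sum_nonneg fun _ _ => by positivity)
          fun _ _ => sum_Icc_half_pow_le L
      _ = _ := by simp
  have h2 : ∑ z ∈ (Fintype.piFinset fun _ : κ => Finset.Icc (-(L : ℤ)) L).filter
      (fun z => ∑ c, (z c).natAbs ≤ Y), (1 / 2 : ℝ) ^ Y ≤ 4 ^ Fintype.card κ := by
    refine le_trans ?_ h1
    refine (Finset.sum_le_sum fun z hz => ?_).trans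
      (Finset.sum_le_sum_of_subset_of_nonneg (Finset.filter_subset _ _)
        fun _ _ _ => Finset.prod_nonneg fun _ _ => by positivity)
    rw [Finset.prod_pow_eq_pow_sum]
    exact pow_le_pow_of_le_one (by norm_num) (by norm_num) (Finset.mem_filter.1 hz).2
  rw [Finset.sum_const, nsmul_eq_mul] at h2
  have h3 : (2 : ℝ) ^ Y * (1 / 2) ^ Y = 1 := by rw [← mul_pow]; norm_num
  calc _ = 2 ^ Y * (_ * (1 / 2 : ℝ) ^ Y) := by rw [mul_left_comm, h3, mul_one]
    _ ≤ _ := by gcongr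

end TailBound

section TailBoundMain

variable {n : ℕ} {I : Type*} [Fintype I] [DecidableEq I]

lemma compLin_add_mul (p v lam t : ℝ) (g : EdgeIdx n → Bool) (a β : EdgeIdx n → ℝ) :
    compLin p v lam g (fun e => a e + t * β e) = compLin p v lam g a +
      t * ∑ e, (lam * (boolVal (g e) - p) * β e - v * lam ^ 2 * (a e * β e)) -
      v * lam ^ 2 / 2 * t ^ 2 * ∑ e, β e ^ 2 := by
  simp only [compLin, Finset.mul_sum, ← Finset.sum_add_distrib, ← Finset.sum_sub_distrib]
  refine Finset.sum_congr rfl fun e _ => ?_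
  ring

lemma exists_lattice_compLin (p : ℝ) {v lam h : ℝ} (hv : 0 ≤ v) (hh : 0 < h)
    (g : EdgeIdx n → Bool) (U : Fin n × I → ℝ) :
    ∃ z : Fin n × I → ℤ, (∀ c, |h * z c - U c| ≤ h) ∧
      compLin p v lam g (gramEdge U) -
        v * lam ^ 2 * h ^ 2 * (n * ∑ c, (|U c| + h) ^ 2) ≤
      compLin p v lam g (gramEdge fun c => h * z c) := by
  obtain ⟨z, hz, hG⟩ := exists_round (fun U => compLin p v lam g (gramEdge U)) U h
    (fun c => v * lam ^ 2 * h ^ 2 * ∑ j, (|U (j, c.2)| + h) ^ 2) (fun V hV c hc => by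
      set A := ∑ e, (lam * (boolVal (g e) - p) * gramSlope V c e.1.1 e.1.2 -
        v * lam ^ 2 * (gramEdge V e * gramSlope V c e.1.1 e.1.2)) with hA
      set S := ∑ e : EdgeIdx n, gramSlope V c e.1.1 e.1.2 ^ 2 with hS
      have hupd : ∀ x, compLin p v lam g (gramEdge (Function.update V c x)) =
          compLin p v lam g (gramEdge V) + (x - V c) * A -
            v * lam ^ 2 / 2 * (x - V c) ^ 2 * S := fun x => by
        rw [hA, hS, ← compLin_add_mul]
        congr 1
        funext e
        exact gramEdge_update V c x e
      have hSle : S ≤ 2 * ∑ j, (|U (j, c.2)| + h) ^ 2 := by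
        refine (sum_gramSlope_sq_le V c).trans ?_
        gcongr 2 * ∑ j, ?_ with j
        rw [← sq_abs]
        have h1 := hV (j, c.2)
        have h2 := abs_sub_abs_le_abs_sub (V (j, c.2)) (U (j, c.2))
        gcongr
        linarith
      have hS0 : 0 ≤ S := Finset.sum_nonneg fun _ _ => sq_nonneg _
      have hfin : ∀ t : ℝ, |t| ≤ h → v * lam ^ 2 / 2 * t ^ 2 * S ≤
          v * lam ^ 2 * h ^ 2 * ∑ j, (|U (j, c.2)| + h) ^ 2 := fun t ht => by
        have : t ^ 2 ≤ h ^ 2 := sq_le_sq.2 (ht.trans (le_abs_self h))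
        calc _ ≤ v * lam ^ 2 / 2 * h ^ 2 * (2 * ∑ j, (|U (j, c.2)| + h) ^ 2) := by gcongr
          _ = _ := by ring
      have hfl := Int.floor_le (U c / h)
      have hfl' := (Int.lt_floor_add_one (U c / h)).le
      rw [le_div_iff₀ hh] at hfl
      rw [div_le_iff₀ hh] at hfl'
      rcases le_total 0 A with hA0 | hA0
      · refine ⟨⌊U c / h⌋ + 1, ?_, ?_⟩
        · rw [abs_le]; push_cast; constructor <;> nlinarith
        · have hb : |h * ((⌊U c / h⌋ + 1 : ℤ) : ℝ) - V c| ≤ h := by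
            rw [hc, abs_le]; push_cast; constructor <;> nlinarith
          have := hfin _ hb
          have hp : 0 ≤ (h * ((⌊U c / h⌋ + 1 : ℤ) : ℝ) - V c) * A := by
            refine mul_nonneg ?_ hA0
            rw [hc]; push_cast; nlinarith
          simp only [hupd]
          linarith
      · refine ⟨⌊U c / h⌋, ?_, ?_⟩
        · rw [abs_le]; constructor <;> nlinarith
        · have hb : |h * (⌊U c / h⌋ : ℝ) - V c| ≤ h := by
            rw [hc, abs_le]; constructor <;> nlinarith
          have := hfin _ hb
          have hp : 0 ≤ (h * (⌊U c / h⌋ : ℝ) - V c) * A := by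
            refine mul_nonneg_of_nonpos_of_nonpos ?_ hA0
            rw [hc]; nlinarith
          simp only [hupd]
          linarith) hh.le
  refine ⟨z, hz, ?_⟩
  have hD : ∑ c : Fin n × I, v * lam ^ 2 * h ^ 2 * ∑ j, (|U (j, c.2)| + h) ^ 2 =
      v * lam ^ 2 * h ^ 2 * (n * ∑ c, (|U c| + h) ^ 2) := by
    rw [← Finset.mul_sum]
    congr 1
    rw [Fintype.sum_prod_type, Fintype.sum_prod_type]
    simp only [Finset.sum_const, Finset.card_univ, Fintype.card_fin, nsmul_eq_mul]
    rw [Finset.sum_comm]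
  rw [hD] at hG
  exact hG

lemma exists_lattice_of_gram (p : ℝ) {v ε s σ : ℝ} (hv : 0 < v) (hε : 0 < ε) (hε1 : ε ≤ 1)
    (hs : 0 ≤ s) (hσ : σ ^ 2 = 1) (hn : 1 ≤ n) (hI : 1 ≤ Fintype.card I) {Y : ℕ}
    (hY : 2 * n * Fintype.card I * (1 / ε ^ 2 + 1) ≤ (Y : ℝ))
    (g : EdgeIdx n → Bool) (U : Fin n × I → ℝ) (hU1 : ∑ e, gramEdge U e ^ 2 ≤ 1 / 2)
    (hU2 : ∑ c, U c ^ 2 ≤ √(Fintype.card I))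
    (hU : s ≤ σ * (2 * ∑ e, (boolVal (g e) - p) * gramEdge U e)) :
    ∃ z : Fin n × I → ℤ, ∑ c, (z c).natAbs ≤ Y ∧ (1 - 16 * ε ^ 2) * (s ^ 2 / (4 * v)) ≤
      compLin p v (σ * (s / v)) g
        (gramEdge fun c => √(ε ^ 2 / (n * √(Fintype.card I))) * z c) := by
  set ρ := √(Fintype.card I : ℝ) with hρ
  have hρ2 : ρ ^ 2 = Fintype.card I := Real.sq_sqrt (by positivity)
  have hρ1 : 1 ≤ ρ := Real.one_le_sqrt.2 (by exact_mod_cast hI)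
  have hn1 : (1 : ℝ) ≤ n := by exact_mod_cast hn
  have hn0 : (0 : ℝ) < n := by linarith
  set h := √(ε ^ 2 / (n * ρ)) with hh
  have hh2 : h ^ 2 = ε ^ 2 / (n * ρ) := Real.sq_sqrt (by positivity)
  have hh0 : 0 < h := Real.sqrt_pos.2 (by positivity)
  obtain ⟨z, hz, hG⟩ := exists_lattice_compLin p (lam := σ * (s / v)) hv.le hh0 g U
  have hsum : ∑ c, (|U c| + h) ^ 2 ≤ 2 * ρ + 2 * (n * ρ ^ 2) * h ^ 2 := by
    calc _ ≤ ∑ c, (2 * U c ^ 2 + 2 * h ^ 2) := by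
          refine Finset.sum_le_sum fun c _ => ?_
          nlinarith [sq_nonneg (|U c| - h), sq_abs (U c)]
      _ = 2 * ∑ c, U c ^ 2 + 2 * (n * ρ ^ 2) * h ^ 2 := by
          rw [Finset.sum_add_distrib, ← Finset.mul_sum, hρ2]
          simp
          ring
      _ ≤ _ := by linarith
  refine ⟨z, ?_, ?_⟩
  · have h1 : ((∑ c, (z c).natAbs : ℕ) : ℝ) ≤ ∑ c, (|U c| + h) ^ 2 / h ^ 2 := by
      push_cast
      refine Finset.sum_le_sum fun c _ => ?_
      have h2 : h * |(z c : ℝ)| ≤ |U c| + h := by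
        have := abs_sub_abs_le_abs_sub (h * (z c : ℝ)) (U c)
        rw [abs_mul, abs_of_pos hh0] at this
        linarith [hz c]
      have h3 : ((z c).natAbs : ℝ) ≤ |(z c : ℝ)| ^ 2 := by
        rw [← Int.cast_abs, ← Nat.cast_natAbs]
        have : (z c).natAbs ≤ (z c).natAbs ^ 2 := Nat.le_self_pow two_ne_zero _
        exact_mod_cast this
      refine h3.trans ?_
      rw [le_div_iff₀ (by positivity), ← mul_pow, mul_comm]
      gcongr
    have h4 : ∑ c, (|U c| + h) ^ 2 / h ^ 2 ≤ 2 * n * Fintype.card I * (1 / ε ^ 2 + 1) := by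
      rw [← Finset.sum_div, div_le_iff₀ (by positivity)]
      refine hsum.trans ?_
      rw [hh2, ← hρ2]
      have : 2 * n * ρ ^ 2 * (1 / ε ^ 2 + 1) * (ε ^ 2 / (n * ρ)) =
          2 * ρ + 2 * (n * ρ ^ 2) * (ε ^ 2 / (n * ρ)) := by
        field_simp
      rw [this]
    exact_mod_cast (h1.trans h4).trans hY
  · refine le_trans ?_ hG
    have hlam : (σ * (s / v)) ^ 2 = s ^ 2 / v ^ 2 := by rw [mul_pow, hσ, one_mul, div_pow]
    have hcomp : s ^ 2 / (4 * v) ≤ compLin p v (σ * (s / v)) g (gramEdge U) := by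
      have e : compLin p v (σ * (s / v)) g (gramEdge U) =
          s / v / 2 * (σ * (2 * ∑ e, (boolVal (g e) - p) * gramEdge U e)) -
            v * (s ^ 2 / v ^ 2) / 2 * ∑ e, gramEdge U e ^ 2 := by
        rw [compLin, hlam]
        simp only [Finset.mul_sum, ← Finset.sum_sub_distrib]
        refine Finset.sum_congr rfl fun e _ => ?_
        ring
      have h1 : s / v / 2 * s ≤
          s / v / 2 * (σ * (2 * ∑ e, (boolVal (g e) - p) * gramEdge U e)) := by gcongr
      have h2 : v * (s ^ 2 / v ^ 2) / 2 * ∑ e, gramEdge U e ^ 2 ≤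
          v * (s ^ 2 / v ^ 2) / 2 * (1 / 2) := by gcongr
      have h3 : s ^ 2 / (4 * v) = s / v / 2 * s - v * (s ^ 2 / v ^ 2) / 2 * (1 / 2) := by
        field_simp; ring
      linarith
    have hloss : v * (σ * (s / v)) ^ 2 * h ^ 2 * (n * ∑ c, (|U c| + h) ^ 2) ≤
        16 * ε ^ 2 * (s ^ 2 / (4 * v)) := by
      rw [hlam]
      calc _ ≤ v * (s ^ 2 / v ^ 2) * h ^ 2 * (n * (2 * ρ + 2 * (n * ρ ^ 2) * h ^ 2)) := by
            gcongr
        _ = (s ^ 2 / v) * (2 * ε ^ 2 * (1 + ε ^ 2)) := by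
            rw [hh2]; field_simp
        _ ≤ (s ^ 2 / v) * (4 * ε ^ 2) := by
            have : ε ^ 2 ≤ 1 := pow_le_one₀ hε.le hε1
            refine mul_le_mul_of_nonneg_left ?_ (by positivity)
            nlinarith [sq_nonneg ε]
        _ = _ := by field_simp; ring
    linarith

/-- Large deviations of the quadratic form of the fluctuation matrix over low-rank
matrices. -/
lemma bernProb_exists_gram_le {p v ε s σ : ℝ} (hp : 0 ≤ p) (hp1 : p ≤ 1) (hv0 : 0 < v)
    (hv : ∀ s : ℝ, p * Real.exp (s * (1 - p)) + (1 - p) * Real.exp (-(s * p)) ≤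
        Real.exp (v * s ^ 2 / 2)) (hε : 0 < ε) (hε1 : ε ≤ 1)
    (hs : 0 ≤ s) (hσ : σ ^ 2 = 1) (hn : 1 ≤ n) (hI : 1 ≤ Fintype.card I) {Y : ℕ}
    (hY : 2 * n * Fintype.card I * (1 / ε ^ 2 + 1) ≤ (Y : ℝ)) :
    bernProb (fun _ => p) (fun g : EdgeIdx n → Bool => ∃ U : Fin n × I → ℝ,
      ∑ e, gramEdge U e ^ 2 ≤ 1 / 2 ∧ ∑ c, U c ^ 2 ≤ √(Fintype.card I) ∧
      s ≤ σ * (2 * ∑ e, (boolVal (g e) - p) * gramEdge U e)) ≤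
    2 ^ Y * 4 ^ (n * Fintype.card I) *
      Real.exp (-((1 - 16 * ε ^ 2) * (s ^ 2 / (4 * v)))) := by
  have hq : IsBern (fun _ : EdgeIdx n => p) := fun _ => ⟨hp, hp1⟩
  set Z := (Fintype.piFinset fun _ : Fin n × I => Finset.Icc (-(Y : ℤ)) Y).filter
      fun z => ∑ c, (z c).natAbs ≤ Y with hZ
  set h := √(ε ^ 2 / (n * √(Fintype.card I)))
  set x := (1 - 16 * ε ^ 2) * (s ^ 2 / (4 * v))
  calc _ ≤ bernProb (fun _ => p) (fun g : EdgeIdx n → Bool => ∃ z ∈ Z,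
        x ≤ compLin p v (σ * (s / v)) g (gramEdge fun c => h * z c)) := by
        refine bernProb_mono hq ?_
        rintro g ⟨U, hU1, hU2, hU⟩
        obtain ⟨z, hz, hG⟩ := exists_lattice_of_gram p hv0 hε hε1 hs hσ hn hI hY g U hU1 hU2 hU
        refine ⟨z, ?_, hG⟩
        rw [hZ, Finset.mem_filter]
        refine ⟨Fintype.mem_piFinset.2 fun c => ?_, hz⟩
        have := (Finset.single_le_sum (f := fun c => (z c).natAbs) (fun _ _ => Nat.zero_le _)
          (Finset.mem_univ c)).trans hz
        rw [Finset.mem_Icc]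
        omega
    _ ≤ ∑ z ∈ Z, Real.exp (-x) := by
        refine (bernProb_exists_le hq Z _).trans (Finset.sum_le_sum fun z _ => ?_)
        refine (bernProb_le_exp_mul hq _ x).trans ?_
        have := bernExp_exp_compLin_le hp hp1 hv (σ * (s / v))
          (gramEdge fun c => h * (z c : ℝ))
        have h2 := mul_le_mul_of_nonneg_left this (Real.exp_pos (-x)).le
        rwa [mul_one] at h2
    _ ≤ _ := by
        rw [Finset.sum_const, nsmul_eq_mul]
        gcongr
        have := card_lattice_ball_le (κ := Fin n × I) Y Y
        simpa using this

end TailBoundMain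

section TailEvents

variable {n : ℕ}

lemma bernProb_exists_gram_le_exp {I : Type*} [Fintype I] [DecidableEq I] {p v ε s σ : ℝ}
    (hp : 0 ≤ p) (hp1 : p ≤ 1) (hv0 : 0 < v)
    (hv : ∀ s : ℝ, p * Real.exp (s * (1 - p)) + (1 - p) * Real.exp (-(s * p)) ≤
        Real.exp (v * s ^ 2 / 2)) (hε : 0 < ε) (hε1 : ε ≤ 1)
    (hs : 0 ≤ s) (hσ : σ ^ 2 = 1) (hn : 1 ≤ n) (hI : 1 ≤ Fintype.card I) :
    bernProb (fun _ => p) (fun g : EdgeIdx n → Bool => ∃ U : Fin n × I → ℝ,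
      ∑ e, gramEdge U e ^ 2 ≤ 1 / 2 ∧ ∑ c, U c ^ 2 ≤ √(Fintype.card I) ∧
      s ≤ σ * (2 * ∑ e, (boolVal (g e) - p) * gramEdge U e)) ≤
    Real.exp (5 * n * Fintype.card I * (1 / ε ^ 2 + 1) -
      (1 - 16 * ε ^ 2) * (s ^ 2 / (4 * v))) := by
  refine (bernProb_exists_gram_le hp hp1 hv0 hv hε hε1 hs hσ hn hI (Nat.le_ceil _)).trans ?_
  set y : ℝ := 2 * n * Fintype.card I * (1 / ε ^ 2 + 1) with hy
  have hm : (1 : ℝ) ≤ n * Fintype.card I := by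
    exact_mod_cast Nat.one_le_iff_ne_zero.2 (Nat.mul_ne_zero (by omega) (by omega))
  have he : 0 ≤ 1 / ε ^ 2 := by positivity
  have hy0 : 0 ≤ y := by positivity
  have h1 : (2 : ℝ) ^ ⌈y⌉₊ ≤ Real.exp (y + 1) := by
    have h2 : (2 : ℝ) ≤ Real.exp 1 := by have := Real.add_one_le_exp (1 : ℝ); linarith
    calc (2 : ℝ) ^ ⌈y⌉₊ ≤ Real.exp 1 ^ ⌈y⌉₊ := by gcongr
      _ = Real.exp ⌈y⌉₊ := by rw [← Real.exp_nat_mul, mul_one]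
      _ ≤ _ := Real.exp_le_exp.2 (Nat.ceil_lt_add_one hy0).le
  have h2 : (4 : ℝ) ^ (n * Fintype.card I) ≤ Real.exp (2 * (n * Fintype.card I)) := by
    have h2 : (4 : ℝ) ≤ Real.exp 2 := by
      have := Real.add_one_le_exp (1 : ℝ)
      rw [show (2 : ℝ) = 1 + 1 by norm_num, Real.exp_add]
      nlinarith
    calc (4 : ℝ) ^ (n * Fintype.card I) ≤ Real.exp 2 ^ (n * Fintype.card I) := by gcongr
      _ = _ := by rw [← Real.exp_nat_mul]; push_cast; ring_nf
  rw [sub_eq_add_neg (5 * _ * _ * _), Real.exp_add]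
  gcongr
  calc _ ≤ Real.exp (y + 1) * Real.exp (2 * (n * Fintype.card I)) := by gcongr
    _ ≤ _ := by
        rw [← Real.exp_add]
        refine Real.exp_le_exp.2 ?_
        rw [hy]
        nlinarith [mul_nonneg (zero_le_one.trans hm) he]

lemma eigenvalue_eq_sum {ι : Type*} [Fintype ι] [DecidableEq ι] {H : Matrix ι ι ℝ}
    (hH : H.IsHermitian) (i : ι) :
    hH.eigenvalues i = ∑ a, ∑ b, H a b * (eigMat hH a i * eigMat hH b i) := by
  have h := congrFun (congrFun (eigMat_conj hH) i) i
  rw [diagonal_apply_eq, mul_apply] at h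
  rw [← h, Finset.sum_comm]
  refine Finset.sum_congr rfl fun b _ => ?_
  rw [mul_apply, Finset.sum_mul]
  refine Finset.sum_congr rfl fun a _ => ?_
  rw [transpose_apply]; ring

lemma sum_eigMat_mul {ι : Type*} [Fintype ι] [DecidableEq ι] {H : Matrix ι ι ℝ}
    (hH : H.IsHermitian) (i j : ι) :
    ∑ a, eigMat hH a i * eigMat hH a j = if i = j then 1 else 0 := by
  have h := congrFun (congrFun (eigMat_transpose_mul hH) i) j
  rwa [mul_apply, one_apply] at h

lemma exists_gram {H : Matrix (Fin n) (Fin n) ℝ} (hH : H.IsHermitian) (S : Finset (Fin n))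
    {r : ℕ} (hr : S.card = r) {σ Λ : ℝ} (hΛ : 0 < Λ) (hΛ2 : ∑ i ∈ S, hH.eigenvalues i ^ 2 = Λ ^ 2)
    (hσ : ∀ i ∈ S, hH.eigenvalues i = σ * |hH.eigenvalues i|) :
    ∃ U : Fin n × Fin r → ℝ, ∑ e, gramEdge U e ^ 2 ≤ 1 / 2 ∧
      ∑ c, U c ^ 2 ≤ √(r : ℝ) ∧
      ∑ a, ∑ b, H a b * ∑ k, U (a, k) * U (b, k) = σ * Λ := by
  subst hr
  set τ : Fin S.card → Fin n := fun k => (S.equivFin.symm k : Fin n) with hτ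
  have hτS : ∀ k, τ k ∈ S := fun k => (S.equivFin.symm k).2
  have hτi : Function.Injective τ := fun a b h => S.equivFin.symm.injective (Subtype.ext h)
  have hsum : ∀ F : Fin n → ℝ, ∑ k, F (τ k) = ∑ i ∈ S, F i := fun F => by
    rw [← Finset.sum_coe_sort S F]
    exact Equiv.sum_comp S.equivFin.symm (fun x : S => F x)
  set lam : Fin S.card → ℝ := fun k => hH.eigenvalues (τ k)
  set b : Fin S.card → ℝ := fun k => |lam k| / Λ with hb
  set O := eigMat hH
  have hb0 : ∀ k, 0 ≤ b k := fun k => by positivity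
  have hb2 : ∑ k, b k ^ 2 = 1 := by
    simp only [hb, div_pow, sq_abs]
    rw [← Finset.sum_div, hsum (fun i => hH.eigenvalues i ^ 2), hΛ2, div_self (by positivity)]
  have horth : ∀ k l, ∑ a, O a (τ k) * O a (τ l) = if k = l then 1 else 0 := fun k l => by
    rw [sum_eigMat_mul hH]
    simp [hτi.eq_iff]
  have hUU : ∀ (a c : Fin n) (k : Fin S.card), √(b k) * O a (τ k) * (√(b k) * O c (τ k)) =
      b k * (O a (τ k) * O c (τ k)) := fun a c k => by
    have := Real.mul_self_sqrt (hb0 k)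
    calc _ = (√(b k) * √(b k)) * (O a (τ k) * O c (τ k)) := by ring
      _ = _ := by rw [this]
  refine ⟨fun c => √(b c.2) * O c.1 (τ c.2), ?_, ?_, ?_⟩
  · have h1 := sum_edges_le_half (n := n)
      (H := fun a c => (∑ k, √(b k) * O a (τ k) * (√(b k) * O c (τ k))) ^ 2)
      (fun a c => by congr 1; refine Finset.sum_congr rfl fun k _ => ?_; ring)
      (fun _ _ => sq_nonneg _)
    have h2 : ∑ a, ∑ c, (∑ k, √(b k) * O a (τ k) * (√(b k) * O c (τ k))) ^ 2 = 1 := by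
      simp only [hUU]
      calc _ = ∑ a, ∑ c, ∑ k, ∑ l, b k * b l *
            ((O a (τ k) * O a (τ l)) * (O c (τ k) * O c (τ l))) := by
            refine Finset.sum_congr rfl fun a _ => Finset.sum_congr rfl fun c _ => ?_
            rw [sq, Finset.sum_mul_sum]
            refine Finset.sum_congr rfl fun k _ => Finset.sum_congr rfl fun l _ => ?_
            ring
        _ = ∑ k, ∑ l, ∑ a, ∑ c, b k * b l *
            ((O a (τ k) * O a (τ l)) * (O c (τ k) * O c (τ l))) := by
            have : ∀ a, ∑ c, ∑ k, ∑ l, b k * b l *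
                ((O a (τ k) * O a (τ l)) * (O c (τ k) * O c (τ l))) =
                ∑ k, ∑ l, ∑ c, b k * b l *
                ((O a (τ k) * O a (τ l)) * (O c (τ k) * O c (τ l))) := fun a => by
              rw [Finset.sum_comm]
              refine Finset.sum_congr rfl fun k _ => Finset.sum_comm
            simp only [this]
            rw [Finset.sum_comm]
            refine Finset.sum_congr rfl fun k _ => Finset.sum_comm
        _ = ∑ k, ∑ l, b k * b l * (if k = l then 1 else 0) := by
            refine Finset.sum_congr rfl fun k _ => Finset.sum_congr rfl fun l _ => ?_
            simp only [← Finset.mul_sum, ← Finset.sum_mul]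
            rw [horth]
            split_ifs <;> ring
        _ = 1 := by
            simp only [mul_ite, mul_one, mul_zero, Finset.sum_ite_eq, Finset.mem_univ, if_true]
            rw [← hb2]
            exact Finset.sum_congr rfl fun k _ => (sq _).symm
    have h3 : ∑ e : EdgeIdx n, gramEdge (fun c => √(b c.2) * O c.1 (τ c.2)) e ^ 2 =
        ∑ e : EdgeIdx n, (∑ k, √(b k) * O e.1.1 (τ k) * (√(b k) * O e.1.2 (τ k))) ^ 2 := rfl
    rw [h3]
    linarith
  · have h1 : ∑ c : Fin n × Fin S.card, (√(b c.2) * O c.1 (τ c.2)) ^ 2 = ∑ k, b k := by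
      rw [Fintype.sum_prod_type_right]
      refine Finset.sum_congr rfl fun k _ => ?_
      simp only [sq, hUU, ← Finset.mul_sum, horth, if_true, mul_one]
    rw [h1]
    refine Real.le_sqrt_of_sq_le ?_
    have := sq_sum_le_card_mul_sum_sq (s := Finset.univ) (f := b)
    simpa [hb2] using this
  · simp only [hUU, Finset.mul_sum]
    have h1 : ∑ a, ∑ c, ∑ k, H a c * (b k * (O a (τ k) * O c (τ k))) = ∑ k, b k * lam k := by
      have : ∀ a, ∑ c, ∑ k, H a c * (b k * (O a (τ k) * O c (τ k))) =
          ∑ k, ∑ c, H a c * (b k * (O a (τ k) * O c (τ k))) := fun a => Finset.sum_comm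
      simp only [this]
      rw [Finset.sum_comm]
      refine Finset.sum_congr rfl fun k _ => ?_
      simp only [lam]
      rw [eigenvalue_eq_sum hH]
      simp only [Finset.mul_sum]
      refine Finset.sum_congr rfl fun a _ => Finset.sum_congr rfl fun c _ => ?_
      ring
    rw [h1]
    have h2 : ∀ k, b k * lam k = σ * Λ * b k ^ 2 := fun k => by
      have : lam k = σ * |lam k| := hσ _ (hτS k)
      rw [this]
      simp only [hb]
      rw [this, abs_mul, abs_abs]
      by_cases h0 : |lam k| = 0
      · simp [h0]
      · have : |σ| = 1 := by
          have h := congrArg abs this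
          rw [abs_mul, abs_abs] at h
          exact mul_right_cancel₀ h0 (by linarith)
        rw [this]
        field_simp
    simp only [h2, ← Finset.mul_sum, hb2, mul_one]

lemma sum_flucMat_mul (p : ℝ) (g : EdgeIdx n → Bool) {I : Type*} [Fintype I]
    (U : Fin n × I → ℝ) :
    ∑ a, ∑ b, flucMat p g a b * ∑ k, U (a, k) * U (b, k) =
      2 * ∑ e, (boolVal (g e) - p) * gramEdge U e :=
  sum_smat_mul_eq _ fun _ _ => Finset.sum_congr rfl fun _ _ => mul_comm _ _

lemma sum_flucMat_mul_le {p : ℝ} (hp : 0 ≤ p) (g : EdgeIdx n → Bool) {I : Type*} [Fintype I]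
    (U : Fin n × I → ℝ) :
    ∑ a, ∑ b, flucMat p g a b * ∑ k, U (a, k) * U (b, k) ≤
      ∑ a, ∑ b, adjOf g a b * ∑ k, U (a, k) * U (b, k) + p * ∑ c, U c ^ 2 := by
  have h1 : ∑ a, ∑ b, flucMat p g a b * ∑ k, U (a, k) * U (b, k) =
      ∑ a, ∑ b, adjOf g a b * ∑ k, U (a, k) * U (b, k) + p * ∑ c, U c ^ 2 -
        p * ∑ k, (∑ a, U (a, k)) ^ 2 := by
    have e1 : ∑ c, U c ^ 2 = ∑ a, ∑ b, if a = b then ∑ k, U (a, k) * U (b, k) else 0 := by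
      rw [Fintype.sum_prod_type]
      simp [sq]
    have e2 : ∑ k, (∑ a, U (a, k)) ^ 2 = ∑ a, ∑ b, ∑ k, U (a, k) * U (b, k) := by
      simp only [sq, Finset.sum_mul_sum]
      rw [Finset.sum_comm]
      exact Finset.sum_congr rfl fun a _ => Finset.sum_comm
    rw [e1, e2]
    simp only [Finset.mul_sum, ← Finset.sum_add_distrib, ← Finset.sum_sub_distrib]
    refine Finset.sum_congr rfl fun a _ => Finset.sum_congr rfl fun b _ => ?_
    simp only [← Finset.mul_sum, flucMat_eq]
    split_ifs <;> ring
  have h2 : 0 ≤ p * ∑ k, (∑ a, U (a, k)) ^ 2 :=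
    mul_nonneg hp (Finset.sum_nonneg fun _ _ => sq_nonneg _)
  linarith

/-- Sum of the squares of the eigenvalues of a symmetric matrix lying below `-R`. -/
def lowSq {H : Matrix (Fin n) (Fin n) ℝ} (hH : H.IsHermitian) (R : ℝ) : ℝ :=
  ∑ i with hH.eigenvalues i < -R, hH.eigenvalues i ^ 2

lemma exists_small_subset {κ : Type*} [DecidableEq κ] (T : Finset κ) (w : κ → ℝ) {x y : ℝ}
    (hw : ∀ i ∈ T, y ≤ w i) (hx : 0 < x) (hT : x ≤ ∑ i ∈ T, w i) :
    ∃ S ⊆ T, 1 ≤ S.card ∧ x ≤ ∑ i ∈ S, w i ∧ ((S.card : ℝ) - 1) * y ≤ x := by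
  obtain ⟨S, hS, hmin⟩ := Finset.exists_min_image (T.powerset.filter fun S => x ≤ ∑ i ∈ S, w i)
    Finset.card ⟨T, by simpa using hT⟩
  rw [Finset.mem_filter, Finset.mem_powerset] at hS
  have hne : S.Nonempty := by
    rw [Finset.nonempty_iff_ne_empty]
    rintro rfl
    have h := hS.2
    rw [Finset.sum_empty] at h
    linarith
  refine ⟨S, hS.1, hne.card_pos, hS.2, ?_⟩
  obtain ⟨i, hi⟩ := hne
  have hcard := Finset.card_erase_of_mem hi
  have hpos := Finset.card_pos.2 ⟨i, hi⟩
  have hlt : ∑ j ∈ S.erase i, w j < x := by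
    by_contra! hcon
    have := hmin (S.erase i) (by
      rw [Finset.mem_filter, Finset.mem_powerset]
      exact ⟨(Finset.erase_subset _ _).trans hS.1, hcon⟩)
    omega
  refine le_trans ?_ hlt.le
  have h1 := Finset.card_nsmul_le_sum (S.erase i) w y
    fun j hj => hw j (hS.1 (Finset.mem_of_mem_erase hj))
  rw [nsmul_eq_mul, hcard, Nat.cast_sub hpos, Nat.cast_one] at h1
  exact h1

lemma bernProb_lowSq_ge_le {p v ε s R : ℝ} (hp : 0 ≤ p) (hp1 : p ≤ 1) (hv0 : 0 < v)
    (hv : ∀ s : ℝ, p * Real.exp (s * (1 - p)) + (1 - p) * Real.exp (-(s * p)) ≤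
        Real.exp (v * s ^ 2 / 2)) (hε : 0 < ε) (hε2 : ε ≤ 1)
    (hn : 1 ≤ n) (hR : 0 < R) (hs : √n < s) :
    bernProb (fun _ => p)
      (fun g : EdgeIdx n → Bool => s ^ 2 ≤ lowSq (adjOf_isHermitian g) R) ≤
    (n + 1) * Real.exp (5 * n * (1 + s ^ 2 / R ^ 2) * (1 / ε ^ 2 + 1) -
      (1 - 16 * ε ^ 2) * ((s - √n) ^ 2 / (4 * v))) := by
  have hq : IsBern (fun _ : EdgeIdx n => p) := fun _ => ⟨hp, hp1⟩
  have hs0 : 0 < s := (Real.sqrt_nonneg _).trans_lt hs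
  set T : Finset ℕ := (Finset.range (n + 1)).filter fun r : ℕ => 1 ≤ r ∧ ((r : ℝ) - 1) * R ^ 2 ≤ s ^ 2 with hT
  calc _ ≤ bernProb (fun _ => p) (fun g : EdgeIdx n → Bool => ∃ r ∈ T,
        ∃ U : Fin n × Fin r → ℝ, ∑ e, gramEdge U e ^ 2 ≤ 1 / 2 ∧
        ∑ c, U c ^ 2 ≤ √(Fintype.card (Fin r)) ∧
        s - √n ≤ -1 * (2 * ∑ e, (boolVal (g e) - p) * gramEdge U e)) := by
        refine bernProb_mono hq fun g hg => ?_
        set hA := adjOf_isHermitian g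
        obtain ⟨S, hST, hS1, hSx, hSc⟩ := exists_small_subset
          (Finset.univ.filter fun i => hA.eigenvalues i < -R) (fun i => hA.eigenvalues i ^ 2)
          (y := R ^ 2) (x := s ^ 2) (fun i hi => by
            have := (Finset.mem_filter.1 hi).2
            exact sq_le_sq' (by linarith) (by linarith) |>.trans_eq (neg_sq _)) (by positivity) hg
        have hcard : S.card ≤ n := by simpa using Finset.card_le_univ S
        obtain ⟨U, hU1, hU2, hU3⟩ := exists_gram hA S rfl (σ := -1)
          (Λ := √(∑ i ∈ S, hA.eigenvalues i ^ 2)) (Real.sqrt_pos.2 (by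
            refine lt_of_lt_of_le ?_ hSx; positivity))
          (Real.sq_sqrt (Finset.sum_nonneg fun _ _ => sq_nonneg _)).symm (fun i hi => by
            have := (Finset.mem_filter.1 (hST hi)).2
            rw [abs_of_neg (by linarith)]; ring)
        refine ⟨S.card, ?_, U, hU1, by simpa using hU2, ?_⟩
        · rw [hT, Finset.mem_filter, Finset.mem_range]
          exact ⟨by omega, hS1, hSc⟩
        · rw [← sum_flucMat_mul]
          have h1 := sum_flucMat_mul_le hp g U
          rw [hU3] at h1
          have h2 : s ≤ √(∑ i ∈ S, hA.eigenvalues i ^ 2) := Real.le_sqrt_of_sq_le hSx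
          have h3 : √(S.card : ℝ) ≤ √n := Real.sqrt_le_sqrt (by exact_mod_cast hcard)
          have h4 : p * ∑ c, U c ^ 2 ≤ 1 * √n :=
            mul_le_mul hp1 (hU2.trans h3) (Finset.sum_nonneg fun _ _ => sq_nonneg _) zero_le_one
          linarith
    _ ≤ ∑ r ∈ T, Real.exp (5 * n * (1 + s ^ 2 / R ^ 2) * (1 / ε ^ 2 + 1) -
          (1 - 16 * ε ^ 2) * ((s - √n) ^ 2 / (4 * v))) := by
        refine (bernProb_exists_le hq T _).trans (Finset.sum_le_sum fun r hr => ?_)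
        rw [hT, Finset.mem_filter] at hr
        refine (bernProb_exists_gram_le_exp (I := Fin r) hp hp1 hv0 hv hε hε2 (by linarith)
          (by norm_num) hn (by simpa using hr.2.1)).trans ?_
        refine Real.exp_le_exp.2 ?_
        rw [Fintype.card_fin]
        have : (r : ℝ) ≤ 1 + s ^ 2 / R ^ 2 := by
          have h := hr.2.2
          rw [← le_div_iff₀ (by positivity)] at h
          linarith
        gcongr
    _ ≤ _ := by
        rw [Finset.sum_const, nsmul_eq_mul]
        gcongr
        have h1 : T.card ≤ n + 1 := by
          simpa using Finset.card_filter_le (Finset.range (n + 1)) _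
        exact_mod_cast h1

lemma bernProb_eigenvalue_gt_le {p v ε R : ℝ} (hp : 0 ≤ p) (hp1 : p ≤ 1) (hv0 : 0 < v)
    (hv : ∀ s : ℝ, p * Real.exp (s * (1 - p)) + (1 - p) * Real.exp (-(s * p)) ≤
        Real.exp (v * s ^ 2 / 2)) (hε : 0 < ε) (hε2 : ε ≤ 1) (hn : 1 ≤ n) (hR : 0 < R) :
    bernProb (fun _ => p)
      (fun g : EdgeIdx n → Bool => ∃ i, R < (flucMat_isHermitian p g).eigenvalues i) ≤
    Real.exp (5 * n * (1 / ε ^ 2 + 1) - (1 - 16 * ε ^ 2) * (R ^ 2 / (4 * v))) := by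
  have hq : IsBern (fun _ : EdgeIdx n => p) := fun _ => ⟨hp, hp1⟩
  refine le_trans (bernProb_mono hq ?_) ((bernProb_exists_gram_le_exp (I := Fin 1)
    hp hp1 hv0 hv hε hε2 hR.le (σ := 1) (by norm_num) hn (by simp)).trans_eq (by simp))
  rintro g ⟨i, hi⟩
  set hM := flucMat_isHermitian p g
  obtain ⟨U, hU1, hU2, hU3⟩ := exists_gram hM {i} (Finset.card_singleton i) (σ := 1) (Λ := hM.eigenvalues i)
    (hR.trans hi) (by simp) (fun j hj => by
      rw [Finset.mem_singleton] at hj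
      rw [hj, abs_of_pos (hR.trans hi), one_mul])
  rw [sum_flucMat_mul] at hU3
  refine ⟨U, hU1, by simpa using hU2, ?_⟩
  linarith

end TailEvents

section ExpectedCube

variable {n : ℕ}

lemma trace_cube_eq_sum {ι : Type*} [Fintype ι] (A : Matrix ι ι ℝ) :
    (A * A * A).trace = ∑ i, ∑ k, ∑ j, A i j * A j k * A k i := by
  simp only [trace, diag_apply, mul_apply, Finset.sum_mul]

/-- The edge joining two distinct vertices. -/
def mkEdge {i j : Fin n} (h : i ≠ j) : EdgeIdx n :=
  ⟨(min i j, max i j), min_lt_max.2 h⟩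

lemma smat_mkEdge (x : EdgeIdx n → ℝ) {i j : Fin n} (h : i ≠ j) : smat x i j = x (mkEdge h) := by
  rcases h.lt_or_gt with h' | h'
  · rw [smat_of_lt x h']; congr 1
    simp [mkEdge, min_eq_left h'.le, max_eq_right h'.le]
  · rw [smat_comm, smat_of_lt x h']; congr 1
    simp [mkEdge, min_eq_right h'.le, max_eq_left h'.le]

lemma mkEdge_ne {i j k : Fin n} (hij : i ≠ j) (hjk : j ≠ k) (hki : k ≠ i) :
    mkEdge hij ≠ mkEdge hjk := by
  intro h
  simp only [mkEdge, Subtype.mk.injEq, Prod.mk.injEq] at h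
  rcases hij.lt_or_gt with h1 | h1 <;> rcases hjk.lt_or_gt with h2 | h2 <;>
    simp only [min_eq_left h1.le, max_eq_right h1.le, min_eq_right h1.le, max_eq_left h1.le,
      min_eq_left h2.le, max_eq_right h2.le, min_eq_right h2.le, max_eq_left h2.le] at h <;>
    omega

lemma bernExp_mul_mul {ι : Type*} [Fintype ι] [DecidableEq ι] (q : ι → ℝ) (φ : ι → Bool → ℝ)
    {a b c : ι} (hab : a ≠ b) (hbc : b ≠ c) (hac : a ≠ c) :
    bernExp q (fun g => φ a (g a) * φ b (g b) * φ c (g c)) =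
      (q a * φ a true + (1 - q a) * φ a false) * (q b * φ b true + (1 - q b) * φ b false) *
      (q c * φ c true + (1 - q c) * φ c false) := by
  have h := bernExp_prod_finset q {a, b, c} φ
  have h1 : a ∉ ({b, c} : Finset ι) := by simp [hab, hac]
  have h2 : b ∉ ({c} : Finset ι) := by simp [hbc]
  simp only [Finset.prod_insert h1, Finset.prod_insert h2, Finset.prod_singleton, ← mul_assoc] at h
  exact h

lemma bernExp_trace_cube (q : EdgeIdx n → ℝ) (φ : EdgeIdx n → Bool → ℝ) :
    bernExp q (fun g => (smat (fun e => φ e (g e)) * smat (fun e => φ e (g e)) *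
      smat (fun e => φ e (g e))).trace) =
    (smat (fun e => q e * φ e true + (1 - q e) * φ e false) *
      smat (fun e => q e * φ e true + (1 - q e) * φ e false) *
      smat (fun e => q e * φ e true + (1 - q e) * φ e false)).trace := by
  simp only [trace_cube_eq_sum, bernExp_sum]
  refine Finset.sum_congr rfl fun i _ => Finset.sum_congr rfl fun k _ =>
    Finset.sum_congr rfl fun j _ => ?_
  by_cases hij : i = j
  · subst hij; simp [bernExp_const]
  by_cases hjk : j = k
  · subst hjk; simp [bernExp_const]
  by_cases hki : k = i
  · subst hki; simp [bernExp_const]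
  simp only [smat_mkEdge _ hij, smat_mkEdge _ hjk, smat_mkEdge _ hki]
  refine bernExp_mul_mul q φ (mkEdge_ne hij hjk hki) (mkEdge_ne hjk hki hij) ?_
  exact (mkEdge_ne hki hij hjk).symm

lemma bernExp_trace_flucMat_cube (p : ℝ) :
    bernExp (fun _ => p) (fun g : EdgeIdx n → Bool =>
      (flucMat p g * flucMat p g * flucMat p g).trace) = 0 := by
  have h := bernExp_trace_cube (n := n) (fun _ => p) (fun _ b => boolVal b - p)
  simp only [flucMat]
  rw [h]
  have : (fun _ : EdgeIdx n => p * (boolVal true - p) + (1 - p) * (boolVal false - p)) =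
      fun _ => 0 := by
    funext _; simp [boolVal]; ring
  rw [this, trace_cube_eq_sum]
  have : ∀ i j : Fin n, smat (fun _ => 0) i j = 0 := fun i j => by simp [smat]
  simp [this]

end ExpectedCube

section Bulk

variable {n : ℕ}

lemma abs_eigenvalue_le {A : Matrix (Fin n) (Fin n) ℝ} (hA : A.IsHermitian)
    (h : ∀ i j, |A i j| ≤ 1) (i : Fin n) : |hA.eigenvalues i| ≤ n := by
  refine abs_le_of_sq_le_sq ?_ (Nat.cast_nonneg n)
  have h1 : hA.eigenvalues i ^ 2 ≤ ∑ i, hA.eigenvalues i ^ 2 :=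
    Finset.single_le_sum (f := fun i => hA.eigenvalues i ^ 2)
      (fun i _ => sq_nonneg _) (Finset.mem_univ i)
  rw [← sum_sq_eq_sum_eigenvalues_sq hA] at h1
  refine h1.trans ?_
  calc ∑ i, ∑ j, A i j ^ 2 ≤ ∑ _i : Fin n, ∑ _j : Fin n, (1 : ℝ) := by
        refine Finset.sum_le_sum fun i _ => Finset.sum_le_sum fun j _ => ?_
        rw [sq_le_one_iff_abs_le_one]; exact h i j
    _ = _ := by simp [sq]

lemma abs_flucMat_le_one {p : ℝ} (hp : 0 ≤ p) (hp1 : p ≤ 1) (g : EdgeIdx n → Bool) (i j : Fin n) :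
    |flucMat p g i j| ≤ 1 := by
  by_cases h : i = j
  · subst h; simp [flucMat]
  · rw [flucMat_eq, if_neg h, abs_le]
    have := adjOf_nonneg g i j
    have := adjOf_le_one g i j
    constructor <;> linarith

/-- The spectral sum of the cube function made linear outside `[-R, R]`. -/
def bulkTrace (R : ℝ) (A : Matrix (Fin n) (Fin n) ℝ) : ℝ :=
  specSum (bulkCube R) A - specSum (fun x => bulkCube R (-x)) A

lemma bulkTrace_eq (R : ℝ) {A : Matrix (Fin n) (Fin n) ℝ} (hA : A.IsHermitian) :
    bulkTrace R A = ∑ i, (bulkCube R (hA.eigenvalues i) - bulkCube R (-hA.eigenvalues i)) := by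
  rw [bulkTrace, specSum_eq _ hA, specSum_eq _ hA, Finset.sum_sub_distrib]

lemma trace_cube_le_bulkTrace {R : ℝ} (hR : 0 ≤ R) {A : Matrix (Fin n) (Fin n) ℝ}
    (hA : A.IsHermitian) (h : ∀ i j, |A i j| ≤ 1) [Decidable (∃ i, R < hA.eigenvalues i)] :
    (A * A * A).trace ≤
      bulkTrace R A + (n : ℝ) ^ 4 * if ∃ i, R < hA.eigenvalues i then 1 else 0 := by
  rw [trace_pow_three_eq hA, bulkTrace_eq R hA]
  have key : ∀ i, hA.eigenvalues i ^ 3 ≤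
      (bulkCube R (hA.eigenvalues i) - bulkCube R (-hA.eigenvalues i)) +
        (n : ℝ) ^ 3 * if ∃ i, R < hA.eigenvalues i then 1 else 0 := fun i => by
    have hn : (0 : ℝ) ≤ (n : ℝ) ^ 3 * if ∃ i, R < hA.eigenvalues i then 1 else 0 := by
      split_ifs <;> positivity
    rcases le_total (hA.eigenvalues i) 0 with h0 | h0
    · rw [bulkCube_of_nonpos hR h0]
      have := bulkCube_le_cube (R := R) (neg_nonneg.2 h0)
      nlinarith [this]
    · rw [bulkCube_of_nonpos hR (neg_nonpos.2 h0)]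
      by_cases h1 : hA.eigenvalues i ≤ R
      · rw [bulkCube_of_mem h0 h1]; linarith
      · rw [if_pos ⟨i, not_le.1 h1⟩]
        have h2 := bulkCube_nonneg hR (hA.eigenvalues i)
        have h3 : hA.eigenvalues i ^ 3 ≤ (n : ℝ) ^ 3 :=
          pow_le_pow_left₀ h0 ((le_abs_self _).trans (abs_eigenvalue_le hA h i)) 3
        linarith
  refine (Finset.sum_le_sum fun i _ => key i).trans_eq ?_
  rw [Finset.sum_add_distrib, Finset.sum_const, Finset.card_univ, Fintype.card_fin, nsmul_eq_mul]
  ring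

lemma convexOn_specSum_smat {f : ℝ → ℝ} (hf : ConvexOn ℝ Set.univ f) (p : ℝ) :
    ConvexOn ℝ Set.univ fun x : EdgeIdx n → ℝ => specSum f (smat fun e => x e - p) := by
  refine ⟨convex_univ, fun x _ y _ a b ha hb hab => ?_⟩
  have h : smat (fun e => (a • x + b • y) e - p) =
      a • smat (fun e => x e - p) + b • smat (fun e => y e - p) := by
    rw [← smat_smul, ← smat_smul, ← smat_add]
    congr 1
    funext e
    simp only [Pi.add_apply, Pi.smul_apply, smul_eq_mul]
    linear_combination p * hab
  simp only [smul_eq_mul]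
  rw [h]
  exact specSum_mix_le hf (smat_isHermitian _) (smat_isHermitian _) ha hb hab

lemma specSum_smat_le_add {f : ℝ → ℝ} (hf : ConvexOn ℝ Set.univ f) {L : ℝ} (hL0 : 0 ≤ L)
    (hL : ∀ x y, f x ≤ f y + L * |x - y|) (p : ℝ) (x y : EdgeIdx n → ℝ) :
    specSum f (smat fun e => x e - p) ≤ specSum f (smat fun e => y e - p) +
      (L * √(2 * n)) * √(∑ e, (x e - y e) ^ 2) := by
  have h := specSum_le_add hf hL0 hL (smat_isHermitian (fun e => x e - p))
    (smat_isHermitian (fun e => y e - p))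
  refine h.trans_eq ?_
  rw [sum_smat_sub_sq]
  simp only [sub_sub_sub_cancel_right, Fintype.card_fin]
  rw [Real.sqrt_mul zero_le_two, Real.sqrt_mul zero_le_two]
  ring

lemma bernProb_bulkTrace_le {p R a b : ℝ} (hp : 0 ≤ p) (hp1 : p ≤ 1) (hn : 1 ≤ n) (hR : 0 < R)
    (ha : 0 ≤ a)
    (hb : (n : ℝ) ^ 4 * bernProb (fun _ => p)
      (fun g : EdgeIdx n → Bool => ∃ i, R < (flucMat_isHermitian p g).eigenvalues i) ≤ b) :
    bernProb (fun _ => p)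
      (fun g : EdgeIdx n → Bool => bulkTrace R (flucMat p g) ≤ -(2 * a + b)) ≤
    2 * Real.exp (-(a ^ 2 / (72 * R ^ 4 * n))) := by
  classical
  have hq : IsBern (fun _ : EdgeIdx n => p) := fun _ => ⟨hp, hp1⟩
  have hn0 : (0 : ℝ) < n := by exact_mod_cast hn
  set f₁ : (EdgeIdx n → ℝ) → ℝ := fun x => specSum (bulkCube R) (smat fun e => x e - p) with hf₁
  set f₂ : (EdgeIdx n → ℝ) → ℝ :=
    fun x => specSum (fun x => bulkCube R (-x)) (smat fun e => x e - p) with hf₂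
  set E₁ := bernExp (fun _ => p) (fun g : EdgeIdx n → Bool => f₁ fun e => boolVal (g e)) with hE₁
  set E₂ := bernExp (fun _ => p) (fun g : EdgeIdx n → Bool => f₂ fun e => boolVal (g e)) with hE₂
  have hL : 0 < 3 * R ^ 2 * √(2 * n) := by positivity
  have hLsq : 4 * (3 * R ^ 2 * √(2 * n)) ^ 2 = 72 * R ^ 4 * n := by
    rw [mul_pow, Real.sq_sqrt (by positivity)]; ring
  have h1 := (bernProb_convex_lipschitz hq (convexOn_specSum_smat (n := n)
    (convexOn_bulkCube hR.le) p) hL (specSum_smat_le_add (convexOn_bulkCube hR.le)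
    (by positivity) (bulkCube_le_add_abs hR.le) p) ha).2
  have h2 := (bernProb_convex_lipschitz hq (convexOn_specSum_smat (n := n)
    (convexOn_bulkCube_neg hR.le) p) hL (specSum_smat_le_add (convexOn_bulkCube_neg hR.le)
    (by positivity) (fun x y => by
      refine (bulkCube_le_add_abs hR.le (-x) (-y)).trans_eq ?_
      rw [neg_sub_neg, abs_sub_comm]) p) ha).1
  rw [hLsq] at h1 h2
  have hE : -b ≤ E₁ - E₂ := by
    rw [hE₁, hE₂, ← bernExp_sub]
    have h3 := bernExp_mono hq (fun g : EdgeIdx n → Bool => trace_cube_le_bulkTrace hR.le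
      (flucMat_isHermitian p g) (abs_flucMat_le_one hp hp1 g))
    rw [bernExp_trace_flucMat_cube, bernExp_add, bernExp_const_mul] at h3
    simp only [bulkTrace] at h3
    have h4 : bernExp (fun _ => p) (fun g : EdgeIdx n → Bool =>
        if ∃ i, R < (flucMat_isHermitian p g).eigenvalues i then (1 : ℝ) else 0) =
        bernProb (fun _ => p)
        (fun g : EdgeIdx n → Bool => ∃ i, R < (flucMat_isHermitian p g).eigenvalues i) := by
      unfold bernProb
      congr 1
      funext g
      congr
    rw [h4] at h3
    have h5 : ∀ g : EdgeIdx n → Bool, (f₁ fun e => boolVal (g e)) - (f₂ fun e => boolVal (g e)) =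
      specSum (bulkCube R) (flucMat p g) - specSum (fun x => bulkCube R (-x)) (flucMat p g) :=
      fun _ => rfl
    simp only [h5]
    linarith
  refine (bernProb_mono hq (T := fun g => (f₁ fun e => boolVal (g e)) ≤ E₁ - a ∨
    E₂ + a ≤ f₂ fun e => boolVal (g e)) fun g hg => ?_).trans
    ((bernProb_or_le hq _ _).trans (by linarith))
  by_contra! hcon
  have h6 : bulkTrace R (flucMat p g) =
    (f₁ fun e => boolVal (g e)) - (f₂ fun e => boolVal (g e)) := rfl
  linarith [hcon.1, hcon.2]

end Bulk

section Deterministic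

variable {n : ℕ}

lemma conj_diag_eq_sum {ι : Type*} [Fintype ι] (A W : Matrix ι ι ℝ) (i : ι) :
    (Wᵀ * A * W) i i = ∑ a, ∑ b, A a b * (W a i * W b i) := by
  rw [mul_apply, Finset.sum_comm]
  refine Finset.sum_congr rfl fun b _ => ?_
  rw [mul_apply, Finset.sum_mul]
  refine Finset.sum_congr rfl fun a _ => ?_
  rw [transpose_apply]; ring

lemma conj_flucMat_diag (p : ℝ) (g : EdgeIdx n → Bool) {W : Matrix (Fin n) (Fin n) ℝ}
    (hW : Wᵀ * W = 1) (i : Fin n) :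
    (Wᵀ * flucMat p g * W) i i = (Wᵀ * adjOf g * W) i i + p - p * (∑ a, W a i) ^ 2 := by
  have h1 : ∑ a, W a i * W a i = 1 := by
    have := congrFun (congrFun hW i) i
    rwa [mul_apply, one_apply_eq] at this
  rw [conj_diag_eq_sum, conj_diag_eq_sum]
  have e1 : p = ∑ a, ∑ b, (if a = b then p else 0) * (W a i * W b i) := by
    simp [← Finset.mul_sum, h1]
  have e2 : p * (∑ a, W a i) ^ 2 = ∑ a, ∑ b, p * (W a i * W b i) := by
    rw [sq, Finset.sum_mul_sum]
    simp only [Finset.mul_sum]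
  rw [e2]
  nth_rewrite 2 [e1]
  simp only [← Finset.sum_add_distrib, ← Finset.sum_sub_distrib]
  refine Finset.sum_congr rfl fun a _ => Finset.sum_congr rfl fun b _ => ?_
  rw [flucMat_eq]; ring

lemma bulkTrace_flucMat_le {p R : ℝ} (hp : 0 ≤ p) (hR : 0 ≤ R) (g : EdgeIdx n → Bool) :
    bulkTrace R (flucMat p g) ≤ bulkTrace R (adjOf g) + 6 * R ^ 2 * p * n := by
  have hM := flucMat_isHermitian p g
  have hA := adjOf_isHermitian g
  have h1 : specSum (bulkCube R) (flucMat p g) ≤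
      specSum (bulkCube R) (adjOf g) + 3 * R ^ 2 * p * n := by
    rw [specSum_eq _ hM, specSum_eq _ hA]
    have h := sum_apply_conj_le (convexOn_bulkCube hR) hA (eigMat_transpose_mul hM)
    have h2 : ∀ i, bulkCube R (hM.eigenvalues i) ≤
        bulkCube R (((eigMat hM)ᵀ * adjOf g * eigMat hM) i i) + 3 * R ^ 2 * p := fun i => by
      have h3 := conj_flucMat_diag p g (eigMat_transpose_mul hM) i
      rw [eigMat_conj, diagonal_apply_eq] at h3
      refine (bulkCube_le_add hR _ _).trans (add_le_add le_rfl ?_)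
      refine mul_le_mul_of_nonneg_left (max_le hp ?_) (by positivity)
      have := mul_nonneg hp (sq_nonneg (∑ a, eigMat hM a i))
      linarith
    have h4 := Finset.sum_le_sum fun i (_ : i ∈ Finset.univ) => h2 i
    rw [Finset.sum_add_distrib, Finset.sum_const, Finset.card_univ, Fintype.card_fin,
      nsmul_eq_mul] at h4
    linarith
  have h2 : specSum (fun x => bulkCube R (-x)) (adjOf g) ≤
      specSum (fun x => bulkCube R (-x)) (flucMat p g) + 3 * R ^ 2 * p * n := by
    rw [specSum_eq _ hM, specSum_eq _ hA]
    have h := sum_apply_conj_le (convexOn_bulkCube_neg hR) hM (eigMat_transpose_mul hA)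
    have h2 : ∀ i, bulkCube R (-hA.eigenvalues i) ≤
        bulkCube R (-((eigMat hA)ᵀ * flucMat p g * eigMat hA) i i) + 3 * R ^ 2 * p := fun i => by
      have h3 := conj_flucMat_diag p g (eigMat_transpose_mul hA) i
      rw [eigMat_conj, diagonal_apply_eq] at h3
      refine (bulkCube_le_add hR _ _).trans (add_le_add le_rfl ?_)
      refine mul_le_mul_of_nonneg_left (max_le hp ?_) (by positivity)
      have := mul_nonneg hp (sq_nonneg (∑ a, eigMat hA a i))
      linarith
    have h4 := Finset.sum_le_sum fun i (_ : i ∈ Finset.univ) => h2 i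
    rw [Finset.sum_add_distrib, Finset.sum_const, Finset.card_univ, Fintype.card_fin,
      nsmul_eq_mul] at h4
    linarith
  rw [bulkTrace, bulkTrace]
  linarith

lemma exists_eigenvalue_ge (hn : 1 ≤ n) {A : Matrix (Fin n) (Fin n) ℝ} (hA : A.IsHermitian) :
    ∃ i, (∑ a, ∑ b, A a b) / n ≤ hA.eigenvalues i := by
  have : Nonempty (Fin n) := ⟨⟨0, hn⟩⟩
  obtain ⟨i, hi⟩ := Finite.exists_max hA.eigenvalues
  refine ⟨i, ?_⟩
  have hn0 : (0 : ℝ) < n := by exact_mod_cast hn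
  have h1 : ∑ a, ∑ b, A a b = ∑ i, hA.eigenvalues i * (∑ a, eigMat hA a i) ^ 2 := by
    have h : ∀ i, hA.eigenvalues i * (∑ a, eigMat hA a i) ^ 2 =
        ∑ a, ∑ b, hA.eigenvalues i * (eigMat hA a i * eigMat hA b i) := fun i => by
      rw [sq, Finset.sum_mul_sum]; simp only [Finset.mul_sum]
    simp only [h]
    rw [Finset.sum_comm]
    refine Finset.sum_congr rfl fun a _ => ?_
    rw [Finset.sum_comm]
    refine Finset.sum_congr rfl fun b _ => ?_
    rw [apply_eq_sum_eigenvalues hA]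
    exact Finset.sum_congr rfl fun i _ => by ring
  have h2 : ∑ i, (∑ a, eigMat hA a i) ^ 2 = n := by
    simp only [sq, Finset.sum_mul_sum]
    rw [Finset.sum_comm]
    have h : ∀ a, ∑ i, ∑ b, eigMat hA a i * eigMat hA b i = 1 := fun a => by
      rw [Finset.sum_comm]
      have h3 : ∀ b, ∑ i, eigMat hA a i * eigMat hA b i = if a = b then 1 else 0 := fun b => by
        have := congrFun (congrFun (eigMat_mul_transpose hA) a) b
        rwa [mul_apply, one_apply] at this
      simp [h3]
    simp [h]
  rw [div_le_iff₀ hn0, h1, ← h2, Finset.mul_sum]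
  exact Finset.sum_le_sum fun j _ => mul_le_mul_of_nonneg_right (hi j) (sq_nonneg _)

lemma sum_low_cube_ge (hn : 1 ≤ n) {R : ℝ} (hR : 0 ≤ R) {A : Matrix (Fin n) (Fin n) ℝ}
    (hA : A.IsHermitian) (h1 : ∀ i j, |A i j| ≤ 1) (hs : 0 ≤ ∑ a, ∑ b, A a b) :
    ((∑ a, ∑ b, A a b) / n) ^ 3 + bulkTrace R A - 3 * R ^ 2 * n - (A * A * A).trace ≤
      ∑ i with hA.eigenvalues i < -R, -hA.eigenvalues i ^ 3 := by
  obtain ⟨k, hk⟩ := exists_eigenvalue_ge hn hA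
  have hk0 : 0 ≤ (∑ a, ∑ b, A a b) / n := by positivity
  have hk3 := pow_le_pow_left₀ hk0 hk 3
  set s := (∑ a, ∑ b, A a b) / n
  set d : Fin n → ℝ := fun i => if i = k then s ^ 3 - 3 * R ^ 2 * n else 0 with hd
  have hsum : ∑ i, d i = s ^ 3 - 3 * R ^ 2 * n := by simp [hd]
  have key : ∀ i, bulkCube R (hA.eigenvalues i) - bulkCube R (-hA.eigenvalues i) + d i -
      hA.eigenvalues i ^ 3 ≤
      if hA.eigenvalues i < -R then -hA.eigenvalues i ^ 3 else 0 := fun i => by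
    rcases le_total 0 (hA.eigenvalues i) with h0 | h0
    · have h2 : d i ≤ hA.eigenvalues i ^ 3 - bulkCube R (hA.eigenvalues i) := by
        by_cases hik : i = k
        · subst hik
          have h2 := bulkCube_le_mul hR h0
          have h3 := mul_le_mul_of_nonneg_left
            ((le_abs_self _).trans (abs_eigenvalue_le hA h1 i)) (by positivity : 0 ≤ 3 * R ^ 2)
          simp only [hd, if_true]
          linarith
        · simp only [hd, if_neg hik]
          have := bulkCube_le_cube (R := R) h0
          linarith
      rw [if_neg (by linarith), bulkCube_of_nonpos hR (neg_nonpos.2 h0)]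
      linarith
    · have hz : d i ≤ 0 := by
        by_cases hik : i = k
        · subst hik
          have h2 : s = 0 := le_antisymm (hk.trans h0) hk0
          simp only [hd, if_true, h2]
          have : 0 ≤ 3 * R ^ 2 * n := by positivity
          linarith
        · simp [hd, hik]
      rw [bulkCube_of_nonpos hR h0]
      split_ifs with hlow
      · have := bulkCube_nonneg hR (-hA.eigenvalues i)
        linarith
      · rw [bulkCube_of_mem (neg_nonneg.2 h0) (by linarith)]
        nlinarith
  rw [Finset.sum_filter]
  refine le_trans (le_of_eq ?_) (Finset.sum_le_sum fun i _ => key i)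
  rw [trace_pow_three_eq hA, bulkTrace_eq R hA, Finset.sum_sub_distrib (s := Finset.univ)
    (g := fun i => hA.eigenvalues i ^ 3), Finset.sum_add_distrib, hsum]
  ring

lemma eigDesc_spec (hn : 2 ≤ n) {A : Matrix (Fin n) (Fin n) ℝ} (hA : A.IsHermitian) :
    ∃ i j, i ≠ j ∧ eigDesc A (n - 1) = hA.eigenvalues i ∧ eigDesc A (n - 2) = hA.eigenvalues j ∧
      ∀ k, hA.eigenvalues i ≤ hA.eigenvalues k := by
  set σ := Tuple.sort hA.eigenvalues with hσ
  refine ⟨σ ⟨0, by omega⟩, σ ⟨1, by omega⟩, ?_, ?_, ?_, fun k => ?_⟩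
  · intro h
    have := σ.injective h
    simp at this
  · rw [eigDesc, dif_pos (by omega), dif_pos hA]
    congr 2
    ext; simp [Fin.val_rev]; omega
  · rw [eigDesc, dif_pos (by omega), dif_pos hA]
    congr 2
    ext; simp [Fin.val_rev]; omega
  · have h := Tuple.monotone_sort hA.eigenvalues (a := ⟨0, by omega⟩) (b := σ.symm k)
      (Fin.mk_le_of_le_val (Nat.zero_le _))
    simpa [hσ] using h

lemma low_eigenvalues (hn : 2 ≤ n) {R X : ℝ} (hR : 0 ≤ R) {A : Matrix (Fin n) (Fin n) ℝ}
    (hA : A.IsHermitian) (hX : 0 < X)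
    (hXA : X ≤ ∑ i with hA.eigenvalues i < -R, -hA.eigenvalues i ^ 3) :
    eigDesc A (n - 1) < 0 ∧ X ≤ -eigDesc A (n - 1) * lowSq hA R ∧
      eigDesc A (n - 1) ^ 2 ≤ lowSq hA R ∧
      (-R ≤ eigDesc A (n - 2) ∨
        eigDesc A (n - 1) ^ 2 + eigDesc A (n - 2) ^ 2 ≤ lowSq hA R) := by
  obtain ⟨i, j, hij, hi, hj, hmin⟩ := eigDesc_spec hn hA
  rw [hi, hj]
  have hil : hA.eigenvalues i < -R := by
    by_contra! hcon
    have : (Finset.univ.filter fun i => hA.eigenvalues i < -R) = ∅ := by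
      refine Finset.filter_false_of_mem fun k _ => ?_
      linarith [hmin k]
    rw [this, Finset.sum_empty] at hXA
    linarith
  refine ⟨by linarith, hXA.trans ?_, ?_, ?_⟩
  · rw [lowSq, Finset.mul_sum]
    refine Finset.sum_le_sum fun k _ => ?_
    nlinarith [mul_nonneg (sub_nonneg.2 (hmin k)) (sq_nonneg (hA.eigenvalues k))]
  · exact Finset.single_le_sum (f := fun i => hA.eigenvalues i ^ 2)
      (fun _ _ => sq_nonneg _) (Finset.mem_filter.2 ⟨Finset.mem_univ i, hil⟩)
  · by_cases hjl : hA.eigenvalues j < -R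
    · right
      rw [← Finset.sum_pair hij (f := fun i => hA.eigenvalues i ^ 2)]
      refine Finset.sum_le_sum_of_subset_of_nonneg ?_ fun _ _ _ => sq_nonneg _
      intro k hk
      rw [Finset.mem_insert, Finset.mem_singleton] at hk
      rw [Finset.mem_filter]
      rcases hk with rfl | rfl
      · exact ⟨Finset.mem_univ _, hil⟩
      · exact ⟨Finset.mem_univ _, hjl⟩
    · exact Or.inl (not_lt.1 hjl)

lemma cubes_of_low_bounds {a b Q ρ η ε R : ℝ} (hρ : 0 < ρ) (hη : 0 < η) (hη1 : 10 * η ≤ 1)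
    (hε : 10 * η ≤ ε) (ha : a < 0) (hX : (1 - η) * ρ ^ 3 ≤ -a * Q) (haQ : a ^ 2 ≤ Q)
    (hQ : Q ≤ (1 + η) * ρ ^ 2) (hRρ : R ^ 3 ≤ ε * ρ ^ 3)
    (hb : -R ≤ b ∨ a ^ 2 + b ^ 2 ≤ Q) :
    -(1 + ε) * ρ ^ 3 ≤ a ^ 3 ∧ a ^ 3 ≤ -(1 - ε) * ρ ^ 3 ∧ -(ε * ρ ^ 3) ≤ b ^ 3 := by
  obtain ⟨x, rfl⟩ : ∃ x, a = -(x * ρ) := ⟨-a / ρ, by field_simp⟩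
  obtain ⟨y, rfl⟩ : ∃ y, b = y * ρ := ⟨b / ρ, by field_simp⟩
  obtain ⟨Z, rfl⟩ : ∃ Z, Q = Z * ρ ^ 2 := ⟨Q / ρ ^ 2, by field_simp⟩
  have hρ3 : 0 < ρ ^ 3 := by positivity
  have hρ2 : 0 < ρ ^ 2 := by positivity
  have hx : 0 < x := by
    by_contra! h
    nlinarith [mul_nonneg (neg_nonneg.2 h) hρ.le]
  have hX' : 1 - η ≤ x * Z := by
    refine le_of_mul_le_mul_right (hX.trans_eq ?_) hρ3; ring
  have hxZ : x ^ 2 ≤ Z := by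
    refine le_of_mul_le_mul_right (le_trans (le_of_eq ?_) haQ) hρ2; ring
  have hZ : Z ≤ 1 + η := le_of_mul_le_mul_right hQ hρ2
  have hx1 : 1 - 2 * η ≤ x := by
    have : 1 - η ≤ x * (1 + η) := hX'.trans (mul_le_mul_of_nonneg_left hZ hx.le)
    nlinarith
  have hx2 : x ≤ 1 + η := by nlinarith
  refine ⟨?_, ?_, ?_⟩
  · have : x ^ 3 ≤ 1 + ε := by
      have h1 : x ^ 3 = x ^ 2 * x := by ring
      have h2 : x ^ 2 * x ≤ (1 + η) * (1 + η) :=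
        mul_le_mul (hxZ.trans hZ) hx2 hx.le (by linarith)
      nlinarith
    nlinarith
  · have : 1 - ε ≤ x ^ 3 := by
      have h1 : (1 - 2 * η) ^ 3 ≤ x ^ 3 := pow_le_pow_left₀ (by linarith) hx1 3
      nlinarith [mul_pos hη hη]
    nlinarith
  · rcases hb with hb | hb
    · rcases le_total 0 (y * ρ) with h0 | h0
      · have : 0 ≤ (y * ρ) ^ 3 := by positivity
        have : 0 ≤ ε * ρ ^ 3 := mul_nonneg (by linarith) hρ3.le
        linarith
      · have h1 : (-(y * ρ)) ^ 3 ≤ R ^ 3 := pow_le_pow_left₀ (by linarith) (by linarith) 3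
        nlinarith
    · have h1 : x ^ 2 + y ^ 2 ≤ Z := by
        refine le_of_mul_le_mul_right (le_trans (le_of_eq ?_) hb) hρ2; ring
      have h2 : (1 - 2 * η) ^ 2 ≤ x ^ 2 := pow_le_pow_left₀ (by linarith) hx1 2
      have h3 : y ^ 2 ≤ 5 * η := by nlinarith
      have h4 : -1 ≤ y := by nlinarith
      have h5 : -ε ≤ y ^ 3 := by
        nlinarith [mul_nonneg (sq_nonneg y) (by linarith : 0 ≤ y + 1)]
      have : (y * ρ) ^ 3 = y ^ 3 * ρ ^ 3 := by ring
      nlinarith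

end Deterministic

section UpperBound

variable {n : ℕ}

lemma lowSq_exponent_le {v δ e K C ρ w B : ℝ} (hv0 : 0 < v) (hδ0 : 0 < δ) (hδ1 : δ ≤ 1)
    (he : 16 * e ^ 2 ≤ δ / 4) (hB : 0 ≤ B) (hK0 : 0 < K) (hK : 256 * v * B ≤ δ * K ^ 2)
    (hC1 : 1 ≤ C) (hC2 : 2 ≤ δ * C) (hC3 : 64 * v * (B + 1) ≤ δ * C) (hw : 1 ≤ w)
    (hwn : w ^ 4 = n) (hρ : C * w ^ 3 ≤ ρ) :
    (n + 1) * Real.exp (B * n * (1 + ((1 + δ) * ρ) ^ 2 / (K * w ^ 2) ^ 2) -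
      (1 - 16 * e ^ 2) * (((1 + δ) * ρ - w ^ 2) ^ 2 / (4 * v))) ≤
    Real.exp (-((1 + δ / 4) * (ρ ^ 2 / (4 * v)))) := by
  set Z := ρ ^ 2 / (4 * v) with hZ
  have hw0 : 0 < w := by linarith
  have hρ0 : 0 < ρ := lt_of_lt_of_le (by positivity) hρ
  have hZ0 : 0 < Z := by positivity
  have h1 : w ^ 2 ≤ δ / 2 * ρ := by
    have : w ^ 2 ≤ w ^ 3 := pow_le_pow_right₀ hw (by norm_num)
    have h2 := mul_le_mul_of_nonneg_left hρ hδ0.le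
    nlinarith [mul_le_mul_of_nonneg_right hC2 (pow_pos hw0 3).le]
  have h2 : (1 + δ / 2) * Z ≤ (1 - 16 * e ^ 2) * (((1 + δ) * ρ - w ^ 2) ^ 2 / (4 * v)) := by
    have h3 : ((1 + δ / 2) * ρ) ^ 2 ≤ ((1 + δ) * ρ - w ^ 2) ^ 2 :=
      pow_le_pow_left₀ (by positivity) (by linarith) 2
    calc (1 + δ / 2) * Z ≤ (1 - δ / 4) * ((1 + δ / 2) ^ 2 * Z) := by
          have : 1 + δ / 2 ≤ (1 - δ / 4) * (1 + δ / 2) ^ 2 := by nlinarith [mul_pos hδ0 hδ0]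
          nlinarith
      _ = (1 - δ / 4) * (((1 + δ / 2) * ρ) ^ 2 / (4 * v)) := by rw [hZ]; ring
      _ ≤ (1 - 16 * e ^ 2) * (((1 + δ / 2) * ρ) ^ 2 / (4 * v)) := by
          gcongr
      _ ≤ _ := by
          have : 0 ≤ 1 - 16 * e ^ 2 := by linarith
          gcongr
  have hn2 : (n : ℝ) * (C * C) ≤ ρ ^ 2 := by
    have h3 : (C * w ^ 3) ^ 2 ≤ ρ ^ 2 := pow_le_pow_left₀ (by positivity) hρ 2
    have h4 : w ^ 4 ≤ w ^ 6 := pow_le_pow_right₀ hw (by norm_num)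
    rw [← hwn]
    nlinarith [mul_le_mul_of_nonneg_left h4 (mul_self_nonneg C)]
  have h3 : (B + 1) * n ≤ δ / 16 * Z := by
    have h4 : 64 * v * (B + 1) * n ≤ δ * ρ ^ 2 := by
      calc 64 * v * (B + 1) * n ≤ δ * C * n := by gcongr
        _ ≤ δ * (n * (C * C)) := by
            have h5 : C ≤ C * C := by nlinarith
            have h6 := mul_le_mul_of_nonneg_left h5 (mul_nonneg hδ0.le (Nat.cast_nonneg (α := ℝ) n))
            linarith
        _ ≤ _ := by gcongr
    rw [hZ, ← mul_div_assoc, le_div_iff₀ (by positivity)]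
    linarith
  have h4 : B * n * (((1 + δ) * ρ) ^ 2 / (K * w ^ 2) ^ 2) ≤ δ / 16 * Z := by
    have e1 : B * n * (((1 + δ) * ρ) ^ 2 / (K * w ^ 2) ^ 2) = B * ((1 + δ) ^ 2 * ρ ^ 2) / K ^ 2 := by
      rw [← hwn]; field_simp
    rw [e1, hZ, ← mul_div_assoc, div_le_div_iff₀ (by positivity) (by positivity)]
    have h5 : (1 + δ) ^ 2 ≤ 4 := by nlinarith
    calc B * ((1 + δ) ^ 2 * ρ ^ 2) * (4 * v) ≤ B * (4 * ρ ^ 2) * (4 * v) := by gcongr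
      _ = (256 * v * B) * ρ ^ 2 / 16 := by ring
      _ ≤ (δ * K ^ 2) * ρ ^ 2 / 16 := by gcongr
      _ = _ := by ring
  have h5 : (n : ℝ) + 1 ≤ Real.exp n := Real.add_one_le_exp _
  calc _ ≤ Real.exp n * Real.exp (B * n * (1 + ((1 + δ) * ρ) ^ 2 / (K * w ^ 2) ^ 2) -
      (1 - 16 * e ^ 2) * (((1 + δ) * ρ - w ^ 2) ^ 2 / (4 * v))) := by gcongr
    _ ≤ _ := by
      rw [← Real.exp_add]
      refine Real.exp_le_exp.2 ?_
      nlinarith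

lemma mul_pow_le_of_mul_cube_le {C w ρ : ℝ} (hC : 1 ≤ C) (hw : 1 ≤ w) (hρ : C * w ^ 3 ≤ ρ) {j k : ℕ}
    (hk : k ≠ 0) (hj : j ≤ 3 * k) : C * w ^ j ≤ ρ ^ k := by
  have hw0 : 0 < w := by linarith
  calc C * w ^ j ≤ C ^ k * w ^ (3 * k) :=
        mul_le_mul (le_self_pow₀ hC hk) (pow_le_pow_right₀ hw hj) (by positivity) (by positivity)
    _ = (C * w ^ 3) ^ k := by rw [mul_pow, pow_mul]
    _ ≤ _ := pow_le_pow_left₀ (by positivity) hρ k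

lemma pow_four_mul_exp_neg_le (n : ℕ) : (n : ℝ) ^ 4 * Real.exp (-n) ≤ 24 := by
  have h := Real.pow_div_factorial_le_exp (n : ℝ) (Nat.cast_nonneg n) 4
  rw [Real.exp_neg, ← div_eq_mul_inv, div_le_iff₀ (Real.exp_pos _)]
  rw [div_le_iff₀ (by positivity)] at h
  norm_num [Nat.factorial] at h
  linarith

lemma sum_low_cube_ge_of_deficit {p R c ρ D : ℝ} (hp : 0 ≤ p) (hp1 : p ≤ 1) (hn : 2 ≤ n)
    (hR : 0 ≤ R) (g : EdgeIdx n → Bool) (hc : 0 ≤ c) (hcp : c ≤ p * n) (hρp : ρ ≤ p * n)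
    (hρ : 0 ≤ ρ) (hm : p * n - c ≤ 2 * edgeCount g / n)
    (hcond : (adjOf g * adjOf g * adjOf g).trace ≤
      (p ^ 3 - ρ ^ 3 / (n : ℝ) ^ 3) * ((n : ℝ) * ((n : ℝ) - 1) * ((n : ℝ) - 2)))
    (hbulk : -D ≤ bulkTrace R (flucMat p g)) :
    ρ ^ 3 - D - 9 * R ^ 2 * n - 3 * c * (n : ℝ) ^ 2 ≤
      ∑ i with (adjOf_isHermitian g).eigenvalues i < -R,
        -(adjOf_isHermitian g).eigenvalues i ^ 3 := by
  have hn2 : (2 : ℝ) ≤ n := by exact_mod_cast hn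
  have h1 := sum_low_cube_ge (by omega) hR (adjOf_isHermitian g)
    (fun i j => by rw [abs_of_nonneg (adjOf_nonneg g i j)]; exact adjOf_le_one g i j)
    (by rw [sum_adjOf]; positivity)
  rw [sum_adjOf] at h1
  refine le_trans ?_ h1
  have h2 := bulkTrace_flucMat_le hp hR g
  have h3 : p ^ 3 * n ^ 3 - 3 * c * (n : ℝ) ^ 2 ≤ (2 * edgeCount g / n : ℝ) ^ 3 := by
    have h4 : (p * n - c) ^ 3 ≤ (2 * edgeCount g / n : ℝ) ^ 3 :=
      pow_le_pow_left₀ (by linarith) hm 3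
    have h5 : (p * n) ^ 2 ≤ (1 * n : ℝ) ^ 2 := by gcongr
    nlinarith [mul_nonneg (sq_nonneg c) (by linarith : 0 ≤ 3 * (p * n) - c),
      mul_le_mul_of_nonneg_left h5 hc]
  have h4 : (p ^ 3 - ρ ^ 3 / (n : ℝ) ^ 3) * ((n : ℝ) * ((n : ℝ) - 1) * ((n : ℝ) - 2)) ≤
      p ^ 3 * n ^ 3 - ρ ^ 3 := by
    have h5 : 0 ≤ p ^ 3 - ρ ^ 3 / (n : ℝ) ^ 3 := by
      rw [sub_nonneg, div_le_iff₀ (by positivity), ← mul_pow]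
      exact pow_le_pow_left₀ hρ hρp 3
    calc _ ≤ (p ^ 3 - ρ ^ 3 / (n : ℝ) ^ 3) * (n * n * n) := by
          gcongr <;> linarith
      _ = _ := by field_simp
  have h5 : R ^ 2 * (p * n) ≤ R ^ 2 * n := by
    gcongr; nlinarith
  linarith

set_option maxHeartbeats 1000000 in
lemma bernProb_deficit_not_isolated_le {p v δ e K C c ρ w B ε : ℝ} {m : ℕ} (hp : 0 ≤ p)
    (hp1 : p ≤ 1) (hv0 : 0 < v)
    (hv : ∀ s : ℝ, p * Real.exp (s * (1 - p)) + (1 - p) * Real.exp (-(s * p)) ≤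
        Real.exp (v * s ^ 2 / 2))
    (hδ0 : 0 < δ) (hδ1 : 30 * δ ≤ 1) (hδε : 30 * δ ≤ ε) (he0 : 0 < e) (he1 : e ≤ 1)
    (he : 16 * e ^ 2 ≤ δ / 4) (hB : B = 5 * (1 / e ^ 2 + 1)) (hK0 : 0 < K)
    (hK : 256 * v * B ≤ δ * K ^ 2) (hc : 0 ≤ c)
    (hC1 : 1 ≤ C) (hC2 : 2 ≤ δ * C) (hC3 : 64 * v * (B + 1) ≤ δ * C)
    (hC4 : 24 + 9 * K ^ 2 + 3 * c ≤ δ * C) (hC5 : 144 * K ^ 4 ≤ δ ^ 2 * v * C)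
    (hC6 : K ^ 3 ≤ ε * C) (hn : 2 ≤ n) (hw : 1 ≤ w) (hwn : w ^ 4 = n) (hρ : C * w ^ 3 ≤ ρ)
    (hcp : c ≤ p * n) (hρp : ρ ≤ p * n) (hm : p * n - c ≤ 2 * m / n) :
    bernProb (fun _ => p) (fun g : EdgeIdx n → Bool => edgeCount g = m ∧
      (adjOf g * adjOf g * adjOf g).trace ≤
        (p ^ 3 - ρ ^ 3 / (n : ℝ) ^ 3) * ((n : ℝ) * ((n : ℝ) - 1) * ((n : ℝ) - 2)) ∧
      ¬ (-(1 + ε) * ρ ^ 3 ≤ eigDesc (adjOf g) (n - 1) ^ 3 ∧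
        eigDesc (adjOf g) (n - 1) ^ 3 ≤ -(1 - ε) * ρ ^ 3 ∧
        -(ε * ρ ^ 3) ≤ eigDesc (adjOf g) (n - 2) ^ 3)) ≤
    3 * Real.exp (-((1 + δ / 4) * (ρ ^ 2 / (4 * v)))) := by
  have hq : IsBern (fun _ : EdgeIdx n => p) := fun _ => ⟨hp, hp1⟩
  have hw0 : 0 < w := by linarith
  have hρ0 : 0 < ρ := lt_of_lt_of_le (by positivity) hρ
  have hn0 : (0 : ℝ) < n := by rw [← hwn]; positivity
  have hsq : √(n : ℝ) = w ^ 2 := by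
    rw [← hwn, show w ^ 4 = (w ^ 2) ^ 2 by ring, Real.sqrt_sq (by positivity)]
  have hB5 : 5 ≤ B := by
    have : 0 ≤ 1 / e ^ 2 := by positivity
    linarith
  set R := K * w ^ 2 with hR
  have hR0 : 0 < R := by positivity
  have hR2 : R ^ 2 = K ^ 2 * n := by rw [hR, ← hwn]; ring
  have hlow := bernProb_lowSq_ge_le hp hp1 hv0 hv he0 he1 (n := n) (by omega) hR0
    (s := (1 + δ) * ρ) (by
      rw [hsq]
      have h1 := mul_pow_le_of_mul_cube_le hC1 hw hρ (j := 2) (k := 1) one_ne_zero (by norm_num)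
      have h2 := le_mul_of_one_le_left (sq_nonneg w) hC1
      have h3 := mul_pos hδ0 hρ0
      linarith)
  have hlow2 := lowSq_exponent_le (n := n) hv0 hδ0 (by linarith) he (by linarith) hK0 hK hC1 hC2
    hC3 hw hwn hρ
  have hlow3 : 5 * (n : ℝ) * (1 + ((1 + δ) * ρ) ^ 2 / R ^ 2) * (1 / e ^ 2 + 1) =
      B * n * (1 + ((1 + δ) * ρ) ^ 2 / R ^ 2) := by rw [hB]; ring
  rw [hlow3, hsq] at hlow
  have hlow4 := hlow.trans hlow2
  have hK2 : B + 1 ≤ (1 - 16 * e ^ 2) * (K ^ 2 / (4 * v)) := by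
    have h1 : 64 * B ≤ K ^ 2 / (4 * v) := by
      rw [le_div_iff₀ (by positivity)]
      have h2 : δ * K ^ 2 ≤ 1 * K ^ 2 := by gcongr; linarith
      linarith
    have h2 : 1 / 2 * (K ^ 2 / (4 * v)) ≤ (1 - 16 * e ^ 2) * (K ^ 2 / (4 * v)) := by
      gcongr; linarith
    linarith
  have hb : (n : ℝ) ^ 4 * bernProb (fun _ => p)
      (fun g : EdgeIdx n → Bool => ∃ i, R < (flucMat_isHermitian p g).eigenvalues i) ≤ 24 := by
    refine le_trans ?_ (pow_four_mul_exp_neg_le n)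
    refine mul_le_mul_of_nonneg_left ((bernProb_eigenvalue_gt_le hp hp1 hv0 hv he0 he1
      (by omega) hR0).trans (Real.exp_le_exp.2 ?_)) (by positivity)
    have h1 : 5 * (n : ℝ) * (1 / e ^ 2 + 1) = B * n := by rw [hB]; ring
    rw [h1, hR2]
    have h2 := mul_le_mul_of_nonneg_right hK2 hn0.le
    have h3 : (1 - 16 * e ^ 2) * (K ^ 2 * n / (4 * v)) =
      (1 - 16 * e ^ 2) * (K ^ 2 / (4 * v)) * n := by ring
    rw [h3]
    linarith
  have hbulk := bernProb_bulkTrace_le hp hp1 (by omega) hR0 (a := δ / 2 * ρ ^ 3) (by positivity) hb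
  have hbulk2 : (1 + δ / 4) * (ρ ^ 2 / (4 * v)) ≤
      (δ / 2 * ρ ^ 3) ^ 2 / (72 * R ^ 4 * n) := by
    have h1 : R ^ 4 = K ^ 4 * n ^ 2 := by rw [show R ^ 4 = (R ^ 2) ^ 2 by ring, hR2]; ring
    have h2 : C * (n : ℝ) ^ 3 ≤ ρ ^ 4 := by
      rw [← hwn, ← pow_mul]
      exact mul_pow_le_of_mul_cube_le hC1 hw hρ (by norm_num) (by norm_num)
    rw [h1, ← mul_div_assoc, div_le_div_iff₀ (by positivity) (by positivity)]
    calc (1 + δ / 4) * ρ ^ 2 * (72 * (K ^ 4 * n ^ 2) * n) ≤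
          2 * ρ ^ 2 * (72 * (K ^ 4 * n ^ 2) * n) := by
            gcongr; linarith
      _ = 144 * K ^ 4 * (ρ ^ 2 * n ^ 3) := by ring
      _ ≤ δ ^ 2 * v * C * (ρ ^ 2 * n ^ 3) := by gcongr
      _ = δ ^ 2 * v * ρ ^ 2 * (C * n ^ 3) := by ring
      _ ≤ δ ^ 2 * v * ρ ^ 2 * ρ ^ 4 := by gcongr
      _ = _ := by ring
  have hbulk3 := hbulk.trans (mul_le_mul_of_nonneg_left
    (Real.exp_le_exp.2 (neg_le_neg hbulk2)) zero_le_two)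
  refine (bernProb_mono hq (T := fun g => bulkTrace R (flucMat p g) ≤ -(2 * (δ / 2 * ρ ^ 3) + 24) ∨
    ((1 + δ) * ρ) ^ 2 ≤ lowSq (adjOf_isHermitian g) R) fun g hg => ?_).trans
    ((bernProb_or_le hq _ _).trans (by linarith))
  by_contra! hcon
  obtain ⟨hgm, hcond, hnot⟩ := hg
  refine hnot ?_
  have hX := sum_low_cube_ge_of_deficit hp hp1 hn hR0.le g hc hcp hρp hρ0.le
    (by rw [hgm]; exact hm) hcond hcon.1.le
  have hn2 : C * (n : ℝ) ^ 2 ≤ ρ ^ 3 := by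
    rw [← hwn, ← pow_mul]
    exact mul_pow_le_of_mul_cube_le hC1 hw hρ (by norm_num) (by norm_num)
  have hXn : (1 - 3 * δ) * ρ ^ 3 ≤
      ρ ^ 3 - (2 * (δ / 2 * ρ ^ 3) + 24) - 9 * R ^ 2 * n - 3 * c * (n : ℝ) ^ 2 := by
    rw [hR2]
    have h1 := mul_le_mul_of_nonneg_right hC4 (sq_nonneg (n : ℝ))
    have h2 := mul_le_mul_of_nonneg_left hn2 hδ0.le
    have h3 : (1 : ℝ) ≤ (n : ℝ) ^ 2 := one_le_pow₀ (by exact_mod_cast (by omega : 1 ≤ n))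
    linarith [mul_pos hδ0 (pow_pos hρ0 3)]
  have hX2 := hXn.trans hX
  obtain ⟨h1, h2, h3, h4⟩ := low_eigenvalues hn hR0.le (adjOf_isHermitian g)
    (mul_pos (by linarith) (pow_pos hρ0 3)) hX2
  refine cubes_of_low_bounds (η := 3 * δ) hρ0 (by linarith) (by linarith) (by linarith) h1 h2 h3
    (hcon.2.le.trans ?_) ?_ h4
  · rw [mul_pow]
    gcongr
    have h5 : δ * δ ≤ δ * 1 := by gcongr; linarith
    linarith
  · have h5 := mul_pow_le_of_mul_cube_le hC1 hw hρ (j := 6) (k := 3) (by norm_num) (by norm_num)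
    have hε : 0 < ε := by linarith
    calc R ^ 3 = K ^ 3 * w ^ 6 := by rw [hR]; ring
      _ ≤ ε * C * w ^ 6 := by gcongr
      _ = ε * (C * w ^ 6) := by ring
      _ ≤ _ := by gcongr

end UpperBound

section Slices

lemma bernProb_flip_le {ι : Type*} [Fintype ι] [DecidableEq ι] {q : ι → ℝ} (hq : IsBern q) {r : ℝ}
    {b : Bool} (e : ι) (hr : (if b then q e else 1 - q e) ≤ r * (if b then 1 - q e else q e))
    (hr0 : 0 ≤ r) (T : (ι → Bool) → Prop) :
    bernProb q (fun g => g e = b ∧ T (Function.update g e (!b))) ≤ r * bernProb q T := by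
  classical
  have hinv : Function.Involutive fun g : ι → Bool => Function.update g e (!(g e)) := fun g => by
    simp
  unfold bernProb bernExp
  rw [Finset.mul_sum, ← Equiv.sum_comp (hinv.toPerm _)]
  refine Finset.sum_le_sum fun g _ => ?_
  have hw := bernWeight_nonneg hq (Function.update g e (!(g e)))
  simp only [Function.Involutive.coe_toPerm, Function.update_self, Function.update_idem]
  by_cases hg : (!(g e)) = b
  · subst hg
    have h2 : bernWeight q (Function.update g e (!(g e))) ≤ r * bernWeight q g := by
      unfold bernWeight
      rw [← Finset.mul_prod_erase _ _ (Finset.mem_univ e),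
        ← Finset.mul_prod_erase Finset.univ (fun e => if g e then q e else 1 - q e)
          (Finset.mem_univ e), ← mul_assoc]
      rw [Finset.prod_congr (g := fun e => if g e then q e else 1 - q e) rfl fun x hx => by
        rw [Function.update_of_ne (Finset.ne_of_mem_erase hx)]]
      refine mul_le_mul_of_nonneg_right ?_ (Finset.prod_nonneg fun x _ => ?_)
      · cases h : g e <;> simpa [h] using hr
      · split_ifs
        · exact (hq x).1
        · linarith [(hq x).2]
    simp only [true_and, Bool.not_not, Function.update_eq_self]
    split_ifs
    · simpa using h2
    · simp
  · simp only [hg, false_and, if_false, mul_zero]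
    exact mul_nonneg hr0 (mul_nonneg (bernWeight_nonneg hq g) (by split_ifs <;> norm_num))

variable {n : ℕ}

lemma edgeCount_update_false {g : EdgeIdx n → Bool} {e : EdgeIdx n} (h : g e = true) :
    edgeCount (Function.update g e false) + 1 = edgeCount g := by
  have h1 : (edgeCount (Function.update g e false) : ℝ) + 1 = edgeCount g := by
    rw [edgeCount_eq_sum, edgeCount_eq_sum, ← Finset.add_sum_erase _ _ (Finset.mem_univ e),
      ← Finset.add_sum_erase Finset.univ (fun e => boolVal (g e)) (Finset.mem_univ e),
      Finset.sum_congr (g := fun e => boolVal (g e)) rfl fun x hx => by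
        rw [Function.update_of_ne (Finset.ne_of_mem_erase hx)]]
    simp [boolVal, h]
    ring
  exact_mod_cast h1

lemma edgeCount_update_true {g : EdgeIdx n → Bool} {e : EdgeIdx n} (h : g e = false) :
    edgeCount (Function.update g e true) = edgeCount g + 1 := by
  have := edgeCount_update_false (g := Function.update g e true) (e := e) (by simp)
  rw [← this]
  simp [← h]

lemma adjOf_mono {g g' : EdgeIdx n → Bool} (h : ∀ e, g e = true → g' e = true) (i j : Fin n) :
    adjOf g i j ≤ adjOf g' i j := by
  simp only [adjOf, of_apply]
  split_ifs with h1 h2 h3 h4 h5 h6 <;> try norm_num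
  · exact h3 (h _ h2)
  · rename_i h7
    exact h7 (h _ h6)

lemma trace_cube_mono {A B : Matrix (Fin n) (Fin n) ℝ} (hA : ∀ i j, 0 ≤ A i j)
    (h : ∀ i j, A i j ≤ B i j) : (A * A * A).trace ≤ (B * B * B).trace := by
  rw [trace_cube_eq_sum, trace_cube_eq_sum]
  have hB : ∀ i j, 0 ≤ B i j := fun i j => (hA i j).trans (h i j)
  gcongr with i _ k _ j _
  · exact hA _ _
  · exact mul_nonneg (hB _ _) (hB _ _)
  · exact hA _ _
  · exact hB _ _
  · exact h _ _
  · exact h _ _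
  · exact h _ _

lemma trace_cube_sub_le {A B : Matrix (Fin n) (Fin n) ℝ} (hA : ∀ i j, 0 ≤ A i j)
    (h : ∀ i j, A i j ≤ B i j) (hB : ∀ i j, B i j ≤ 1) :
    (B * B * B).trace - (A * A * A).trace ≤ 3 * n * ∑ i, ∑ j, (B i j - A i j) := by
  rw [trace_cube_eq_sum, trace_cube_eq_sum]
  have h1 : ∀ i k j, B i j * B j k * B k i - A i j * A j k * A k i ≤
      (B i j - A i j) + (B j k - A j k) + (B k i - A k i) := fun i k j => by
    have a0 := hA i j; have a1 := h i j; have a2 := hB i j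
    have b0 := hA j k; have b1 := h j k; have b2 := hB j k
    have c0 := hA k i; have c1 := h k i; have c2 := hB k i
    have e1 : (B i j - A i j) * (B j k * B k i) ≤ (B i j - A i j) * 1 :=
      mul_le_mul_of_nonneg_left (mul_le_one₀ b2 (by linarith) c2) (by linarith)
    have e2 : (B j k - A j k) * (A i j * B k i) ≤ (B j k - A j k) * 1 :=
      mul_le_mul_of_nonneg_left (mul_le_one₀ (by linarith) (by linarith) c2) (by linarith)
    have e3 : (B k i - A k i) * (A i j * A j k) ≤ (B k i - A k i) * 1 :=
      mul_le_mul_of_nonneg_left (mul_le_one₀ (by linarith) (by linarith) (by linarith))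
        (by linarith)
    nlinarith
  have h2 : ∑ i, ∑ k, ∑ j, (B i j * B j k * B k i - A i j * A j k * A k i) ≤
      ∑ i, ∑ k, ∑ j, ((B i j - A i j) + (B j k - A j k) + (B k i - A k i)) :=
    Finset.sum_le_sum fun i _ => Finset.sum_le_sum fun k _ => Finset.sum_le_sum fun j _ => h1 i k j
  simp only [Finset.sum_sub_distrib, Finset.sum_add_distrib] at h2 ⊢
  refine h2.trans (le_of_eq ?_)
  simp only [Finset.sum_const, Finset.card_univ, Fintype.card_fin, nsmul_eq_mul,
    ← Finset.mul_sum]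
  have c1 : ∑ i : Fin n, ∑ j, B j i = ∑ i, ∑ j, B i j := Finset.sum_comm
  have c2 : ∑ i : Fin n, ∑ j, A j i = ∑ i, ∑ j, A i j := Finset.sum_comm
  rw [c1, c2]
  ring

lemma trace_cube_update_true_le {g : EdgeIdx n → Bool} {e : EdgeIdx n} (h : g e = false) :
    (adjOf (Function.update g e true) * adjOf (Function.update g e true) *
      adjOf (Function.update g e true)).trace ≤ (adjOf g * adjOf g * adjOf g).trace + 6 * n := by
  have := trace_cube_sub_le (A := adjOf g) (B := adjOf (Function.update g e true)) (adjOf_nonneg g)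
    (adjOf_mono fun x hx => by
      by_cases hxe : x = e
      · subst hxe; simp
      · simpa [hxe] using hx) (adjOf_le_one _)
  simp only [Finset.sum_sub_distrib, sum_adjOf, edgeCount_update_true h] at this
  push_cast at this
  linarith

/-- The event that a graph has `j` edges and trace of the cube of the adjacency matrix at
most `τ`. -/
def fewTriangles (j : ℕ) (τ : ℝ) (g : EdgeIdx n → Bool) : Prop :=
  edgeCount g = j ∧ (adjOf g * adjOf g * adjOf g).trace ≤ τ

lemma bernProb_fewTriangles_succ_le {p : ℝ} (hp : 1 / 2 ≤ p) (hp1 : p < 1) (j : ℕ) (τ : ℝ) :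
    bernProb (fun _ : EdgeIdx n => p) (fewTriangles (j + 1) τ) ≤
      Fintype.card (EdgeIdx n) * (p / (1 - p)) * bernProb (fun _ : EdgeIdx n => p) (fewTriangles j τ) := by
  have hq : IsBern (fun _ : EdgeIdx n => p) := fun _ => ⟨by linarith, hp1.le⟩
  have h1p : 0 < 1 - p := by linarith
  calc _ ≤ bernProb (fun _ : EdgeIdx n => p) (fun g => ∃ e ∈ Finset.univ,
        g e = true ∧ fewTriangles j τ (Function.update g e (!true))) := by
        refine bernProb_mono hq fun g hg => ?_
        obtain ⟨hg1, hg2⟩ := hg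
        obtain ⟨e, he⟩ : ∃ e, g e = true := by
          by_contra! hne
          simp [edgeCount, hne] at hg1
        refine ⟨e, Finset.mem_univ e, he, ?_, ?_⟩
        · have := edgeCount_update_false he
          simp only [Bool.not_true]
          omega
        · refine (trace_cube_mono (adjOf_nonneg _) (adjOf_mono fun x hx => ?_)).trans hg2
          by_cases hxe : x = e
          · subst hxe; exact he
          · simpa [hxe] using hx
    _ ≤ ∑ e : EdgeIdx n, p / (1 - p) * bernProb (fun _ : EdgeIdx n => p) (fewTriangles j τ) := by
        refine (bernProb_exists_le hq _ _).trans (Finset.sum_le_sum fun e _ => ?_)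
        refine bernProb_flip_le hq e ?_ (by positivity) _
        simp only [if_true]
        rw [div_mul_cancel₀ _ h1p.ne']
    _ = _ := by simp [mul_assoc]

lemma bernProb_fewTriangles_le_succ {p : ℝ} (hp : 1 / 2 ≤ p) (hp1 : p < 1) {j : ℕ}
    (hj : j < Fintype.card (EdgeIdx n)) (τ : ℝ) :
    bernProb (fun _ : EdgeIdx n => p) (fewTriangles j τ) ≤ Fintype.card (EdgeIdx n) *
      (p / (1 - p)) * bernProb (fun _ : EdgeIdx n => p) (fewTriangles (j + 1) (τ + 6 * n)) := by
  have hq : IsBern (fun _ : EdgeIdx n => p) := fun _ => ⟨by linarith, hp1.le⟩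
  have h1p : 0 < 1 - p := by linarith
  calc _ ≤ bernProb (fun _ : EdgeIdx n => p) (fun g => ∃ e ∈ Finset.univ,
        g e = false ∧ fewTriangles (j + 1) (τ + 6 * n) (Function.update g e (!false))) := by
        refine bernProb_mono hq fun g hg => ?_
        obtain ⟨hg1, hg2⟩ := hg
        obtain ⟨e, he⟩ : ∃ e, g e = false := by
          by_contra! hne
          simp only [ne_eq, Bool.not_eq_false] at hne
          simp only [edgeCount, hne, Finset.filter_true, Finset.card_univ] at hg1
          omega
        refine ⟨e, Finset.mem_univ e, he, ?_, ?_⟩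
        · rw [← hg1]
          exact edgeCount_update_true he
        · exact (trace_cube_update_true_le he).trans (by linarith)
    _ ≤ ∑ e : EdgeIdx n, p / (1 - p) *
          bernProb (fun _ : EdgeIdx n => p) (fewTriangles (j + 1) (τ + 6 * n)) := by
        refine (bernProb_exists_le hq _ _).trans (Finset.sum_le_sum fun e _ => ?_)
        refine bernProb_flip_le hq e ?_ (by positivity) _
        simp only [Bool.false_eq_true, if_false]
        rw [div_mul_eq_mul_div, le_div_iff₀ h1p]
        nlinarith
    _ = _ := by simp [mul_assoc]

lemma fewTriangles_mono {j : ℕ} {τ τ' : ℝ} (h : τ ≤ τ') {g : EdgeIdx n → Bool}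
    (hg : fewTriangles j τ g) : fewTriangles j τ' g := ⟨hg.1, hg.2.trans h⟩

lemma bernProb_fewTriangles_add_le {p M : ℝ} (hp : 1 / 2 ≤ p) (hp1 : p < 1)
    (hM : Fintype.card (EdgeIdx n) * (p / (1 - p)) ≤ M) (m d : ℕ) (τ : ℝ) :
    bernProb (fun _ : EdgeIdx n => p) (fewTriangles (m + d) τ) ≤
      M ^ d * bernProb (fun _ : EdgeIdx n => p) (fewTriangles m τ) := by
  have hq : IsBern (fun _ : EdgeIdx n => p) := fun _ => ⟨by linarith, hp1.le⟩
  have h1p : 0 < 1 - p := by linarith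
  have hM0 : 0 ≤ M := le_trans (by positivity) hM
  induction d with
  | zero => simp
  | succ d ih =>
    rw [← add_assoc]
    refine (bernProb_fewTriangles_succ_le hp hp1 _ _).trans ?_
    rw [pow_succ', mul_assoc M]
    exact mul_le_mul hM ih (bernProb_nonneg hq _) hM0

lemma bernProb_fewTriangles_sub_le {p M : ℝ} (hp : 1 / 2 ≤ p) (hp1 : p < 1)
    (hM : Fintype.card (EdgeIdx n) * (p / (1 - p)) ≤ M) (m d : ℕ)
    (hmd : m + d ≤ Fintype.card (EdgeIdx n)) (τ : ℝ) :
    bernProb (fun _ : EdgeIdx n => p) (fewTriangles m τ) ≤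
      M ^ d * bernProb (fun _ : EdgeIdx n => p) (fewTriangles (m + d) (τ + 6 * n * d)) := by
  have hq : IsBern (fun _ : EdgeIdx n => p) := fun _ => ⟨by linarith, hp1.le⟩
  have h1p : 0 < 1 - p := by linarith
  have hM0 : 0 ≤ M := le_trans (by positivity) hM
  induction d with
  | zero => simp
  | succ d ih =>
    refine (ih (by omega)).trans ?_
    rw [pow_succ, mul_assoc (M ^ d)]
    refine mul_le_mul_of_nonneg_left ?_ (by positivity)
    refine (bernProb_fewTriangles_le_succ hp hp1 (by omega) _).trans ?_
    have e1 : τ + 6 * n * d + 6 * n = τ + 6 * n * ((d + 1 : ℕ) : ℝ) := by push_cast; ring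
    rw [e1]
    exact mul_le_mul hM le_rfl (bernProb_nonneg hq _) hM0

/-- Graphs with about `m` edges and few triangles can be turned into graphs with exactly `m`
edges and few triangles. -/
lemma bernProb_fewTriangles_window_le {p M : ℝ} (hp : 1 / 2 ≤ p) (hp1 : p < 1) (hM1 : 1 ≤ M)
    (hM : Fintype.card (EdgeIdx n) * (p / (1 - p)) ≤ M) {m Y : ℕ}
    (hm : m ≤ Fintype.card (EdgeIdx n)) (τ : ℝ) :
    bernProb (fun _ : EdgeIdx n => p) (fun g => |(edgeCount g : ℝ) - m| ≤ Y ∧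
      (adjOf g * adjOf g * adjOf g).trace ≤ τ) ≤ (Fintype.card (EdgeIdx n) + 1) * (M ^ Y *
        bernProb (fun _ : EdgeIdx n => p) (fewTriangles m (τ + 6 * n * Y))) := by
  have hq : IsBern (fun _ : EdgeIdx n => p) := fun _ => ⟨by linarith, hp1.le⟩
  have hn : (0 : ℝ) ≤ n := n.cast_nonneg
  calc _ ≤ bernProb (fun _ : EdgeIdx n => p) (fun g =>
        ∃ j ∈ Finset.range (Fintype.card (EdgeIdx n) + 1),
          |(j : ℝ) - m| ≤ Y ∧ fewTriangles j τ g) := by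
        refine bernProb_mono hq fun g hg => ⟨edgeCount g, ?_, hg.1, rfl, hg.2⟩
        rw [Finset.mem_range, Nat.lt_succ_iff]
        exact Finset.card_le_univ _
    _ ≤ ∑ j ∈ Finset.range (Fintype.card (EdgeIdx n) + 1),
        M ^ Y * bernProb (fun _ : EdgeIdx n => p) (fewTriangles m (τ + 6 * n * Y)) := by
        refine (bernProb_exists_le hq _ _).trans (Finset.sum_le_sum fun j _ => ?_)
        by_cases hjm : |(j : ℝ) - m| ≤ Y
        · refine (bernProb_mono hq fun g hg => hg.2).trans ?_
          obtain ⟨h1, h2⟩ := abs_le.1 hjm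
          rcases le_total m j with h | h
          · obtain ⟨d, rfl⟩ := Nat.exists_eq_add_of_le h
            push_cast at h2
            have hd : d ≤ Y := by
              have : (d : ℝ) ≤ Y := by linarith
              exact_mod_cast this
            refine (bernProb_fewTriangles_add_le hp hp1 hM m d τ).trans ?_
            refine mul_le_mul (pow_le_pow_right₀ hM1 hd) (bernProb_mono hq fun g hg => ?_)
              (bernProb_nonneg hq _) (by positivity)
            exact fewTriangles_mono (le_add_of_nonneg_right (by positivity)) hg
          · obtain ⟨d, rfl⟩ := Nat.exists_eq_add_of_le h
            push_cast at h1
            have hd' : (d : ℝ) ≤ Y := by linarith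
            have hd : d ≤ Y := by exact_mod_cast hd'
            refine (bernProb_fewTriangles_sub_le hp hp1 hM j d hm τ).trans ?_
            refine mul_le_mul (pow_le_pow_right₀ hM1 hd) (bernProb_mono hq fun g hg => ?_)
              (bernProb_nonneg hq _) (by positivity)
            exact fewTriangles_mono (by gcongr) hg
        · have h0 : bernProb (fun _ : EdgeIdx n => p)
              (fun g => |(j : ℝ) - m| ≤ Y ∧ fewTriangles j τ g) ≤ 0 := by
            simp [bernProb, hjm, bernExp]
          exact h0.trans (mul_nonneg (by positivity) (bernProb_nonneg hq _))
    _ = _ := by simp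

end Slices

section Tilting

/-- Log-likelihood ratio of two Bernoulli laws. -/
def bernLogRatio (q p : ℝ) (b : Bool) : ℝ :=
  if b then Real.log (q / p) else Real.log ((1 - q) / (1 - p))

/-- Change of measure between two product Bernoulli laws. -/
lemma bernProb_tilt_le {ι : Type*} [Fintype ι] [DecidableEq ι] {q p : ι → ℝ}
    (hq : ∀ e, 0 < q e ∧ q e < 1) (hp : ∀ e, 0 < p e ∧ p e < 1) (S : (ι → Bool) → Prop) (b : ℝ) :
    bernProb q (fun g => S g ∧ ∑ e, bernLogRatio (q e) (p e) (g e) ≤ b) ≤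
      Real.exp b * bernProb p S := by
  classical
  unfold bernProb bernExp
  rw [Finset.mul_sum]
  refine Finset.sum_le_sum fun g _ => ?_
  have hpw := bernWeight_nonneg (q := p) (fun e => ⟨(hp e).1.le, (hp e).2.le⟩) g
  have hw : bernWeight q g =
      Real.exp (∑ e, bernLogRatio (q e) (p e) (g e)) * bernWeight p g := by
    rw [Real.exp_sum]
    unfold bernWeight
    rw [← Finset.prod_mul_distrib]
    refine Finset.prod_congr rfl fun e _ => ?_
    obtain ⟨h1, h2⟩ := hq e
    obtain ⟨h3, h4⟩ := hp e
    unfold bernLogRatio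
    split_ifs
    · rw [Real.exp_log (div_pos h1 h3), div_mul_cancel₀ _ h3.ne']
    · rw [Real.exp_log (div_pos (by linarith) (by linarith)), div_mul_cancel₀ _ (by linarith)]
  by_cases hS : S g
  · by_cases hb : ∑ e, bernLogRatio (q e) (p e) (g e) ≤ b
    · simp only [hS, hb, and_self, if_true, mul_one]
      rw [hw]
      exact mul_le_mul_of_nonneg_right (Real.exp_le_exp.2 hb) hpw
    · simp only [hS, hb, and_false, if_true, if_false, mul_zero, mul_one]
      positivity
  · simp [hS]

lemma abs_log_le_of_mem {x a b : ℝ} (ha : 0 < a) (hax : a ≤ x) (hxb : x ≤ b) :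
    |Real.log x| ≤ |Real.log a| + |Real.log b| := by
  have h1 := Real.log_le_log ha hax
  have h2 := Real.log_le_log (ha.trans_le hax) hxb
  rw [abs_le]
  constructor
  · linarith [neg_abs_le (Real.log a), abs_nonneg (Real.log b)]
  · linarith [le_abs_self (Real.log b), abs_nonneg (Real.log a)]

lemma exists_abs_bernLogRatio_le {p δ : ℝ} (hδp : δ < p) (hp : 0 < p) (hp1 : p < 1) :
    ∃ c, ∀ q, p - δ ≤ q → q ≤ (1 + p) / 2 → ∀ b, |bernLogRatio q p b| ≤ c := by
  refine ⟨|Real.log ((p - δ) / p)| + |Real.log (1 / p)| +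
    (|Real.log (1 / 2)| + |Real.log (1 / (1 - p))|), fun q hq hq1 b => ?_⟩
  have h1p : 0 < 1 - p := by linarith
  cases b
  · have h : |bernLogRatio q p false| ≤ |Real.log (1 / 2)| + |Real.log (1 / (1 - p))| := by
      refine abs_log_le_of_mem (by norm_num) ?_ ?_
      · rw [le_div_iff₀ h1p]; linarith
      · gcongr; linarith
    have := abs_nonneg (Real.log ((p - δ) / p))
    have := abs_nonneg (Real.log (1 / p))
    linarith
  · have h : |bernLogRatio q p true| ≤ |Real.log ((p - δ) / p)| + |Real.log (1 / p)| := by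
      refine abs_log_le_of_mem (div_pos (by linarith) hp) ?_ ?_
      · gcongr
      · gcongr; linarith
    have := abs_nonneg (Real.log (1 / 2))
    have := abs_nonneg (Real.log (1 / (1 - p)))
    linarith

/-- The log-likelihood ratio of a product tilt concentrates around the relative entropy. -/
lemma bernProb_sum_bernLogRatio_ge_le {ι : Type*} [Fintype ι] [DecidableEq ι] {q : ι → ℝ}
    {p c y N : ℝ} (hq : IsBern q) (hc : 0 < c) (hL : ∀ e b, |bernLogRatio (q e) p b| ≤ c)
    (hy : 0 ≤ y) (hN : (Fintype.card ι : ℝ) ≤ N) (hN0 : 0 < N) :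
    bernProb q (fun g => ∑ e, bernKL (q e) p + y ≤ ∑ e, bernLogRatio (q e) p (g e)) ≤
      Real.exp (-(y ^ 2 / (4 * N * (2 * c) ^ 2))) := by
  have hmean : ∀ e, q e * bernLogRatio (q e) p true + (1 - q e) * bernLogRatio (q e) p false =
      bernKL (q e) p := fun e => by simp [bernLogRatio, bernKL]
  have hKL : ∀ e, |bernKL (q e) p| ≤ c := fun e => by
    rw [← hmean e]
    have h1 := abs_le.1 (hL e true)
    have h2 := abs_le.1 (hL e false)
    have h3 := (hq e).1
    have h4 := (hq e).2
    rw [abs_le]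
    constructor <;> nlinarith
  refine (bernProb_mono hq fun g hg => ?_).trans
    (bernProb_sum_ge_le hq (X := fun e b => bernLogRatio (q e) p b - bernKL (q e) p) (c := 2 * c)
      (y := y) (fun e => by linarith [hmean e]) (by positivity) (fun e b => ?_) hy N hN hN0)
  · rw [Finset.sum_sub_distrib]
    linarith
  · have h1 := abs_le.1 (hL e b)
    have h2 := abs_le.1 (hKL e)
    rw [abs_le]
    constructor <;> linarith

lemma bernProb_abs_edgeCount_sub_ge_le {n : ℕ} {q : EdgeIdx n → ℝ} (hq : IsBern q) {y N : ℝ}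
    (hy : 0 ≤ y) (hN : (Fintype.card (EdgeIdx n) : ℝ) ≤ N) (hN0 : 0 < N) :
    bernProb q (fun g => y ≤ |(edgeCount g : ℝ) - ∑ e, q e|) ≤
      2 * Real.exp (-(y ^ 2 / (4 * N))) := by
  have h1 := bernProb_sum_ge_le hq (X := fun e b => boolVal b - q e) (c := 1)
      (y := y) (fun e => by simp [boolVal]; ring) one_pos (fun e b => ?_) hy N hN hN0
  · have h2 := bernProb_sum_ge_le hq (X := fun e b => q e - boolVal b) (c := 1)
      (y := y) (fun e => by simp [boolVal]; ring) one_pos (fun e b => ?_) hy N hN hN0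
    · simp only [one_pow, mul_one] at h1 h2
      calc _ ≤ bernProb q (fun g => (y ≤ ∑ e, (boolVal (g e) - q e)) ∨
            (y ≤ ∑ e, (q e - boolVal (g e)))) := bernProb_mono hq fun g hg => by
            rw [edgeCount_eq_sum, ← Finset.sum_sub_distrib] at hg
            rcases le_abs.1 hg with h | h
            · exact Or.inl h
            · right
              rw [← Finset.sum_neg_distrib] at h
              simpa using h
        _ ≤ _ := (bernProb_or_le hq _ _).trans (by linarith)
    · have := boolVal_mem b
      rw [abs_le]
      constructor <;> linarith [(hq e).1, (hq e).2]
  · have := boolVal_mem b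
    rw [abs_le]
    constructor <;> linarith [(hq e).1, (hq e).2]

variable {n : ℕ}

/-- A rank-one perturbation orthogonal to the constants lowers the trace of the cube. -/
lemma trace_cube_smat_rankOne_le {p δ : ℝ} {u : Fin n → ℝ} (hu : ∑ i, u i = 0)
    (hpos : ∀ i j, 0 ≤ p - δ * (u i * u j)) :
    (smat (fun e : EdgeIdx n => p - δ * (u e.1.1 * u e.1.2)) *
      smat (fun e : EdgeIdx n => p - δ * (u e.1.1 * u e.1.2)) *
      smat (fun e : EdgeIdx n => p - δ * (u e.1.1 * u e.1.2))).trace ≤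
      p ^ 3 * (n : ℝ) ^ 3 - δ ^ 3 * (∑ i, u i ^ 2) ^ 3 := by
  set S := ∑ i, u i ^ 2 with hS
  set Q : Matrix (Fin n) (Fin n) ℝ := Matrix.of fun i j => p - δ * (u i * u j) with hQ
  have hle : ∀ i j, smat (fun e : EdgeIdx n => p - δ * (u e.1.1 * u e.1.2)) i j ≤ Q i j := by
    intro i j
    by_cases h : i = j
    · subst h; simpa [hQ] using hpos i i
    · rw [smat_of_ne (fun i j => p - δ * (u i * u j)) (fun i j => by ring) h]; simp [hQ]
  have hnn : ∀ i j, 0 ≤ smat (fun e : EdgeIdx n => p - δ * (u e.1.1 * u e.1.2)) i j := by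
    intro i j
    by_cases h : i = j
    · subst h; simp
    · rw [smat_of_ne (fun i j => p - δ * (u i * u j)) (fun i j => by ring) h]; exact hpos i j
  refine (trace_cube_mono hnn hle).trans (le_of_eq ?_)
  have h2 : Q * Q = Matrix.of fun i j => p ^ 2 * n + δ ^ 2 * S * (u i * u j) := by
    ext i j
    simp only [Matrix.mul_apply, hQ, of_apply]
    calc _ = ∑ k, (p ^ 2 - p * δ * (u i + u j) * u k + δ ^ 2 * (u i * u j) * u k ^ 2) :=
          Finset.sum_congr rfl fun k _ => by ring
      _ = _ := by
          rw [Finset.sum_add_distrib, Finset.sum_sub_distrib, ← Finset.mul_sum, ← Finset.mul_sum,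
            hu, ← hS]
          simp; ring
  rw [h2]
  simp only [Matrix.trace, Matrix.diag_apply, Matrix.mul_apply, hQ, of_apply]
  have h3 : ∀ i, ∑ k, (p ^ 2 * n + δ ^ 2 * S * (u i * u k)) * (p - δ * (u k * u i)) =
      p ^ 3 * n ^ 2 - δ ^ 3 * S ^ 2 * u i ^ 2 := fun i => by
    calc _ = ∑ k, (p ^ 3 * n + (p * δ ^ 2 * S - p ^ 2 * n * δ) * u i * u k -
          δ ^ 3 * S * u i ^ 2 * u k ^ 2) := Finset.sum_congr rfl fun k _ => by ring
      _ = _ := by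
          rw [Finset.sum_sub_distrib, Finset.sum_add_distrib, ← Finset.mul_sum Finset.univ u,
            ← Finset.mul_sum Finset.univ (fun k => u k ^ 2), hu, ← hS]
          simp; ring
  rw [Finset.sum_congr rfl fun i _ => h3 i, Finset.sum_sub_distrib,
    ← Finset.mul_sum Finset.univ (fun k => u k ^ 2), ← hS]
  simp; ring

end Tilting

section LowerBound

variable {n : ℕ}

/-- A centred vector equal to `1` on the first `k` coordinates. -/
def blockVec (n k : ℕ) (i : Fin n) : ℝ := if (i : ℕ) < k then 1 else -((k : ℝ) / (n - k))

lemma sum_block {k : ℕ} (hk : k < n) (a b : ℝ) :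
    ∑ i : Fin n, (if (i : ℕ) < k then a else b) = k * a + (n - k) * b := by
  have h1 : ∑ i : Fin n, (if (i : ℕ) < k then a else b) =
      ∑ i : Fin n, (b + if (i : ℕ) < k then a - b else 0) :=
    Finset.sum_congr rfl fun i _ => by split_ifs <;> ring
  rw [h1, Finset.sum_add_distrib, ← Finset.sum_filter, Finset.sum_const, Finset.sum_const,
    Fin.card_filter_val_lt, min_eq_right hk.le]
  simp
  ring

lemma sum_blockVec {k : ℕ} (hk : k < n) : ∑ i, blockVec n k i = 0 := by
  have : (0 : ℝ) < n - k := sub_pos.2 (by exact_mod_cast hk)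
  unfold blockVec
  rw [sum_block hk]
  field_simp
  ring

lemma sum_blockVec_sq {k : ℕ} (hk : k < n) :
    ∑ i, blockVec n k i ^ 2 = k * (1 + (k : ℝ) / (n - k)) := by
  have : (0 : ℝ) < n - k := sub_pos.2 (by exact_mod_cast hk)
  have h1 : ∀ i : Fin n, blockVec n k i ^ 2 =
      if (i : ℕ) < k then 1 else ((k : ℝ) / (n - k)) ^ 2 := fun i => by
    unfold blockVec; split_ifs <;> ring
  rw [Finset.sum_congr rfl fun i _ => h1 i, sum_block hk]
  field_simp

lemma blockVec_mul_mem {k : ℕ} (hk : 2 * k < n) (i j : Fin n) :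
    -((k : ℝ) / (n - k)) ≤ blockVec n k i * blockVec n k j ∧
      blockVec n k i * blockVec n k j ≤ 1 := by
  have hk' : 2 * (k : ℝ) < n := by exact_mod_cast hk
  have hk0 : (0 : ℝ) ≤ k := k.cast_nonneg
  have h0 : 0 ≤ (k : ℝ) / (n - k) := div_nonneg hk0 (by linarith)
  have h1 : (k : ℝ) / (n - k) ≤ 1 := by
    rw [div_le_one (by linarith)]; linarith
  set r := (k : ℝ) / (n - k)
  have hr : ∀ i, blockVec n k i = if (i : ℕ) < k then 1 else -r := fun i => rfl
  rw [hr, hr]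
  split_ifs <;> constructor <;> nlinarith

lemma sum_bernKL_blockVec_le {p δ K : ℝ} {k : ℕ} (hp : 0 < p) (hp1 : p < 1) (hδ0 : 0 ≤ δ)
    (hδp : δ < p) (hk : 2 * k < n) (hδr : δ * ((k : ℝ) / (n - k)) < 1 - p)
    (hK : bernKL (p - δ) p ≤ K) (hK0 : 0 ≤ K) :
    ∑ e : EdgeIdx n, bernKL (p - δ * (blockVec n k e.1.1 * blockVec n k e.1.2)) p ≤
      (k ^ 2 * K + δ ^ 2 / (p * (1 - p)) *
        ((k * (1 + (k : ℝ) / (n - k))) ^ 2 - (k : ℝ) ^ 2)) / 2 := by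
  have h1p : 0 < 1 - p := by linarith
  set u := blockVec n k
  set χ : Fin n → ℝ := fun i => if (i : ℕ) < k then 1 else 0
  have hχ : ∑ i, χ i = k := by
    simp only [χ, sum_block (show k < n by omega)]
    ring
  set H : Fin n → Fin n → ℝ := fun i j => K * (χ i * χ j) +
    δ ^ 2 / (p * (1 - p)) * (u i ^ 2 * u j ^ 2 - χ i * χ j) with hH
  have hu : ∀ i, χ i = 1 ∧ u i = 1 ∨ χ i = 0 := fun i => by
    by_cases h : (i : ℕ) < k
    · left; simp [χ, u, blockVec, h]
    · right; simp [χ, h]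
  have hH0 : ∀ i j, 0 ≤ H i j := fun i j => by
    have h1 : 0 ≤ χ i := by rcases hu i with h | h <;> linarith [h]
    have h2 : 0 ≤ χ j := by rcases hu j with h | h <;> linarith [h]
    have h3 : 0 ≤ u i ^ 2 * u j ^ 2 - χ i * χ j := by
      rcases hu i with ⟨a, b⟩ | a
      · rcases hu j with ⟨c, d⟩ | c
        · rw [a, b, c, d]; norm_num
        · rw [c, mul_zero, sub_zero]; positivity
      · rw [a, zero_mul, sub_zero]; positivity
    simp only [hH]
    positivity
  have hKL : ∀ i j, bernKL (p - δ * (u i * u j)) p ≤ H i j := fun i j => by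
    have hm := blockVec_mul_mem hk i j
    have gen : bernKL (p - δ * (u i * u j)) p ≤ δ ^ 2 / (p * (1 - p)) * (u i ^ 2 * u j ^ 2) := by
      refine (bernKL_le ?_ ?_ hp hp1).trans (le_of_eq ?_)
      · have := mul_le_mul_of_nonneg_left hm.2 hδ0
        linarith
      · have := mul_le_mul_of_nonneg_left hm.1 hδ0
        linarith
      · field_simp; ring
    rcases hu i with ⟨a, b⟩ | a
    · rcases hu j with ⟨c, d⟩ | c
      · simp only [hH, a, b, c, d]
        simpa using hK
      · simpa [hH, c] using gen
    · simpa [hH, a] using gen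
  have h2 := sum_edges_le_half (H := H) (fun i j => by simp only [hH]; ring) hH0
  have h3 : ∑ i, ∑ j, H i j = k ^ 2 * K + δ ^ 2 / (p * (1 - p)) *
        ((k * (1 + (k : ℝ) / (n - k))) ^ 2 - (k : ℝ) ^ 2) := by
    simp only [hH, Finset.sum_add_distrib, ← Finset.mul_sum, Finset.sum_sub_distrib, hχ,
      ← Finset.sum_mul]
    rw [show ∑ i, u i ^ 2 = k * (1 + (k : ℝ) / (n - k)) from sum_blockVec_sq (by omega)]
    ring
  have h4 : ∑ e : EdgeIdx n, bernKL (p - δ * (u e.1.1 * u e.1.2)) p ≤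
      ∑ e : EdgeIdx n, H e.1.1 e.1.2 := Finset.sum_le_sum fun e _ => hKL _ _
  linarith

lemma bernProb_trace_cube_le_ge {q : EdgeIdx n → ℝ} (hq : IsBern q) {E x T : ℝ}
    (hE : (smat q * smat q * smat q).trace ≤ E) (hx : 0 < x) (hT : E + x ≤ T) :
    x / T ≤ bernProb q (fun g => (adjOf g * adjOf g * adjOf g).trace ≤ E + x) := by
  have hnn : ∀ g : EdgeIdx n → Bool, 0 ≤ (adjOf g * adjOf g * adjOf g).trace := fun g => by
    rw [trace_cube_eq_sum]
    refine Finset.sum_nonneg fun i _ => Finset.sum_nonneg fun j _ => Finset.sum_nonneg fun k _ => ?_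
    exact mul_nonneg (mul_nonneg (adjOf_nonneg _ _ _) (adjOf_nonneg _ _ _)) (adjOf_nonneg _ _ _)
  have hmean : bernExp q (fun g => (adjOf g * adjOf g * adjOf g).trace) ≤ E := by
    have := bernExp_trace_cube q (fun _ => boolVal)
    simp only [boolVal, if_true, mul_one, Bool.false_eq_true, if_false, mul_zero, add_zero] at this
    exact (le_of_eq this).trans hE
  have hE0 : 0 ≤ E := (bernExp_nonneg hq hnn).trans hmean
  have h1 := (mul_bernProb_le_bernExp hq hnn (E + x)).trans hmean
  have h2 : 1 - bernProb q (fun g => E + x ≤ (adjOf g * adjOf g * adjOf g).trace) ≤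
      bernProb q (fun g => (adjOf g * adjOf g * adjOf g).trace ≤ E + x) := by
    rw [← bernProb_not]
    exact bernProb_mono hq fun g hg => (not_le.1 hg).le
  set P := bernProb q (fun g => E + x ≤ (adjOf g * adjOf g * adjOf g).trace)
  refine le_trans ?_ h2
  have hEx : 0 < E + x := by linarith
  calc x / T ≤ x / (E + x) := div_le_div_of_nonneg_left hx.le hEx hT
    _ ≤ 1 - P := by
      rw [div_le_iff₀ hEx]
      linarith

end LowerBound

section LowerBoundMain

variable {n : ℕ}

lemma sum_tilted_edges {p δ : ℝ} {u : Fin n → ℝ} (hu : ∑ i, u i = 0) :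
    ∑ e : EdgeIdx n, (p - δ * (u e.1.1 * u e.1.2)) =
      p * Fintype.card (EdgeIdx n) + δ * (∑ i, u i ^ 2) / 2 := by
  have h := sum_sum_eq_edges (H := fun i j => u i * u j) (fun i j => by ring)
  have h0 : ∑ i, ∑ j, u i * u j = 0 := by
    simp only [← Finset.mul_sum, hu, mul_zero, Finset.sum_const_zero]
  rw [h0] at h
  have h2 : ∑ i, u i * u i = ∑ i, u i ^ 2 := Finset.sum_congr rfl fun i _ => by ring
  rw [Finset.sum_sub_distrib, ← Finset.mul_sum]
  simp only [Finset.sum_const, Finset.card_univ, nsmul_eq_mul]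
  rw [h2] at h
  linear_combination (δ / 2) * h

/-- The tilted measure charges the graphs with about `m` edges, few triangles and a controlled
likelihood ratio. -/
lemma le_bernProb_good {p c b E x w : ℝ} {q : EdgeIdx n → ℝ} {m Y : ℕ} (hq : IsBern q)
    (hc : 1 ≤ c) (hL : ∀ e b, |bernLogRatio (q e) p b| ≤ c)
    (hE : (smat q * smat q * smat q).trace ≤ E) (hx : w ^ 9 ≤ x) (hT : E + x ≤ (n : ℝ) ^ 3)
    (hw : 1 ≤ w) (hwn : w ^ 4 = n) (hexp : 3 * Real.exp (-(w ^ 2 / (16 * c ^ 2))) ≤ 1 / (2 * w ^ 3))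
    (hmean : |∑ e, q e - m| + w ^ 5 ≤ Y) (hb : ∑ e, bernKL (q e) p + w ^ 5 ≤ b) :
    1 / (2 * w ^ 3) ≤ bernProb q (fun g => (|(edgeCount g : ℝ) - m| ≤ Y ∧
      (adjOf g * adjOf g * adjOf g).trace ≤ E + x) ∧
      ∑ e, bernLogRatio (q e) p (g e) ≤ b) := by
  have hw0 : 0 < w := by linarith
  have hN : (Fintype.card (EdgeIdx n) : ℝ) ≤ w ^ 8 := by
    have := card_edgeIdx n
    have h2 : (n : ℝ) ^ 2 = w ^ 8 := by rw [← hwn]; ring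
    have h3 : (0 : ℝ) ≤ n := n.cast_nonneg
    have h4 : (0 : ℝ) ≤ w ^ 8 := by positivity
    linarith
  have h1 : 1 / w ^ 3 ≤ bernProb q (fun g => (adjOf g * adjOf g * adjOf g).trace ≤ E + x) := by
    refine le_trans ?_ (bernProb_trace_cube_le_ge hq hE (lt_of_lt_of_le (by positivity) hx) hT)
    rw [← hwn, div_le_div_iff₀ (by positivity) (by positivity)]
    calc 1 * (w ^ 4) ^ 3 = w ^ 9 * w ^ 3 := by ring
      _ ≤ x * w ^ 3 := by gcongr
  have h2 := bernProb_abs_edgeCount_sub_ge_le hq (y := w ^ 5) (by positivity) hN (by positivity)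
  have h3 := bernProb_sum_bernLogRatio_ge_le (p := p) (y := w ^ 5) hq (by linarith : 0 < c) hL
    (by positivity) hN (by positivity)
  have e2 : Real.exp (-((w ^ 5) ^ 2 / (4 * w ^ 8))) ≤ Real.exp (-(w ^ 2 / (16 * c ^ 2))) := by
    rw [Real.exp_le_exp, neg_le_neg_iff]
    have : (w ^ 5) ^ 2 / (4 * w ^ 8) = w ^ 2 / 4 := by field_simp
    rw [this]
    gcongr
    nlinarith
  have e3 : (w ^ 5) ^ 2 / (4 * w ^ 8 * (2 * c) ^ 2) = w ^ 2 / (16 * c ^ 2) := by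
    field_simp; ring
  rw [e3] at h3
  have h4 : bernProb q (fun g => (adjOf g * adjOf g * adjOf g).trace ≤ E + x) ≤
      bernProb q (fun g => (|(edgeCount g : ℝ) - m| ≤ Y ∧
        (adjOf g * adjOf g * adjOf g).trace ≤ E + x) ∧
        ∑ e, bernLogRatio (q e) p (g e) ≤ b) +
      (bernProb q (fun g => w ^ 5 ≤ |(edgeCount g : ℝ) - ∑ e, q e|) +
      bernProb q (fun g => ∑ e, bernKL (q e) p + w ^ 5 ≤
        ∑ e, bernLogRatio (q e) p (g e))) := by
    refine (bernProb_mono hq fun g hg => ?_).trans ((bernProb_or_le hq _ _).trans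
      (add_le_add_right (bernProb_or_le hq _ _) _))
    by_contra! hne
    obtain ⟨a1, a2, a3⟩ := hne
    have h5 := abs_sub_le (edgeCount g : ℝ) (∑ e, q e) m
    have h6 := a1 ⟨by linarith, hg⟩
    linarith
  have h5 : 1 / w ^ 3 = 1 / (2 * w ^ 3) + 1 / (2 * w ^ 3) := by field_simp; norm_num
  linarith

lemma two_mul_pow_mul_pow_le_exp {w : ℝ} {Y : ℕ} (hw : 1 ≤ w) (hY : (Y : ℝ) ≤ 4 * w ^ 5) :
    2 * w ^ 3 * (w ^ 8 * (w ^ 9) ^ Y) ≤ Real.exp (48 * w ^ 6) := by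
  have hwe : w ≤ Real.exp w := by linarith [Real.add_one_le_exp w]
  have h2 : 2 ≤ Real.exp w := by linarith [Real.add_one_le_exp w]
  have h6 : w ≤ w ^ 6 := le_self_pow₀ hw (by norm_num)
  calc 2 * w ^ 3 * (w ^ 8 * (w ^ 9) ^ Y)
      ≤ Real.exp w * Real.exp w ^ 3 * (Real.exp w ^ 8 * (Real.exp w ^ 9) ^ Y) := by gcongr
    _ = Real.exp (12 * w + 9 * (w * Y)) := by
        simp only [← Real.exp_nat_mul, ← Real.exp_add]
        congr 1
        push_cast
        ring
    _ ≤ _ := by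
        rw [Real.exp_le_exp]
        have : w * Y ≤ w * (4 * w ^ 5) := by gcongr
        nlinarith

lemma tilt_entropy_le {p v δ η C ρ k r : ℝ} (hp : 0 < p) (hp1 : p < 1) (hv : 0 < v) (hδ : 0 < δ)
    (hη0 : 0 < η) (hη1 : η ≤ 1) (hk0 : 0 ≤ k) (hr0 : 0 ≤ r) (hr1 : r ≤ 1)
    (hk : δ * k ≤ (1 + 2 * η) * ρ) (hr : δ * C * r ≤ 6)
    (hC : 36 * v ≤ η * (p * (1 - p)) * (δ * C)) :
    (k ^ 2 * ((1 + η) * (δ ^ 2 / (2 * v))) +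
      δ ^ 2 / (p * (1 - p)) * ((k * (1 + r)) ^ 2 - k ^ 2)) / 2 ≤
      (1 + 26 * η) * (ρ ^ 2 / (4 * v)) := by
  have h1p : 0 < 1 - p := by linarith
  have hpp : 0 < p * (1 - p) := by positivity
  have h1 : (k * (1 + r)) ^ 2 - k ^ 2 ≤ k ^ 2 * (3 * r) := by
    have := mul_nonneg (sq_nonneg k) (mul_nonneg hr0 (sub_nonneg.2 hr1))
    linarith
  have h2 : δ ^ 2 / (p * (1 - p)) * (3 * r) ≤ η * (δ ^ 2 / (2 * v)) := by
    have h3 : 6 * v * r ≤ η * (p * (1 - p)) := by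
      have h4 := mul_le_mul_of_nonneg_right hC hr0
      have h5 := mul_le_mul_of_nonneg_left hr (show 0 ≤ η * (p * (1 - p)) by positivity)
      linarith
    rw [div_mul_eq_mul_div, ← mul_div_assoc, div_le_div_iff₀ hpp (by positivity)]
    have := mul_le_mul_of_nonneg_left h3 (sq_nonneg δ)
    linarith
  have h4 : k ^ 2 * δ ^ 2 ≤ (1 + 2 * η) ^ 2 * ρ ^ 2 := by
    have := pow_le_pow_left₀ (by positivity) hk 2
    linarith
  have h5 : δ ^ 2 / (p * (1 - p)) * ((k * (1 + r)) ^ 2 - k ^ 2) ≤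
      k ^ 2 * (η * (δ ^ 2 / (2 * v))) := by
    calc _ ≤ δ ^ 2 / (p * (1 - p)) * (k ^ 2 * (3 * r)) := by gcongr
      _ = k ^ 2 * (δ ^ 2 / (p * (1 - p)) * (3 * r)) := by ring
      _ ≤ _ := by gcongr
  have h6 : (1 + 2 * η) ^ 3 ≤ 1 + 26 * η := by
    have h7 : η ^ 2 ≤ η := by nlinarith
    have h8 : η ^ 3 ≤ η := by nlinarith
    linarith
  calc _ ≤ (k ^ 2 * ((1 + η) * (δ ^ 2 / (2 * v))) + k ^ 2 * (η * (δ ^ 2 / (2 * v)))) / 2 := by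
        gcongr
    _ = (1 + 2 * η) * (k ^ 2 * δ ^ 2) / (4 * v) := by field_simp; ring
    _ ≤ (1 + 2 * η) * ((1 + 2 * η) ^ 2 * ρ ^ 2) / (4 * v) := by gcongr
    _ = (1 + 2 * η) ^ 3 * (ρ ^ 2 / (4 * v)) := by ring
    _ ≤ _ := by gcongr

lemma exp_le_of_le_exp_mul {w v η C ρ P : ℝ} {Y : ℕ} (hw : 1 ≤ w) (hv : 0 < v) (hη : 0 ≤ η)
    (hC1 : 1 ≤ C) (hC : 196 * v ≤ η * C) (hρ : C ^ 2 * w ^ 6 ≤ ρ ^ 2) (hY : (Y : ℝ) ≤ 4 * w ^ 5)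
    (hP : 0 ≤ P)
    (h : 1 / (2 * w ^ 3) ≤ Real.exp ((1 + 26 * η) * (ρ ^ 2 / (4 * v)) + w ^ 5) *
      (w ^ 8 * ((w ^ 9) ^ Y * P))) :
    Real.exp (-((1 + 27 * η) * (ρ ^ 2 / (4 * v)))) ≤ P := by
  have hw0 : 0 < w := by linarith
  set D := (1 + 26 * η) * (ρ ^ 2 / (4 * v)) with hD
  have key2 : 1 ≤ Real.exp (D + 49 * w ^ 6) * P := by
    rw [div_le_iff₀ (by positivity)] at h
    calc 1 ≤ Real.exp (D + w ^ 5) * (w ^ 8 * ((w ^ 9) ^ Y * P)) * (2 * w ^ 3) := h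
      _ = Real.exp (D + w ^ 5) * (2 * w ^ 3 * (w ^ 8 * (w ^ 9) ^ Y)) * P := by ring
      _ ≤ Real.exp (D + w ^ 5) * Real.exp (48 * w ^ 6) * P := by
          gcongr
          exact two_mul_pow_mul_pow_le_exp hw hY
      _ ≤ _ := by
          rw [← Real.exp_add]
          refine mul_le_mul_of_nonneg_right (Real.exp_le_exp.2 ?_) hP
          linarith [pow_le_pow_right₀ hw (show 5 ≤ 6 by norm_num)]
  have key3 : D + 49 * w ^ 6 ≤ (1 + 27 * η) * (ρ ^ 2 / (4 * v)) := by
    have h1 : 49 * w ^ 6 ≤ η * (ρ ^ 2 / (4 * v)) := by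
      rw [← mul_div_assoc, le_div_iff₀ (by positivity)]
      have : C ≤ C ^ 2 := le_self_pow₀ hC1 (by norm_num)
      calc 49 * w ^ 6 * (4 * v) = 196 * v * w ^ 6 := by ring
        _ ≤ η * C * w ^ 6 := by gcongr
        _ ≤ η * C ^ 2 * w ^ 6 := by gcongr
        _ ≤ η * ρ ^ 2 := by rw [mul_assoc]; gcongr
    rw [hD]
    linarith
  rw [Real.exp_neg, inv_le_iff_one_le_mul₀ (Real.exp_pos _), mul_comm]
  exact key2.trans (mul_le_mul_of_nonneg_right (Real.exp_le_exp.2 key3) hP)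

lemma triangle_budget_le {P E x y w N ρ : ℝ} (hw : 1 ≤ w) (hwn : w ^ 4 = N) (hP1 : P ≤ 1)
    (hρ : 0 ≤ ρ) (hx : 27 * w ^ 9 ≤ x) (hE : E + 2 * x ≤ P * N ^ 3 - ρ ^ 3)
    (hy : y ≤ 4 * w ^ 5) :
    E + x + 6 * N * y ≤ (P - ρ ^ 3 / N ^ 3) * (N * (N - 1) * (N - 2)) := by
  have hw0 : 0 < w := by linarith
  have hN1 : 1 ≤ N := by rw [← hwn]; exact one_le_pow₀ hw
  have hN2 : N ≤ N ^ 2 := le_self_pow₀ hN1 (by norm_num)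
  have h1 : 6 * N * y ≤ 24 * w ^ 9 := by
    rw [← hwn]
    calc 6 * w ^ 4 * y ≤ 6 * w ^ 4 * (4 * w ^ 5) := by gcongr
      _ = _ := by ring
  have h2 : P * (3 * N ^ 2 - 2 * N) ≤ 3 * w ^ 9 := by
    have h3 : P * (3 * N ^ 2 - 2 * N) ≤ 1 * (3 * N ^ 2 - 2 * N) :=
      mul_le_mul_of_nonneg_right hP1 (by linarith)
    have h4 : N ^ 2 = w ^ 8 := by rw [← hwn]; ring
    have h5 : w ^ 8 ≤ w ^ 9 := pow_le_pow_right₀ hw (by norm_num)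
    linarith
  have h3 : ρ ^ 3 / N ^ 3 * (N * (N - 1) * (N - 2)) ≤ ρ ^ 3 := by
    calc _ ≤ ρ ^ 3 / N ^ 3 * N ^ 3 := by
          refine mul_le_mul_of_nonneg_left ?_ (by positivity)
          linarith [show N * (N - 1) * (N - 2) = N ^ 3 - 3 * N ^ 2 + 2 * N by ring]
      _ = _ := div_mul_cancel₀ _ (by positivity)
  have h4 : P * (N * (N - 1) * (N - 2)) = P * N ^ 3 - P * (3 * N ^ 2 - 2 * N) := by ring
  have h5 : 0 ≤ w ^ 9 := by positivity
  rw [sub_mul]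
  linarith

set_option maxHeartbeats 4000000 in
/-- Lower bound for the probability that `G(n, m)` has few triangles. -/
lemma exp_le_bernProb_fewTriangles {p v δ η c C C₀ ρ w : ℝ} {m : ℕ} (hp : 1 / 2 ≤ p) (hp1 : p < 1)
    (hv : 0 < v) (hδ0 : 0 < δ) (hδp : δ < p) (hη0 : 0 < η) (hη1 : η ≤ 1)
    (hKL : bernKL (p - δ) p ≤ (1 + η) * (δ ^ 2 / (2 * v))) (hc : 1 ≤ c)
    (hL : ∀ q, p - δ ≤ q → q ≤ (1 + p) / 2 → ∀ b, |bernLogRatio q p b| ≤ c)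
    (hC1 : 1 ≤ C) (hC2 : 27 ≤ η * C) (hC3 : 196 * v ≤ η * C) (hC4 : 7 ≤ δ * C)
    (hC5 : 12 ≤ C * (1 - p)) (hC6 : 36 * v ≤ η * (p * (1 - p)) * (δ * C))
    (hw : 1 ≤ w) (hwn : w ^ 4 = n) (hρ : C * w ^ 3 ≤ ρ) (hρn : C * ρ ≤ n) (hwp : p / (1 - p) ≤ w)
    (hwC : C₀ ≤ w) (hexp : 3 * Real.exp (-(w ^ 2 / (16 * c ^ 2))) ≤ 1 / (2 * w ^ 3))
    (hmN : m ≤ Fintype.card (EdgeIdx n)) (hm : |m - p * Fintype.card (EdgeIdx n)| ≤ C₀) :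
    Real.exp (-((1 + 27 * η) * (ρ ^ 2 / (4 * v)))) ≤ bernProb (fun _ : EdgeIdx n => p)
      (fewTriangles m ((p ^ 3 - ρ ^ 3 / (n : ℝ) ^ 3) * ((n : ℝ) * ((n : ℝ) - 1) * ((n : ℝ) - 2))))
      := by
  have h1p : 0 < 1 - p := by linarith
  have hp0 : 0 < p := by linarith
  have hw0 : 0 < w := by linarith
  have hwk : ∀ j k : ℕ, j ≤ k → w ^ j ≤ w ^ k := fun j k h => pow_le_pow_right₀ hw h
  have hw3 : 1 ≤ w ^ 3 := one_le_pow₀ hw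
  have hρC : C ≤ ρ := by nlinarith
  have hρ0 : 0 < ρ := by linarith
  have hn0 : (0 : ℝ) < n := by rw [← hwn]; positivity
  have hn1 : (1 : ℝ) ≤ n := by rw [← hwn]; exact one_le_pow₀ hw
  -- the size of the planted block
  obtain ⟨k, hk1, hk2⟩ : ∃ k : ℕ, (1 + η) * ρ ≤ δ * k ∧ δ * k ≤ (1 + 2 * η) * ρ := by
    refine ⟨⌈(1 + η) * ρ / δ⌉₊, ?_, ?_⟩
    · have := Nat.le_ceil ((1 + η) * ρ / δ)
      rw [div_le_iff₀ hδ0] at this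
      linarith
    · have h := (Nat.ceil_lt_add_one (show 0 ≤ (1 + η) * ρ / δ by positivity)).le
      have h2 : δ * ⌈(1 + η) * ρ / δ⌉₊ ≤ (1 + η) * ρ + δ := by
        calc _ ≤ δ * ((1 + η) * ρ / δ + 1) := by gcongr
          _ = _ := by field_simp
      have : η * C ≤ η * ρ := by gcongr
      linarith
  have hk3 : C * (δ * k) ≤ 3 * n := by
    have h1 : δ * k ≤ 3 * ρ := by
      have := mul_le_mul_of_nonneg_right hη1 hρ0.le
      linarith
    have h2 : C * (δ * k) ≤ C * (3 * ρ) := mul_le_mul_of_nonneg_left h1 (by linarith)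
    linarith
  have hk0 : (0 : ℝ) ≤ k := k.cast_nonneg
  have hkn' : 2 * (k : ℝ) < n := by
    have : 7 * (k : ℝ) ≤ δ * C * k := by gcongr
    linarith
  have hkn : 2 * k < n := by exact_mod_cast hkn'
  have hnk : (0 : ℝ) < n - k := by linarith
  set r := (k : ℝ) / (n - k) with hr
  have hr0 : 0 ≤ r := by positivity
  have hr1 : r ≤ 1 := by rw [hr, div_le_one hnk]; linarith
  have hrC : δ * C * r ≤ 6 := by
    rw [hr, ← mul_div_assoc, div_le_iff₀ hnk]
    linarith
  have hδr : δ * r ≤ (1 - p) / 2 := by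
    have : (δ * r) * 12 ≤ (δ * r) * (C * (1 - p)) := by gcongr
    nlinarith
  -- the tilted measure
  set u := blockVec n k with hu
  have hu0 : ∑ i, u i = 0 := sum_blockVec (by omega)
  have hS : ∑ i, u i ^ 2 = k * (1 + r) := sum_blockVec_sq (by omega)
  have humem : ∀ i j, p - δ ≤ p - δ * (u i * u j) ∧ p - δ * (u i * u j) ≤ (1 + p) / 2 :=
    fun i j => by
      have h := blockVec_mul_mem hkn i j
      have h1 := mul_le_mul_of_nonneg_left h.1 hδ0.le
      have h2 := mul_le_mul_of_nonneg_left h.2 hδ0.le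
      constructor <;> linarith
  set q : EdgeIdx n → ℝ := fun e => p - δ * (u e.1.1 * u e.1.2) with hqdef
  have hq01 : ∀ e, 0 < q e ∧ q e < 1 := fun e => by
    have := humem e.1.1 e.1.2
    constructor <;> linarith
  have hq : IsBern q := fun e => ⟨(hq01 e).1.le, (hq01 e).2.le⟩
  set E := p ^ 3 * (n : ℝ) ^ 3 - δ ^ 3 * (k * (1 + r)) ^ 3 with hEdef
  have hE : (smat q * smat q * smat q).trace ≤ E := by
    rw [hEdef, ← hS]
    exact trace_cube_smat_rankOne_le hu0 fun i j => by linarith [(humem i j).1]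
  set x := η * ρ ^ 3 with hxdef
  have hρ3 : C ^ 3 * w ^ 9 ≤ ρ ^ 3 := by
    calc C ^ 3 * w ^ 9 = (C * w ^ 3) ^ 3 := by ring
      _ ≤ _ := by gcongr
  have hρ2 : C ^ 2 * w ^ 6 ≤ ρ ^ 2 := by
    calc C ^ 2 * w ^ 6 = (C * w ^ 3) ^ 2 := by ring
      _ ≤ _ := by gcongr
  have hx27 : 27 * w ^ 9 ≤ x := by
    have : C ≤ C ^ 3 := le_self_pow₀ hC1 (by norm_num)
    calc 27 * w ^ 9 ≤ η * C * w ^ 9 := by gcongr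
      _ ≤ η * C ^ 3 * w ^ 9 := by gcongr
      _ ≤ x := by rw [hxdef, mul_assoc]; gcongr
  have hδk : (1 + 3 * η) * ρ ^ 3 ≤ δ ^ 3 * (k * (1 + r)) ^ 3 := by
    calc (1 + 3 * η) * ρ ^ 3 ≤ (1 + η) ^ 3 * ρ ^ 3 := by
          gcongr
          nlinarith [pow_pos hη0 3, pow_pos hη0 2]
      _ = ((1 + η) * ρ) ^ 3 := by ring
      _ ≤ (δ * (k * (1 + r))) ^ 3 := by
          refine pow_le_pow_left₀ (by positivity) (hk1.trans ?_) 3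
          linarith [mul_nonneg hδ0.le (mul_nonneg hk0 hr0)]
      _ = _ := by ring
  have hp3 : p ^ 3 ≤ 1 := pow_le_one₀ hp0.le hp1.le
  have hT : E + x ≤ (n : ℝ) ^ 3 := by
    have h1 : p ^ 3 * (n : ℝ) ^ 3 ≤ 1 * (n : ℝ) ^ 3 := by gcongr
    have h2 : 0 ≤ η * ρ ^ 3 := by positivity
    have h3 : 0 ≤ ρ ^ 3 := by positivity
    linarith
  set Y := ⌈3 * w ^ 5⌉₊ with hY
  have hY1 : 3 * w ^ 5 ≤ Y := Nat.le_ceil _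
  have hY2 : (Y : ℝ) ≤ 4 * w ^ 5 := by
    have h1 := (Nat.ceil_lt_add_one (show 0 ≤ 3 * w ^ 5 by positivity)).le
    have h2 : 1 ≤ w ^ 5 := one_le_pow₀ hw
    linarith
  have hmean : |∑ e, q e - m| + w ^ 5 ≤ Y := by
    have h1 : ∑ e, q e = p * Fintype.card (EdgeIdx n) + δ * (k * (1 + r)) / 2 := by
      rw [← hS]; exact sum_tilted_edges hu0
    have h2 : δ * (k * (1 + r)) / 2 ≤ w ^ 5 := by
      have : w ^ 4 ≤ w ^ 5 := hwk 4 5 (by norm_num)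
      have h4 : k * (1 + r) ≤ k * 2 := by gcongr; linarith
      have h5 : δ * (k * (1 + r)) ≤ 1 * (k * (1 + r)) := by
        gcongr
        linarith
      linarith
    have h3 : w ≤ w ^ 5 := le_self_pow₀ hw (by norm_num)
    have h4 : 0 ≤ δ * (k * (1 + r)) / 2 := by positivity
    have h5 := abs_le.1 hm
    have h6 : |∑ e, q e - m| ≤ 2 * w ^ 5 := by
      rw [h1, abs_le]
      constructor <;> linarith [h5.1, h5.2]
    linarith
  set D := (1 + 26 * η) * (ρ ^ 2 / (4 * v)) with hD
  have hDle : ∑ e, bernKL (q e) p ≤ D :=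
    (sum_bernKL_blockVec_le hp0 hp1 hδ0.le hδp hkn (by linarith) hKL (by positivity)).trans
      (tilt_entropy_le hp0 hp1 hv hδ0 hη0 hη1 hk0 hr0 hr1 hk2 hrC hC6)
  have hgood := le_bernProb_good (p := p) (m := m) (Y := Y) (b := D + w ^ 5) hq hc
    (fun e b => hL _ (humem e.1.1 e.1.2).1 (humem e.1.1 e.1.2).2 b) hE
    (by linarith [show 0 ≤ w ^ 9 by positivity]) hT hw hwn hexp hmean (by linarith)
  have htilt := bernProb_tilt_le (p := fun _ => p) hq01 (fun _ => ⟨hp0, hp1⟩)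
    (fun g => |(edgeCount g : ℝ) - m| ≤ Y ∧ (adjOf g * adjOf g * adjOf g).trace ≤ E + x)
    (D + w ^ 5)
  have hcard : (Fintype.card (EdgeIdx n) : ℝ) + 1 ≤ w ^ 8 := by
    have h := card_edgeIdx n
    have h2 : (n : ℝ) ^ 2 = w ^ 8 := by rw [← hwn]; ring
    have h3 : (0 : ℝ) ≤ Fintype.card (EdgeIdx n) := Nat.cast_nonneg _
    linarith [show (1 : ℝ) ≤ (n : ℝ) ^ 2 from one_le_pow₀ hn1]
  have hM : Fintype.card (EdgeIdx n) * (p / (1 - p)) ≤ w ^ 9 := by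
    calc _ ≤ w ^ 8 * w := by gcongr; linarith
      _ = _ := by ring
  have hwin := bernProb_fewTriangles_window_le hp hp1 (one_le_pow₀ hw) hM (Y := Y) hmN (E + x)
  have hτ : E + x + 6 * n * Y ≤
      (p ^ 3 - ρ ^ 3 / (n : ℝ) ^ 3) * ((n : ℝ) * ((n : ℝ) - 1) * ((n : ℝ) - 2)) :=
    triangle_budget_le hw hwn hp3 hρ0.le hx27 (by linarith [show 0 ≤ x by positivity]) hY2
  set P := bernProb (fun _ : EdgeIdx n => p) (fewTriangles m
    ((p ^ 3 - ρ ^ 3 / (n : ℝ) ^ 3) * ((n : ℝ) * ((n : ℝ) - 1) * ((n : ℝ) - 2)))) with hP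
  have hB : IsBern (fun _ : EdgeIdx n => p) := fun _ => ⟨hp0.le, hp1.le⟩
  have hP0 : 0 ≤ P := bernProb_nonneg hB _
  have hPle : bernProb (fun _ : EdgeIdx n => p) (fewTriangles m (E + x + 6 * n * Y)) ≤ P :=
    bernProb_mono hB fun g hg => fewTriangles_mono hτ hg
  have key : 1 / (2 * w ^ 3) ≤ Real.exp (D + w ^ 5) * (w ^ 8 * ((w ^ 9) ^ Y * P)) := by
    refine hgood.trans (htilt.trans ?_)
    refine mul_le_mul_of_nonneg_left (hwin.trans ?_) (Real.exp_pos _).le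
    refine mul_le_mul (by linarith) (mul_le_mul_of_nonneg_left hPle (by positivity)) ?_
      (by positivity)
    exact mul_nonneg (by positivity) (bernProb_nonneg hB _)
  exact exp_le_of_le_exp_mul hw hv hη0.le hC1 hC3 hρ2 hY2 hP0 key

end LowerBoundMain

section Conditioning

variable {n : ℕ}

lemma bernWeight_const (p : ℝ) (g : EdgeIdx n → Bool) :
    bernWeight (fun _ => p) g =
      p ^ edgeCount g * (1 - p) ^ (Fintype.card (EdgeIdx n) - edgeCount g) := by
  have h := Finset.card_filter_add_card_filter_not (s := (Finset.univ : Finset (EdgeIdx n)))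
    (fun e => g e = true)
  rw [Finset.card_univ] at h
  rw [bernWeight, Finset.prod_ite, Finset.prod_const, Finset.prod_const, edgeCount, ← h,
    Nat.add_sub_cancel_left]

open Classical in
lemma bernProb_edgeCount_eq_and (p : ℝ) (m : ℕ) (S : (EdgeIdx n → Bool) → Prop) :
    bernProb (fun _ : EdgeIdx n => p) (fun g => edgeCount g = m ∧ S g) =
      p ^ m * (1 - p) ^ (Fintype.card (EdgeIdx n) - m) *
        ((Finset.univ.filter fun g : EdgeIdx n → Bool => edgeCount g = m ∧ S g).card : ℝ) := by
  rw [bernProb, bernExp, Finset.card_filter, Nat.cast_sum, Finset.mul_sum]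
  refine Finset.sum_congr rfl fun g _ => ?_
  by_cases h : edgeCount g = m ∧ S g
  · rw [if_pos h, if_pos h, bernWeight_const, h.1, Nat.cast_one]
  · rw [if_neg h, if_neg h, Nat.cast_zero, mul_zero, mul_zero]

lemma condGrProb_eq {p : ℝ} (hp : 0 < p) (hp1 : p < 1) (m : ℕ)
    (pred cond : Matrix (Fin n) (Fin n) ℝ → Prop) :
    condGrProb n m pred cond =
      bernProb (fun _ : EdgeIdx n => p)
        (fun g => edgeCount g = m ∧ cond (adjOf g) ∧ pred (adjOf g)) /
      bernProb (fun _ : EdgeIdx n => p) (fun g => edgeCount g = m ∧ cond (adjOf g)) := by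
  have h1p : 0 < 1 - p := by linarith
  rw [bernProb_edgeCount_eq_and, bernProb_edgeCount_eq_and, mul_div_mul_left _ _ (by positivity),
    condGrProb]
  congr!

lemma condGrProb_le_one (m : ℕ) (pred cond : Matrix (Fin n) (Fin n) ℝ → Prop) :
    condGrProb n m pred cond ≤ 1 := by
  have hq : IsBern (fun _ : EdgeIdx n => (1 / 2 : ℝ)) := fun _ => by norm_num
  rw [condGrProb_eq (p := 1 / 2) (by norm_num) (by norm_num)]
  exact div_le_one_of_le₀ (bernProb_mono hq fun g hg => ⟨hg.1, hg.2.1⟩) (bernProb_nonneg hq _)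

lemma one_sub_div_le_condGrProb {p b a : ℝ} (hp : 0 < p) (hp1 : p < 1) {m : ℕ}
    {pred cond : Matrix (Fin n) (Fin n) ℝ → Prop}
    (hb : bernProb (fun _ : EdgeIdx n => p)
      (fun g => edgeCount g = m ∧ cond (adjOf g) ∧ ¬ pred (adjOf g)) ≤ b) (ha : 0 < a)
    (hcond : a ≤ bernProb (fun _ : EdgeIdx n => p) (fun g => edgeCount g = m ∧ cond (adjOf g))) :
    1 - b / a ≤ condGrProb n m pred cond := by
  have hq : IsBern (fun _ : EdgeIdx n => p) := fun _ => ⟨hp.le, hp1.le⟩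
  rw [condGrProb_eq hp hp1]
  set T := bernProb (fun _ : EdgeIdx n => p) (fun g => edgeCount g = m ∧ cond (adjOf g))
  set G := bernProb (fun _ : EdgeIdx n => p)
    (fun g => edgeCount g = m ∧ cond (adjOf g) ∧ pred (adjOf g))
  have h1 : T ≤ G + b := by
    refine (bernProb_mono hq fun g hg => ?_).trans ((bernProb_or_le hq _ _).trans
      (add_le_add_right hb _))
    by_cases h : pred (adjOf g)
    · exact Or.inl ⟨hg.1, hg.2, h⟩
    · exact Or.inr ⟨hg.1, hg.2, h⟩
  have hT : 0 < T := ha.trans_le hcond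
  have hb0 : 0 ≤ b := (bernProb_nonneg hq _).trans hb
  have h2 : b / T ≤ b / a := by gcongr
  have h3 : 1 - b / T ≤ G / T := by
    rw [le_div_iff₀ hT, sub_mul, div_mul_cancel₀ _ hT.ne']
    linarith
  linarith

lemma eventually_exp_le {c : ℝ} (hc : 0 < c) :
    ∀ᶠ w : ℝ in atTop, 3 * Real.exp (-(w ^ 2 / (16 * c ^ 2))) ≤ 1 / (2 * w ^ 3) := by
  have h := ((Real.tendsto_pow_mul_exp_neg_atTop_nhds_zero 3).comp
    (tendsto_id.const_mul_atTop (show 0 < 1 / (16 * c ^ 2) by positivity))).eventually_le_const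
    (show 0 < (1 / (16 * c ^ 2)) ^ 3 / 6 by positivity)
  filter_upwards [h, eventually_ge_atTop 1] with w hw hw1
  simp only [Function.comp_apply, id] at hw
  rw [mul_pow, mul_assoc, div_eq_mul_inv _ (6 : ℝ),
    mul_le_mul_iff_right₀ (by positivity)] at hw
  have h2 : Real.exp (-(w ^ 2 / (16 * c ^ 2))) ≤ Real.exp (-(1 / (16 * c ^ 2) * w)) := by
    rw [Real.exp_le_exp, neg_le_neg_iff, one_div_mul_eq_div]
    exact div_le_div_of_nonneg_right (le_self_pow₀ hw1 (by norm_num)) (by positivity)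
  rw [le_div_iff₀ (by positivity)]
  have h3 : w ^ 3 * Real.exp (-(w ^ 2 / (16 * c ^ 2))) ≤ 6⁻¹ := le_trans (by gcongr) hw
  linarith

end Conditioning

section Assembly

lemma eventually_le_mul {b : ℝ} (hb : 0 < b) (a : ℝ) : ∀ᶠ C : ℝ in atTop, a ≤ b * C :=
  (tendsto_id.const_mul_atTop hb).eventually_ge_atTop a

/-- Quantitative form of the conditional concentration of the extreme eigenvalues, with
`ρ` the order of magnitude of `|λ_n|` and `w` the fourth root of `n`. -/
lemma exists_one_sub_exp_le_condGrProb {p ε : ℝ} (hp : 1 / 2 ≤ p) (hp1 : p < 1) (hε : 0 < ε)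
    (C₀ : ℝ) : ∃ κ C : ℝ, 0 < κ ∧ 1 ≤ C ∧ ∀ (n m : ℕ) (w ρ t : ℝ), C ≤ w → w ^ 4 = n →
      C * w ^ 3 ≤ ρ → C * ρ ≤ n → ρ ^ 3 = t * (n : ℝ) ^ 3 →
      |(m : ℝ) - p * (n.choose 2 : ℝ)| ≤ C₀ →
      1 - 3 * Real.exp (-(κ * w)) ≤ condGrProb n m
        (fun A =>
          -(1 + ε) * t * (n : ℝ) ^ 3 ≤ eigDesc A (n - 1) ^ 3 ∧
          eigDesc A (n - 1) ^ 3 ≤ -(1 - ε) * t * (n : ℝ) ^ 3 ∧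
          -(ε * t * (n : ℝ) ^ 3) ≤ eigDesc A (n - 2) ^ 3)
        (fun A => triDensity A ≤ p ^ 3 - t) := by
  have hp0 : 0 < p := by linarith
  have h1p : 0 < 1 - p := by linarith
  obtain ⟨v, hv0, hv, hvη⟩ := exists_variance_proxy hp hp1
  -- parameters of the upper bound
  obtain ⟨δ, hδ0, hδ1, hδε⟩ : ∃ δ : ℝ, 0 < δ ∧ 30 * δ ≤ 1 ∧ 30 * δ ≤ ε :=
    ⟨min 1 ε / 30, by positivity, by linarith [min_le_left 1 ε], by linarith [min_le_right 1 ε]⟩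
  obtain ⟨e, he0, he1, he⟩ : ∃ e : ℝ, 0 < e ∧ e ≤ 1 ∧ 16 * e ^ 2 ≤ δ / 4 :=
    ⟨δ / 8, by positivity, by linarith, by nlinarith⟩
  obtain ⟨B, hB⟩ : ∃ B : ℝ, B = 5 * (1 / e ^ 2 + 1) := ⟨_, rfl⟩
  obtain ⟨K, hK, hK1⟩ := ((eventually_le_mul hδ0 (256 * v * B)).and
    (eventually_ge_atTop 1)).exists
  have hKK : 256 * v * B ≤ δ * K ^ 2 :=
    hK.trans (mul_le_mul_of_nonneg_left (le_self_pow₀ hK1 (by norm_num)) hδ0.le)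
  -- parameters of the lower bound
  obtain ⟨η, hη0, hη1, hηδ⟩ : ∃ η : ℝ, 0 < η ∧ η ≤ 1 ∧ 27 * η ≤ δ / 8 :=
    ⟨δ / 216, by positivity, by linarith, by linarith⟩
  obtain ⟨δ', hδ'0, hδ'p, hKL⟩ := hvη η hη0
  obtain ⟨c', hc'⟩ := exists_abs_bernLogRatio_le hδ'p hp0 hp1
  have hpp : 0 < η * (p * (1 - p)) * δ' := by positivity
  set c := 1 + 2 * |C₀| with hc
  obtain ⟨C, ⟨⟨u1, u2, u3, u4, u5, u6⟩, l1, l2, l3, l4, l5⟩, s1, s2, s3, s4, s5⟩ :=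
    ((((eventually_ge_atTop 2).and <| (eventually_le_mul hδ0 2).and <|
      (eventually_le_mul hδ0 (64 * v * (B + 1))).and <|
      (eventually_le_mul hδ0 (24 + 9 * K ^ 2 + 3 * c)).and <|
      (eventually_le_mul (show 0 < δ ^ 2 * v by positivity) (144 * K ^ 4)).and
      (eventually_le_mul hε (K ^ 3))).and <|
      (eventually_le_mul hη0 27).and <| (eventually_le_mul hη0 (196 * v)).and <|
      (eventually_le_mul hδ'0 7).and <| (eventually_le_mul h1p 12).and
      (eventually_le_mul hpp (36 * v))).and <|
      (eventually_ge_atTop (2 * c)).and <| (eventually_ge_atTop (p / (1 - p))).and <|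
      (eventually_ge_atTop |C₀|).and <| (eventually_le_mul h1p (2 * |C₀|)).and
      (eventually_forall_ge_atTop.2 (eventually_exp_le
        (show 0 < max 1 c' by positivity)))).exists
  refine ⟨δ / 8 / (4 * v), C, by positivity, by linarith, fun n m w ρ t hw hwn hρ hρn ht hm => ?_⟩
  have hw2 : 2 ≤ w := u1.trans hw
  have hw0 : 0 < w := by linarith
  have hnw : w ≤ n := by rw [← hwn]; exact le_self_pow₀ (by linarith) (by norm_num)
  have hn16 : (16 : ℝ) ≤ n := by
    rw [← hwn]
    calc (16 : ℝ) = 2 ^ 4 := by norm_num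
      _ ≤ _ := by gcongr
  have hn0 : (0 : ℝ) < n := by linarith
  have hρw : w ^ 3 ≤ ρ := by
    have : 1 * w ^ 3 ≤ C * w ^ 3 := mul_le_mul_of_nonneg_right (by linarith) (by positivity)
    linarith
  have hww : w ≤ w ^ 3 := le_self_pow₀ (by linarith) (by norm_num)
  have hρ0 : 0 < ρ := by linarith
  have hρ2 : 2 * ρ ≤ n := (mul_le_mul_of_nonneg_right u1 hρ0.le).trans hρn
  have hpn : (n : ℝ) / 2 ≤ p * n := by
    have := mul_le_mul_of_nonneg_right hp hn0.le
    linarith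
  have hcard := card_edgeIdx n
  have hchoose : (n.choose 2 : ℝ) = Fintype.card (EdgeIdx n) := by
    rw [Nat.cast_choose_two]
    linarith
  set N : ℝ := (Fintype.card (EdgeIdx n) : ℝ) with hN
  have hmC : |(m : ℝ) - p * N| ≤ |C₀| := by
    rw [← hchoose]
    exact hm.trans (le_abs_self _)
  have hmC' := abs_le.1 hmC
  have hNn : (n : ℝ) ≤ N := by
    have := mul_le_mul_of_nonneg_right hn16 hn0.le
    linarith
  have hmN : m ≤ Fintype.card (EdgeIdx n) := by
    have h1 : (1 - p) * C ≤ (1 - p) * N := mul_le_mul_of_nonneg_left (by linarith) h1p.le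
    have h2 : (m : ℝ) ≤ N := by linarith [abs_nonneg C₀]
    rw [hN] at h2
    exact_mod_cast h2
  have hmn : p * n - c ≤ 2 * m / n := by
    rw [le_div_iff₀ hn0]
    have h1 : |C₀| * 1 ≤ |C₀| * n := mul_le_mul_of_nonneg_left (by linarith) (abs_nonneg _)
    have h2 : p * n ≤ 1 * n := mul_le_mul_of_nonneg_right hp1.le hn0.le
    have h3 : p * (n + 2 * N) = p * (n : ℝ) ^ 2 := by rw [hcard]
    rw [hc]
    linarith
  have hup := bernProb_deficit_not_isolated_le (m := m) hp0.le hp1.le hv0 hv hδ0 hδ1 hδε he0 he1 he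
    hB (by linarith) hKK (show 0 ≤ c by positivity) (by linarith) u2 u3 u4 u5 u6
    (by exact_mod_cast (show (2 : ℝ) ≤ n by linarith)) (by linarith) hwn hρ (by linarith)
    (by linarith) hmn
  have hlow := exp_le_bernProb_fewTriangles hp hp1 hv0 hδ'0 hδ'p hη0 hη1 hKL (le_max_left 1 c')
    (fun q h1 h2 b => (hc' q h1 h2 b).trans (le_max_right 1 c')) (by linarith) l1 l2 l3
    (by linarith) (by linarith) (by linarith) hwn hρ hρn (s2.trans hw) (s3.trans hw)
    (s5 w hw) hmN hmC
  have ht' : ρ ^ 3 / (n : ℝ) ^ 3 = t := by rw [ht]; field_simp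
  have hD : 0 < (n : ℝ) * ((n : ℝ) - 1) * ((n : ℝ) - 2) :=
    mul_pos (mul_pos hn0 (by linarith)) (by linarith)
  have hτ : ∀ A : Matrix (Fin n) (Fin n) ℝ, triDensity A ≤ p ^ 3 - t ↔
      (A * A * A).trace ≤
        (p ^ 3 - ρ ^ 3 / (n : ℝ) ^ 3) * ((n : ℝ) * ((n : ℝ) - 1) * ((n : ℝ) - 2)) := fun A => by
    rw [ht', triDensity, div_le_iff₀ hD]
  have e1 : -(1 + ε) * t * (n : ℝ) ^ 3 = -(1 + ε) * ρ ^ 3 := by rw [ht]; ring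
  have e2 : -(1 - ε) * t * (n : ℝ) ^ 3 = -(1 - ε) * ρ ^ 3 := by rw [ht]; ring
  have e3 : ε * t * (n : ℝ) ^ 3 = ε * ρ ^ 3 := by rw [ht]; ring
  simp only [e1, e2, e3, hτ]
  refine le_trans ?_ (one_sub_div_le_condGrProb hp0 hp1 hup (Real.exp_pos _) hlow)
  rw [mul_div_assoc, ← Real.exp_sub]
  refine sub_le_sub_left (mul_le_mul_of_nonneg_left (Real.exp_le_exp.2 ?_) (by norm_num)) 1
  set R := ρ ^ 2 / (4 * v) with hR
  have hR0 : 0 ≤ R := by positivity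
  have h1 : δ / 8 / (4 * v) * w ≤ δ / 8 * R := by
    rw [hR, div_mul_eq_mul_div, ← mul_div_assoc]
    gcongr
    exact (by linarith : w ≤ ρ).trans (le_self_pow₀ (by linarith) (by norm_num))
  have h2 := mul_le_mul_of_nonneg_right hηδ hR0
  linarith

end Assembly

/-- Theorem `thm:large-p-triangle-count`, structural part:
conditioned on `τ(A_n) ≤ p³ - t_n`, with high probability
`λ_n(A_n)³ = -t_n n³ (1 - o(1))` and `λ_{n-1}(A_n)³ ≥ -o(t_n n³)`. -/
theorem extreme_eigenvalues_given_triangle_deficit_large_p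
    (p : ℝ) (hp₀ : 1 / 2 ≤ p) (hp₁ : p < 1)
    (m : ℕ → ℕ) (hm : ∃ C : ℝ, ∀ n : ℕ, |(m n : ℝ) - p * (n.choose 2 : ℝ)| ≤ C)
    (t : ℕ → ℝ)
    (ht₁ : Tendsto (fun n : ℕ => (n : ℝ) ^ ((3 : ℝ) / 4) * t n) atTop atTop)
    (ht₂ : Tendsto t atTop (nhds 0)) :
    ∀ ε : ℝ, 0 < ε →
      Tendsto
        (fun n : ℕ =>
          condGrProb n (m n)
            (fun A =>
              -(1 + ε) * t n * (n : ℝ) ^ 3 ≤ eigDesc A (n - 1) ^ 3 ∧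
              eigDesc A (n - 1) ^ 3 ≤ -(1 - ε) * t n * (n : ℝ) ^ 3 ∧
              -(ε * t n * (n : ℝ) ^ 3) ≤ eigDesc A (n - 2) ^ 3)
            (fun A => triDensity A ≤ p ^ 3 - t n))
        atTop (nhds 1) := by
  intro ε hε
  obtain ⟨C₀, hC₀⟩ := hm
  obtain ⟨κ, C, hκ, hC, hmain⟩ := exists_one_sub_exp_le_condGrProb hp₀ hp₁ hε C₀
  have hwT : Tendsto (fun n : ℕ => (n : ℝ) ^ ((1 : ℝ) / 4)) atTop atTop :=
    (tendsto_rpow_atTop (by norm_num)).comp tendsto_natCast_atTop_atTop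
  have hlim : Tendsto (fun n : ℕ => 1 - 3 * Real.exp (-(κ * (n : ℝ) ^ ((1 : ℝ) / 4)))) atTop
      (nhds 1) := by
    have h := (Real.tendsto_exp_neg_atTop_nhds_zero.comp (hwT.const_mul_atTop hκ)).const_mul 3
    simpa using h.const_sub 1
  refine tendsto_of_tendsto_of_tendsto_of_le_of_le' hlim tendsto_const_nhds ?_
    (Eventually.of_forall fun n => condGrProb_le_one _ _ _)
  have hC3 : 0 < C ^ 3 := by positivity
  filter_upwards [hwT.eventually_ge_atTop C, ht₁.eventually_ge_atTop (C ^ 3),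
    ht₂.eventually_le_const (show 0 < 1 / C ^ 3 by positivity)] with n hw h1 h2
  have hn0 : (0 : ℝ) ≤ n := n.cast_nonneg
  have hpow : ∀ k : ℕ, ((n : ℝ) ^ ((1 : ℝ) / 4)) ^ k = (n : ℝ) ^ ((1 : ℝ) / 4 * k) := fun k => by
    rw [← Real.rpow_natCast, ← Real.rpow_mul hn0]
  set w := (n : ℝ) ^ ((1 : ℝ) / 4)
  have hw0 : 0 < w := by linarith
  have hwn : w ^ 4 = n := by
    rw [hpow]
    norm_num
  have hw3 : (n : ℝ) ^ ((3 : ℝ) / 4) = w ^ 3 := by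
    rw [hpow]
    norm_num
  rw [hw3] at h1
  rw [le_div_iff₀ hC3] at h2
  have ht0 : 0 < t n := pos_of_mul_pos_right (hC3.trans_le h1) (by positivity)
  have hρ3 : ((t n * (n : ℝ) ^ 3) ^ ((1 : ℝ) / 3)) ^ 3 = t n * (n : ℝ) ^ 3 := by
    rw [← Real.rpow_natCast, ← Real.rpow_mul (by positivity)]
    norm_num
  refine hmain n (m n) w ((t n * (n : ℝ) ^ 3) ^ ((1 : ℝ) / 3)) (t n) hw hwn ?_ ?_ hρ3 (hC₀ n)
  · refine (pow_le_pow_iff_left₀ (by positivity) (by positivity) three_ne_zero).1 ?_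
    rw [hρ3, ← hwn]
    calc (C * w ^ 3) ^ 3 = C ^ 3 * w ^ 9 := by ring
      _ ≤ w ^ 3 * t n * w ^ 9 := by gcongr
      _ = _ := by ring
  · refine (pow_le_pow_iff_left₀ (by positivity) hn0 three_ne_zero).1 ?_
    rw [mul_pow, hρ3]
    calc C ^ 3 * (t n * (n : ℝ) ^ 3) = t n * C ^ 3 * (n : ℝ) ^ 3 := by ring
      _ ≤ 1 * (n : ℝ) ^ 3 := by gcongr
      _ = _ := one_mul _

end
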